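/- arXiv:2008.06815 — 7 statements merged into one kernel-verified Lean document; each statement's English description precedes it below -/
import Mathlib

section
/- Let n ≥ 1 and let Ω ⊊ ℝⁿ be a nonempty open convex proper subset of ℝⁿ which is NOT an open half-space, i.e. there are no nonzero v ∈ ℝⁿ and c ∈ ℝ with Ω = {x : v·x > c}. Suppose u ∈ C²(Ω) ∩ C⁰(cl Ω) satisfies the minimal surface equation ∑_{i=1}^n D_i( D_i u / √(1+|Du|²) ) = 0 at every point of Ω, and u = l on the topological frontier ∂Ω, where l : ℝⁿ → ℝ is an affine function. Then u = l on all of cl Ω. -/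
open Set Metric MeasureTheory
open scoped RealInnerProductSpace ENNReal

/-- The `i`-th partial derivative of `u` at `x`. -/
noncomputable def pderiv' {n : ℕ} (u : EuclideanSpace ℝ (Fin n) → ℝ) (i : Fin n)
    (x : EuclideanSpace ℝ (Fin n)) : ℝ :=
  fderiv ℝ u x (EuclideanSpace.single i 1)

/-- The squared norm of the gradient of `u` at `x`: `|Du|² = ∑ᵢ (Dᵢu)²`. -/
noncomputable def gradSq {n : ℕ} (u : EuclideanSpace ℝ (Fin n) → ℝ)
    (x : EuclideanSpace ℝ (Fin n)) : ℝ :=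
  ∑ i, (pderiv' u i x) ^ 2

/-- `u` satisfies the minimal surface equation
`∑ᵢ Dᵢ( Dᵢu / √(1+|Du|²) ) = 0` at every point of `Ω`. -/
def MinimalSurfaceEq {n : ℕ} (u : EuclideanSpace ℝ (Fin n) → ℝ)
    (Ω : Set (EuclideanSpace ℝ (Fin n))) : Prop :=
  ∀ x ∈ Ω,
    ∑ i, pderiv' (fun y => pderiv' u i y / Real.sqrt (1 + gradSq u y)) i x = 0

/-! ### Second order consequences of the minimal surface equation -/

/-- Non-divergence form of the minimal surface equation, together with second order Taylor
expansions along lines. -/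
def NonDiv {n : ℕ} (u : EuclideanSpace ℝ (Fin n) → ℝ)
    (Ω : Set (EuclideanSpace ℝ (Fin n))) : Prop :=
  ∀ x ∈ Ω, ∃ (p : EuclideanSpace ℝ (Fin n))
    (b : EuclideanSpace ℝ (Fin n) →L[ℝ] EuclideanSpace ℝ (Fin n) →L[ℝ] ℝ),
    (∀ ζ : EuclideanSpace ℝ (Fin n),
      (fun t : ℝ => u (x + t • ζ) - u x - t * ⟪p, ζ⟫ - t ^ 2 / 2 * b ζ ζ)
        =o[nhds 0] (fun t : ℝ => t ^ 2)) ∧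
    (1 + ‖p‖ ^ 2) * ∑ i, b (EuclideanSpace.single i 1) (EuclideanSpace.single i 1) - b p p = 0

theorem NonDiv.neg {n : ℕ} {u : EuclideanSpace ℝ (Fin n) → ℝ}
    {Ω : Set (EuclideanSpace ℝ (Fin n))} (h : NonDiv u Ω) : NonDiv (fun x => - u x) Ω := by
  intro x hx
  obtain ⟨p, b, h1, h2⟩ := h x hx
  refine ⟨-p, -b, ?_, ?_⟩
  · intro ζ
    refine (h1 ζ).neg_left.congr_left ?_
    intro t
    simp only [inner_neg_left, neg_apply]
    ring
  · simp only [norm_neg, neg_apply, map_neg, Finset.sum_neg_distrib, neg_neg]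
    linarith

/-- Second-order necessary condition. -/
theorem second_order {c1 c2 : ℝ} {r : ℝ → ℝ} (hr : r =o[nhds 0] (fun t : ℝ => t ^ 2))
    (h : ∀ᶠ t in nhds (0 : ℝ), c1 * t + c2 * t ^ 2 + r t ≤ 0) : c1 = 0 ∧ c2 ≤ 0 := by
  have key : ∀ ε > 0, ∃ η > 0, ∀ t : ℝ, |t| < η → c1 * t + c2 * t ^ 2 - ε * t ^ 2 ≤ 0 := by
    intro ε hε
    have := (hr.def hε).and h
    obtain ⟨η, hη, hh⟩ := Metric.eventually_nhds_iff.1 this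
    refine ⟨η, hη, fun t ht => ?_⟩
    obtain ⟨h1, h2⟩ := hh (y := t) (by simpa [Real.dist_eq] using ht)
    rw [Real.norm_eq_abs, Real.norm_eq_abs, abs_of_nonneg (sq_nonneg t)] at h1
    have := neg_abs_le (r t)
    linarith
  have hc1 : c1 = 0 := by
    obtain ⟨η, hη, hh⟩ := key 1 one_pos
    by_contra hne
    have hpos : 0 < |c1| := abs_pos.2 hne
    -- choose t = s * sign c1 small
    set M := |c2| + 2 with hM
    have hMpos : 0 < M := by positivity
    set s := min (η / 2) (|c1| / (2 * M)) with hs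
    have hspos : 0 < s := lt_min (by linarith) (by positivity)
    have hs1 : s < η := lt_of_le_of_lt (min_le_left _ _) (by linarith)
    have hs2 : s * (2 * M) ≤ |c1| := by
      have := min_le_right (η / 2) (|c1| / (2 * M))
      rwa [← hs, le_div_iff₀ (by positivity)] at this
    have hc2 : -M + 1 ≤ c2 - 1 := by
      have := neg_abs_le c2
      linarith
    rcases lt_or_gt_of_ne hne with hneg | hpos'
    · have h1 := hh (-s) (by rw [abs_neg, abs_of_pos hspos]; exact hs1)
      rw [abs_of_neg hneg] at hs2
      nlinarith [mul_pos hspos hspos]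
    · have h1 := hh s (by rw [abs_of_pos hspos]; exact hs1)
      rw [abs_of_pos hpos'] at hs2
      nlinarith [mul_pos hspos hspos]
  refine ⟨hc1, ?_⟩
  by_contra hc
  push Not at hc
  obtain ⟨η, hη, hh⟩ := key (c2 / 2) (by linarith)
  have h1 := hh (η / 2) (by rw [abs_of_pos (by linarith)]; linarith)
  rw [hc1] at h1
  nlinarith [mul_pos hη hη, mul_pos hc (mul_pos hη hη)]

theorem trace_nonpos {n : ℕ}
    (B : EuclideanSpace ℝ (Fin n) →L[ℝ] EuclideanSpace ℝ (Fin n) →L[ℝ] ℝ)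
    (hB : ∀ ξ, B ξ ξ ≤ 0) (p : EuclideanSpace ℝ (Fin n)) :
    (1 + ‖p‖ ^ 2) * ∑ i, B (EuclideanSpace.single i 1) (EuclideanSpace.single i 1)
      - B p p ≤ 0 := by
  set ε : Fin n → EuclideanSpace ℝ (Fin n) := fun i => EuclideanSpace.single i 1 with hε
  have hp : p = ∑ i, p i • ε i := by
    have := (EuclideanSpace.basisFun (Fin n) ℝ).sum_repr p
    simpa using this.symm
  have hBp : B p p = ∑ i, ∑ j, p i * p j * B (ε i) (ε j) := by
    conv_lhs => rw [hp]
    simp only [map_sum, map_smul, sum_apply, smul_apply,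
      smul_eq_mul, Finset.mul_sum]
    rw [Finset.sum_comm]
    refine Finset.sum_congr rfl fun i _ => Finset.sum_congr rfl fun j _ => by ring
  have hn : ‖p‖ ^ 2 = ∑ i, p i ^ 2 := EuclideanSpace.real_norm_sq_eq p
  have h1 : ∑ i, B (ε i) (ε i) ≤ 0 := Finset.sum_nonpos fun i _ => hB _
  have h2 : ∑ i, ∑ j, B (p i • ε j - p j • ε i) (p i • ε j - p j • ε i) ≤ 0 :=
    Finset.sum_nonpos fun i _ => Finset.sum_nonpos fun j _ => hB _
  have h3 : ∑ i, ∑ j, B (p i • ε j - p j • ε i) (p i • ε j - p j • ε i)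
      = 2 * (‖p‖ ^ 2 * ∑ i, B (ε i) (ε i) - B p p) := by
    have : ∀ i j, B (p i • ε j - p j • ε i) (p i • ε j - p j • ε i)
      = p i ^ 2 * B (ε j) (ε j) + p j ^ 2 * B (ε i) (ε i) - p i * p j * B (ε i) (ε j)
        - p j * p i * B (ε j) (ε i) := by
      intro i j
      simp only [map_sub, map_smul, sub_apply, smul_apply,
        smul_eq_mul]
      ring
    simp only [this, Finset.sum_add_distrib, Finset.sum_sub_distrib]
    rw [Finset.sum_comm (f := fun i j => p j ^ 2 * B (ε i) (ε i)),
      Finset.sum_comm (f := fun i j => p j * p i * B (ε j) (ε i)), ← hBp, hn,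
      Finset.sum_mul_sum]
    ring
  nlinarith

theorem touching {n : ℕ} {u : EuclideanSpace ℝ (Fin n) → ℝ}
    {Ω : Set (EuclideanSpace ℝ (Fin n))} (hN : NonDiv u Ω)
    {x G e : EuclideanSpace ℝ (Fin n)} (hx : x ∈ Ω) {g A κ : ℝ}
    (h : ∀ᶠ ξ in nhds (0 : EuclideanSpace ℝ (Fin n)),
      ⟪G, ξ⟫ + g * (u (x + ξ) - u x) + A * ⟪e, ξ⟫ ^ 2
        - κ * (‖ξ‖ ^ 2 + (u (x + ξ) - u x) ^ 2) ≤ 0) :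
    ∃ p : EuclideanSpace ℝ (Fin n), G = - (g • p) ∧
      A * ((1 + ‖p‖ ^ 2) * ‖e‖ ^ 2 - ⟪p, e⟫ ^ 2) ≤ κ * n * (1 + ‖p‖ ^ 2) := by
  obtain ⟨p, b, h1, h2⟩ := hN x hx
  have main : ∀ ζ : EuclideanSpace ℝ (Fin n), ⟪G, ζ⟫ + g * ⟪p, ζ⟫ = 0 ∧
      g / 2 * b ζ ζ + A * ⟪e, ζ⟫ ^ 2 - κ * (‖ζ‖ ^ 2 + ⟪p, ζ⟫ ^ 2) ≤ 0 := by
    intro ζ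
    have hr := h1 ζ
    set r : ℝ → ℝ := fun t : ℝ => u (x + t • ζ) - u x - t * ⟪p, ζ⟫ - t ^ 2 / 2 * b ζ ζ with hrdef
    have hd : ∀ t : ℝ, u (x + t • ζ) - u x = t * ⟪p, ζ⟫ + t ^ 2 / 2 * b ζ ζ + r t := by
      intro t; simp only [hrdef]; ring
    have htend : Filter.Tendsto (fun t : ℝ => t • ζ) (nhds 0) (nhds 0) := by
      have : Continuous (fun t : ℝ => t • ζ) := by fun_prop
      simpa using this.tendsto 0
    have hev := htend.eventually h
    -- remainder
    have hrest : (fun t : ℝ => g * r t - κ * ((t * ⟪p, ζ⟫ + t ^ 2 / 2 * b ζ ζ + r t) ^ 2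
        - t ^ 2 * ⟪p, ζ⟫ ^ 2)) =o[nhds 0] (fun t : ℝ => t ^ 2) := by
      refine (hr.const_mul_left g).sub (Asymptotics.IsLittleO.const_mul_left ?_ κ)
      have heq : ∀ t : ℝ, (t * ⟪p, ζ⟫ + t ^ 2 / 2 * b ζ ζ + r t) ^ 2 - t ^ 2 * ⟪p, ζ⟫ ^ 2
          = t ^ 2 * (t * (⟪p, ζ⟫ * b ζ ζ) + t ^ 2 * (b ζ ζ ^ 2 / 4))
            + r t * (2 * t * ⟪p, ζ⟫ + t ^ 2 * b ζ ζ + r t) := by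
        intro t; ring
      refine Asymptotics.IsLittleO.congr_left ?_ (fun t => (heq t).symm)
      have hr0 : Filter.Tendsto r (nhds 0) (nhds 0) := by
        refine hr.trans_tendsto ?_
        have : Continuous (fun t : ℝ => t ^ 2) := by fun_prop
        simpa using this.tendsto 0
      refine Asymptotics.IsLittleO.add ?_ ?_
      · have : (fun t : ℝ => t * (⟪p, ζ⟫ * b ζ ζ) + t ^ 2 * (b ζ ζ ^ 2 / 4)) =o[nhds 0]
            (fun _ : ℝ => (1 : ℝ)) := by
          rw [Asymptotics.isLittleO_one_iff]
          have : Continuous (fun t : ℝ => t * (⟪p, ζ⟫ * b ζ ζ) + t ^ 2 * (b ζ ζ ^ 2 / 4)) := by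
            fun_prop
          simpa using this.tendsto 0
        simpa using (Asymptotics.isBigO_refl (fun t : ℝ => t ^ 2) (nhds 0)).mul_isLittleO this
      · have : (fun t : ℝ => 2 * t * ⟪p, ζ⟫ + t ^ 2 * b ζ ζ + r t) =o[nhds 0]
            (fun _ : ℝ => (1 : ℝ)) := by
          rw [Asymptotics.isLittleO_one_iff]
          have h' : Continuous (fun t : ℝ => 2 * t * ⟪p, ζ⟫ + t ^ 2 * b ζ ζ) := by
            fun_prop
          simpa using (h'.tendsto 0).add hr0
        simpa using hr.mul this
    have := second_order (c1 := ⟪G, ζ⟫ + g * ⟪p, ζ⟫)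
      (c2 := g / 2 * b ζ ζ + A * ⟪e, ζ⟫ ^ 2 - κ * (‖ζ‖ ^ 2 + ⟪p, ζ⟫ ^ 2)) hrest ?_
    · exact this
    · filter_upwards [hev] with t ht
      rw [hd t] at ht
      simp only [inner_smul_right, norm_smul, Real.norm_eq_abs, mul_pow, sq_abs] at ht
      linarith
  refine ⟨p, ?_, ?_⟩
  · refine ext_inner_right ℝ fun ζ => ?_
    rw [inner_neg_left, inner_smul_left]
    have := (main ζ).1
    simp only [conj_trivial]
    linarith
  · obtain ⟨II, hII⟩ : ∃ II : EuclideanSpace ℝ (Fin n) →L[ℝ] EuclideanSpace ℝ (Fin n) →L[ℝ] ℝ,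
        ∀ v w, II v w = ⟪v, w⟫ :=
      ⟨(isBoundedBilinearMap_inner (𝕜 := ℝ)).toContinuousLinearMap, fun v w => rfl⟩
    set B : EuclideanSpace ℝ (Fin n) →L[ℝ] EuclideanSpace ℝ (Fin n) →L[ℝ] ℝ :=
      (g / 2) • b + A • ((innerSL ℝ e).smulRight (innerSL ℝ e))
        - κ • (II + (innerSL ℝ p).smulRight (innerSL ℝ p)) with hBdef
    have hBv : ∀ ζ, B ζ ζ =
        g / 2 * b ζ ζ + A * ⟪e, ζ⟫ ^ 2 - κ * (‖ζ‖ ^ 2 + ⟪p, ζ⟫ ^ 2) := by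
      intro ζ
      simp only [hBdef, sub_apply, add_apply,
        smul_apply, ContinuousLinearMap.smulRight_apply, innerSL_apply_apply,
        smul_eq_mul, hII, real_inner_self_eq_norm_sq]
      ring
    have ht := trace_nonpos B (fun ζ => by rw [hBv]; exact (main ζ).2) p
    simp only [hBv] at ht
    have hs : ∀ w : EuclideanSpace ℝ (Fin n),
        ∑ i, ⟪w, EuclideanSpace.single i (1 : ℝ)⟫ ^ 2 = ‖w‖ ^ 2 := by
      intro w
      rw [EuclideanSpace.real_norm_sq_eq]
      refine Finset.sum_congr rfl fun i _ => ?_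
      simp [EuclideanSpace.inner_single_right]
    simp only [Finset.sum_add_distrib, Finset.sum_sub_distrib, ← Finset.mul_sum, hs] at ht
    simp only [PiLp.norm_single, norm_one, one_pow, Finset.sum_const, Finset.card_univ,
      Fintype.card_fin, nsmul_eq_mul, mul_one, real_inner_self_eq_norm_sq] at ht
    rw [real_inner_comm p e] at ht
    nlinarith [congrArg (fun z => g / 2 * z) h2]

theorem nonDiv_of_mse {n : ℕ} {u : EuclideanSpace ℝ (Fin n) → ℝ}
    {Ω : Set (EuclideanSpace ℝ (Fin n))} (hopen : IsOpen Ω)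
    (hu2 : ContDiffOn ℝ 2 u Ω) (hmse : MinimalSurfaceEq u Ω) : NonDiv u Ω := by
  intro x hx
  have hcd : ∀ y ∈ Ω, ContDiffAt ℝ 2 u y := fun y hy => hu2.contDiffAt (hopen.mem_nhds hy)
  have hd1 : ∀ y ∈ Ω, HasFDerivAt u (fderiv ℝ u y) y := fun y hy =>
    ((hcd y hy).differentiableAt (by norm_num)).hasFDerivAt
  have hd2 : HasFDerivAt (fderiv ℝ u) (fderiv ℝ (fderiv ℝ u) x) x := by
    have : ContDiffAt ℝ 1 (fderiv ℝ u) x := (hcd x hx).fderiv_right (by norm_num)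
    exact (this.differentiableAt (by norm_num)).hasFDerivAt
  set b := fderiv ℝ (fderiv ℝ u) x with hb
  set p : EuclideanSpace ℝ (Fin n) :=
    (InnerProductSpace.toDual ℝ (EuclideanSpace ℝ (Fin n))).symm (fderiv ℝ u x) with hp
  have hpi : ∀ ζ, ⟪p, ζ⟫ = fderiv ℝ u x ζ := fun ζ => InnerProductSpace.toDual_symm_apply
  have hpi' : ∀ i, p i = pderiv' u i x := by
    intro i
    have := hpi (EuclideanSpace.single i 1)
    simpa [EuclideanSpace.inner_single_right, pderiv'] using this
  refine ⟨p, b, ?_, ?_⟩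
  · intro ζ
    have hcont : Continuous (fun t : ℝ => x + t • ζ) := by fun_prop
    have hmem : ∀ᶠ t : ℝ in nhds 0, x + t • ζ ∈ Ω := by
      refine hcont.continuousAt.eventually_mem (hopen.mem_nhds ?_)
      simpa using hx
    obtain ⟨η, hη, hball⟩ := Metric.eventually_nhds_iff_ball.1 hmem
    have hline : ∀ t : ℝ, HasDerivAt (fun t : ℝ => x + t • ζ) ζ t := by
      intro t
      simpa using ((hasDerivAt_id t).smul_const ζ).const_add x
    have key := Convex.isLittleO_pow_succ_real (n := 1) (x₀ := (0 : ℝ))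
      (f := fun t : ℝ => u (x + t • ζ) - t * ⟪p, ζ⟫ - t ^ 2 / 2 * b ζ ζ)
      (f' := fun t : ℝ => fderiv ℝ u (x + t • ζ) ζ - ⟪p, ζ⟫ - t * b ζ ζ)
      (convex_ball (0 : ℝ) η) (mem_ball_self hη) ?_ ?_
    · have hnh : nhdsWithin (0 : ℝ) (ball 0 η) = nhds 0 :=
        (isOpen_ball).nhdsWithin_eq (mem_ball_self hη)
      rw [hnh] at key
      refine key.congr (fun t => ?_) (fun t => ?_)
      · simp; ring
      · simp
    · intro t ht
      refine HasDerivAt.hasDerivWithinAt ?_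
      have h1 : HasDerivAt (fun t : ℝ => u (x + t • ζ)) (fderiv ℝ u (x + t • ζ) ζ) t :=
        (hd1 _ (hball t ht)).comp_hasDerivAt t (hline t)
      have h2 : HasDerivAt (fun t : ℝ => t * ⟪p, ζ⟫) ⟪p, ζ⟫ t := by
        simpa using (hasDerivAt_id t).mul_const ⟪p, ζ⟫
      have h3 : HasDerivAt (fun t : ℝ => t ^ 2 / 2 * b ζ ζ) (t * b ζ ζ) t := by
        have := ((hasDerivAt_pow 2 t).div_const 2).mul_const (b ζ ζ)
        convert! this using 1
        push_cast
        ring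
      exact (h1.sub h2).sub h3
    · have hnh : nhdsWithin (0 : ℝ) (ball 0 η) = nhds 0 :=
        (isOpen_ball).nhdsWithin_eq (mem_ball_self hη)
      rw [hnh]
      have h4 : HasDerivAt (fun t : ℝ => fderiv ℝ u (x + t • ζ)) (b ζ) 0 := by
        have : HasFDerivAt (fderiv ℝ u) b (x + (0 : ℝ) • ζ) := by simpa using hd2
        exact this.comp_hasDerivAt 0 (hline 0)
      have h5 : HasDerivAt (fun t : ℝ => fderiv ℝ u (x + t • ζ) ζ) (b ζ ζ) 0 := by
        have := h4.clm_apply (hasDerivAt_const 0 ζ)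
        simpa using this
      have h6 := h5.isLittleO
      refine h6.congr (fun t => ?_) (fun t => ?_)
      · simp [hpi]
      · simp
  · have hui : ∀ i, HasFDerivAt (fun y => pderiv' u i y)
        (b.flip (EuclideanSpace.single i 1)) x := by
      intro i
      have := hd2.clm_apply (hasFDerivAt_const (EuclideanSpace.single i (1 : ℝ)) x)
      simpa [pderiv'] using this
    have hg : HasFDerivAt (fun y => 1 + gradSq u y)
        (∑ j, (2 * pderiv' u j x) • (b.flip (EuclideanSpace.single j 1))) x := by
      have : HasFDerivAt (fun y => ∑ j, (pderiv' u j y) ^ 2)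
          (∑ j, (2 * pderiv' u j x) • (b.flip (EuclideanSpace.single j 1))) x := by
        refine HasFDerivAt.fun_sum fun j _ => ?_
        have := (hui j).pow 2
        simpa using this
      exact this.const_add 1
    have hgs : gradSq u x = ‖p‖ ^ 2 := by
      rw [EuclideanSpace.real_norm_sq_eq]
      simp only [gradSq, hpi']
    have hpos : 0 < 1 + gradSq u x := by rw [hgs]; positivity
    set w := Real.sqrt (1 + gradSq u x) with hw
    have hwpos : 0 < w := Real.sqrt_pos.2 hpos
    have hw2 : w ^ 2 = 1 + ‖p‖ ^ 2 := by rw [hw, Real.sq_sqrt hpos.le, hgs]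
    have hs := hg.sqrt hpos.ne'
    have hq : ∀ i, pderiv' (fun y => pderiv' u i y / Real.sqrt (1 + gradSq u y)) i x
        = (w ^ 2 * b (EuclideanSpace.single i 1) (EuclideanSpace.single i 1)
          - p i * ∑ j, p j * b (EuclideanSpace.single i 1) (EuclideanSpace.single j 1)) / w ^ 3 := by
      intro i
      have hinv := (hasDerivAt_inv (x := Real.sqrt (1 + gradSq u x))
        (by rw [← hw]; exact hwpos.ne')).comp_hasFDerivAt x hs
      have h1 := ((hui i).fun_mul hinv).fderiv
      simp only [div_eq_mul_inv]
      rw [pderiv']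
      simp only [Function.comp_def] at h1
      rw [h1]
      simp only [← hw, smul_apply, add_apply, sum_apply, ContinuousLinearMap.flip_apply,
        smul_eq_mul, ← hpi', mul_assoc, ← Finset.mul_sum]
      field_simp
      ring
    have h0 := hmse x hx
    simp only [hq, ← Finset.sum_div] at h0
    rw [div_eq_zero_iff] at h0
    have h0' := h0.resolve_right (by positivity)
    rw [Finset.sum_sub_distrib, ← Finset.mul_sum, hw2] at h0'
    have hpe : p = ∑ i, p i • EuclideanSpace.single i (1 : ℝ) := by
      have := (EuclideanSpace.basisFun (Fin n) ℝ).sum_repr p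
      simpa using this.symm
    have hBp : b p p = ∑ i, p i * ∑ j, p j * b (EuclideanSpace.single i 1)
        (EuclideanSpace.single j 1) := by
      conv_lhs => rw [hpe]
      simp only [map_sum, map_smul, sum_apply, smul_apply, smul_eq_mul, Finset.mul_sum]
      rw [Finset.sum_comm]
      refine Finset.sum_congr rfl fun i _ => Finset.sum_congr rfl fun j _ => by ring
    rw [hBp]
    have hfinal := h0'
    exact hfinal

/-! ### The slab case -/

/-- Elementary inequality behind the choice of the parameter `R` in the slab case. -/
theorem slab_const (N2 α b m w : ℝ) (n : ℕ) (hα : α ^ 2 ≤ N2) :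
    ∃ C : ℝ, 0 ≤ C ∧ ∀ R : ℝ, C + 2 ≤ R → ∀ s : ℝ, |s| ≤ w →
      n * (2 * (n * N2 + 1 + n) * s - (R * α + 2 * (s + m))) ^ 2
        < (n * N2 + 1) * (R ^ 2 * (1 + N2) - 4 * R * b
          + 4 * (n * N2 + 1 + n) * (s ^ 2 - w ^ 2) - (R * α + 2 * (s + m)) ^ 2) := by
  set K : ℝ := n * N2 + 1 + n with hK
  set c : ℝ := n * N2 + 1 with hc
  have hN2 : 0 ≤ N2 := (sq_nonneg α).trans hα
  have hn : (0 : ℝ) ≤ n := Nat.cast_nonneg n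
  have hc1 : 1 ≤ c := by rw [hc]; nlinarith [mul_nonneg hn hN2]
  set k : ℝ → ℝ := fun s => 2 * (s + m) - 2 * K * s with hk
  set c1 : ℝ → ℝ := fun s => c * (-4 * b - 4 * α * (s + m)) - n * (2 * α * k s) with hc1d
  set c0 : ℝ → ℝ := fun s => c * (4 * K * (s ^ 2 - w ^ 2) - 4 * (s + m) ^ 2) - n * k s ^ 2 with hc0d
  have hc1c : Continuous c1 := by simp only [hc1d, hk]; fun_prop
  have hc0c : Continuous c0 := by simp only [hc0d, hk]; fun_prop
  obtain ⟨C1, hC1⟩ := (isCompact_Icc (a := -w) (b := w)).exists_bound_of_continuousOn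
    hc1c.continuousOn
  obtain ⟨C0, hC0⟩ := (isCompact_Icc (a := -w) (b := w)).exists_bound_of_continuousOn
    hc0c.continuousOn
  refine ⟨|C1| + |C0|, by positivity, fun R hR s hs => ?_⟩
  have hs' : s ∈ Icc (-w) w := abs_le.1 hs
  have h1 := hC1 s hs'
  have h0 := hC0 s hs'
  rw [Real.norm_eq_abs] at h1 h0
  have h1' : -|C1| ≤ c1 s := by
    have := neg_abs_le (c1 s); have := le_abs_self C1; linarith
  have h0' : -|C0| ≤ c0 s := by
    have := neg_abs_le (c0 s); have := le_abs_self C0; linarith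
  have hR0 : 0 ≤ R := by have := abs_nonneg C1; have := abs_nonneg C0; linarith
  have hlead : 1 ≤ c * (1 + N2 - α ^ 2) - n * α ^ 2 := by
    have : n * α ^ 2 ≤ n * N2 := mul_le_mul_of_nonneg_left hα hn
    nlinarith
  have hid : (n * N2 + 1) * (R ^ 2 * (1 + N2) - 4 * R * b
          + 4 * K * (s ^ 2 - w ^ 2) - (R * α + 2 * (s + m)) ^ 2)
        - n * (2 * K * s - (R * α + 2 * (s + m))) ^ 2
      = R ^ 2 * (c * (1 + N2 - α ^ 2) - n * α ^ 2) + R * c1 s + c0 s := by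
    simp only [hc1d, hc0d, hk, hc]
    ring
  have hfin : 0 < R ^ 2 * (c * (1 + N2 - α ^ 2) - n * α ^ 2) + R * c1 s + c0 s := by
    have e1 : R ^ 2 * 1 ≤ R ^ 2 * (c * (1 + N2 - α ^ 2) - n * α ^ 2) :=
      mul_le_mul_of_nonneg_left hlead (sq_nonneg R)
    have e2 : R * (-|C1|) ≤ R * c1 s := mul_le_mul_of_nonneg_left h1' hR0
    have := abs_nonneg C1
    have := abs_nonneg C0
    nlinarith
  linarith

theorem le_sq_add_one (X : ℝ) : X ≤ X ^ 2 + 1 := by nlinarith [sq_nonneg (X - 1)]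

set_option maxHeartbeats 1000000 in
theorem slab_le {n : ℕ} {u : EuclideanSpace ℝ (Fin n) → ℝ}
    {Ω : Set (EuclideanSpace ℝ (Fin n))} (hopen : IsOpen Ω) (hN : NonDiv u Ω)
    (hu0 : ContinuousOn u (closure Ω)) {a e : EuclideanSpace ℝ (Fin n)} {b m w : ℝ}
    (hbdry : ∀ x ∈ frontier Ω, u x = ⟪a, x⟫ + b) (he : ‖e‖ = 1)
    (hs : ∀ x ∈ Ω, |⟪e, x⟫ - m| ≤ w) : ∀ x ∈ Ω, u x ≤ ⟪a, x⟫ + b := by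
  intro xs hxs
  refine le_of_forall_gt_imp_ge_of_dense fun zs hzs => ?_
  by_contra hcon
  push Not at hcon
  have hα : ⟪a, e⟫ ^ 2 ≤ ‖a‖ ^ 2 := by
    have := abs_real_inner_le_norm a e
    rw [he, mul_one] at this
    exact sq_le_sq' (by have := neg_abs_le ⟪a, e⟫; linarith) ((le_abs_self _).trans this)
  obtain ⟨C, hC0, hC⟩ := slab_const (‖a‖ ^ 2) ⟪a, e⟫ b m w n hα
  set K : ℝ := n * ‖a‖ ^ 2 + 1 + n with hK
  have hKpos : 0 < K := by rw [hK]; positivity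
  set l : EuclideanSpace ℝ (Fin n) → ℝ := fun x => ⟪a, x⟫ + b with hl
  have hgap : 0 < zs - l xs := by simp only [hl]; linarith
  obtain ⟨R, hR⟩ : ∃ R : ℝ, R = max (C + 2) ((‖xs‖ ^ 2 + zs ^ 2 + K * w ^ 2) / (zs - l xs)) :=
    ⟨_, rfl⟩
  have hR1 : C + 2 ≤ R := by rw [hR]; exact le_max_left _ _
  have hR2 : ‖xs‖ ^ 2 + zs ^ 2 + K * w ^ 2 ≤ R * (zs - l xs) := by
    rw [← div_le_iff₀ hgap, hR]; exact le_max_right _ _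
  have hRpos : 0 < R := by linarith
  have hscl : ∀ x ∈ closure Ω, |⟪e, x⟫ - m| ≤ w := by
    have hcl : IsClosed {x : EuclideanSpace ℝ (Fin n) | |⟪e, x⟫ - m| ≤ w} :=
      isClosed_le (by fun_prop) continuous_const
    intro x hx
    exact closure_minimal (fun y hy => hs y hy) hcl hx
  have hssq : ∀ x ∈ closure Ω, (⟪e, x⟫ - m) ^ 2 - w ^ 2 ≤ 0 := by
    intro x hx
    have := hscl x hx
    have h := abs_le.1 this
    nlinarith
  set Ψ : EuclideanSpace ℝ (Fin n) × ℝ → ℝ := fun q =>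
    R * (q.2 - l q.1) - ‖q.1‖ ^ 2 - q.2 ^ 2 + K * ((⟪e, q.1⟫ - m) ^ 2 - w ^ 2) with hΨ
  have hΨc : Continuous Ψ := by simp only [hΨ, hl]; fun_prop
  set S : Set (EuclideanSpace ℝ (Fin n) × ℝ) := {q | q.1 ∈ closure Ω ∧ 0 ≤ Ψ q} with hS
  have hSc : IsClosed S :=
    (isClosed_closure.preimage continuous_fst).inter (isClosed_le continuous_const hΨc)
  have hSb : Bornology.IsBounded S := by
    set Q : ℝ := R ^ 2 * ‖a‖ ^ 2 / 4 + R ^ 2 / 4 + R * |b| with hQ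
    have hQ0 : 0 ≤ Q := by positivity
    refine (isBounded_closedBall (x := (0 : EuclideanSpace ℝ (Fin n) × ℝ))
      (r := R * ‖a‖ / 2 + R / 2 + Q + 1)).subset ?_
    rintro ⟨x, z⟩ ⟨hx, hz⟩
    have h1 := hssq x hx
    have h2 : K * ((⟪e, x⟫ - m) ^ 2 - w ^ 2) ≤ 0 := mul_nonpos_of_nonneg_of_nonpos hKpos.le h1
    simp only [hΨ, hl] at hz
    have h3 : -⟪a, x⟫ ≤ ‖a‖ * ‖x‖ := by
      have := abs_real_inner_le_norm a x
      have := neg_abs_le ⟪a, x⟫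
      linarith
    have h4 := neg_abs_le b
    have h5 := le_abs_self z
    have h6 : R * (z - (⟪a, x⟫ + b)) ≤ R * (|z| + ‖a‖ * ‖x‖ + |b|) :=
      mul_le_mul_of_nonneg_left (by linarith) hRpos.le
    have h7 : (‖x‖ - R * ‖a‖ / 2) ^ 2 + (|z| - R / 2) ^ 2 ≤ Q := by
      have : |z| ^ 2 = z ^ 2 := sq_abs z
      rw [hQ]
      linarith
    have hx1 : ‖x‖ - R * ‖a‖ / 2 ≤ Q + 1 := by
      linarith [sq_nonneg (|z| - R / 2), le_sq_add_one (‖x‖ - R * ‖a‖ / 2)]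
    have hz1 : |z| - R / 2 ≤ Q + 1 := by
      linarith [le_sq_add_one (|z| - R / 2), sq_nonneg (‖x‖ - R * ‖a‖ / 2)]
    have hRa : 0 ≤ R * ‖a‖ := by positivity
    rw [mem_closedBall_zero_iff, Prod.norm_def]
    refine max_le ?_ ?_
    · simp only; linarith
    · simp only [Real.norm_eq_abs]; linarith
  have hScomp : IsCompact S := Metric.isCompact_of_isClosed_isBounded hSc hSb
  have hsS : (xs, zs) ∈ S := by
    refine ⟨subset_closure hxs, ?_⟩
    simp only [hΨ]
    linarith [mul_nonneg hKpos.le (sq_nonneg (⟪e, xs⟫ - m))]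
  have hfc : ContinuousOn (fun q : EuclideanSpace ℝ (Fin n) × ℝ => u q.1 - q.2) S := by
    refine ContinuousOn.sub ?_ continuous_snd.continuousOn
    exact hu0.comp continuous_fst.continuousOn (fun q hq => hq.1)
  obtain ⟨⟨x1, z1⟩, ⟨hx1, hz1⟩, hmax⟩ := hScomp.exists_isMaxOn ⟨_, hsS⟩ hfc
  have hT := hmax hsS
  simp only [Set.mem_ofPred_eq] at hT
  have hTpos : 0 < u x1 - z1 := by linarith
  have hx1Ω : x1 ∈ Ω := by
    by_contra hnot
    have hfr : x1 ∈ frontier Ω := by rw [hopen.frontier_eq]; exact ⟨hx1, hnot⟩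
    have h1 := hbdry x1 hfr
    have h2 := mul_nonpos_of_nonneg_of_nonpos hKpos.le (hssq x1 hx1)
    simp only [hΨ, hl] at hz1
    have h3 : R * (z1 - (⟪a, x1⟫ + b)) < 0 := mul_neg_of_pos_of_neg hRpos (by linarith)
    linarith [sq_nonneg ‖x1‖, sq_nonneg z1]
  -- below the touching height
  have hbelow : ∀ x ∈ Ω, Ψ (x, z1 + (u x - u x1)) ≤ 0 := by
    intro x hx
    by_contra hpos
    push Not at hpos
    have hcl : Continuous (fun ε : ℝ => Ψ (x, z1 + (u x - u x1) - ε)) := by fun_prop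
    have hev : ∀ᶠ ε : ℝ in nhds 0, 0 < Ψ (x, z1 + (u x - u x1) - ε) := by
      refine hcl.continuousAt.eventually_const_lt ?_
      simpa using hpos
    obtain ⟨η, hη, hh⟩ := Metric.eventually_nhds_iff.1 hev
    have h1 := hh (y := η / 2) (by
      rw [Real.dist_eq, sub_zero, abs_of_pos (by linarith)]; linarith)
    have hmem : (x, z1 + (u x - u x1) - η / 2) ∈ S := ⟨subset_closure hx, h1.le⟩
    have h2 := hmax hmem
    simp only [Set.mem_ofPred_eq] at h2
    linarith
  have hΨ0 : Ψ (x1, z1) = 0 := by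
    have := hbelow x1 hx1Ω
    rw [sub_self, add_zero] at this
    exact le_antisymm this hz1
  obtain ⟨s, hsdef⟩ : ∃ s : ℝ, s = ⟪e, x1⟫ - m := ⟨_, rfl⟩
  obtain ⟨p, hG, hineq⟩ := touching (G := -(R • a) - (2 : ℝ) • x1 + (2 * K * s) • e)
    (e := e) (g := R - 2 * z1) (A := K) (κ := 1) hN hx1Ω (by
      have hcont : Continuous (fun ξ : EuclideanSpace ℝ (Fin n) => x1 + ξ) := by fun_prop
      have hmem : ∀ᶠ ξ in nhds (0 : EuclideanSpace ℝ (Fin n)), x1 + ξ ∈ Ω :=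
        hcont.continuousAt.eventually_mem (hopen.mem_nhds (by simpa using hx1Ω))
      filter_upwards [hmem] with ξ hξ
      have h1 := hbelow _ hξ
      have h2 := hΨ0
      simp only [hΨ, hl, inner_add_right, ← hsdef] at h1 h2
      have h3 : ⟪e, x1⟫ = s + m := by linarith
      have h4 : ‖x1 + ξ‖ ^ 2 = ‖x1‖ ^ 2 + 2 * ⟪x1, ξ⟫ + ‖ξ‖ ^ 2 := norm_add_sq_real x1 ξ
      simp only [inner_add_left, inner_sub_left, inner_neg_left, real_inner_smul_left]
      rw [h3, h4] at h1
      linarith)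
  -- algebra
  have hsw : |s| ≤ w := by rw [hsdef]; exact hscl x1 hx1
  have hcontr := hC R hR1 s hsw
  have hex : ⟪x1, e⟫ = s + m := by rw [real_inner_comm, hsdef]; ring
  have hee : ⟪e, e⟫ = 1 := by rw [real_inner_self_eq_norm_sq, he]; norm_num
  set G := -(R • a) - (2 : ℝ) • x1 + (2 * K * s) • e with hGdef
  have hGe : ⟪G, e⟫ = 2 * K * s - (R * ⟪a, e⟫ + 2 * (s + m)) := by
    simp only [hGdef, inner_add_left, inner_sub_left, inner_neg_left, real_inner_smul_left, hex,
      hee]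
    ring
  have hGG : ‖G‖ ^ 2 = R ^ 2 * ‖a‖ ^ 2 + 4 * R * ⟪a, x1⟫ + 4 * ‖x1‖ ^ 2
      - 4 * K * s * (R * ⟪a, e⟫ + 2 * (s + m)) + 4 * K ^ 2 * s ^ 2 := by
    rw [← real_inner_self_eq_norm_sq, ← real_inner_self_eq_norm_sq, ← real_inner_self_eq_norm_sq]
    simp only [hGdef, inner_add_left, inner_sub_left, inner_neg_left, real_inner_smul_left,
      inner_add_right, inner_sub_right, inner_neg_right, real_inner_smul_right, hex, hee,
      real_inner_comm a e, real_inner_comm a x1, real_inner_comm x1 e]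
    ring
  have hGp : ‖G‖ ^ 2 = (R - 2 * z1) ^ 2 * ‖p‖ ^ 2 := by
    rw [hG, norm_neg, norm_smul, mul_pow, Real.norm_eq_abs, sq_abs]
  have hGpe : ⟪G, e⟫ = -((R - 2 * z1) * ⟪p, e⟫) := by
    rw [hG, inner_neg_left, real_inner_smul_left]
  have hΨ1 : R * (z1 - (⟪a, x1⟫ + b)) - ‖x1‖ ^ 2 - z1 ^ 2 + K * (s ^ 2 - w ^ 2) = 0 := by
    have := hΨ0
    simpa only [hΨ, hl, ← hsdef] using this
  have hmul : (K - n) * ((R - 2 * z1) ^ 2 + ‖G‖ ^ 2) ≤ K * ⟪G, e⟫ ^ 2 := by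
    rw [hGp, hGpe]
    rw [he] at hineq
    have := mul_le_mul_of_nonneg_left hineq (sq_nonneg (R - 2 * z1))
    linarith
  have hsum : (R - 2 * z1) ^ 2 + ‖G‖ ^ 2 = R ^ 2 * (1 + ‖a‖ ^ 2) - 4 * R * b
      + 4 * K * (s ^ 2 - w ^ 2) - 4 * K * s * (R * ⟪a, e⟫ + 2 * (s + m)) + 4 * K ^ 2 * s ^ 2 := by
    rw [hGG]
    linarith
  rw [hsum, hGe] at hmul
  have hKn : (n : ℝ) * ‖a‖ ^ 2 + 1 = K - n := by rw [hK]; ring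
  rw [hKn] at hcontr
  linarith

/-! ### The wedge case -/

theorem sqrt_lower_aux (r α β : ℝ) (hr : 0 < r) (h : α ^ 2 + β ^ 2 ≤ (r / 4) ^ 2) :
    r + α + β ^ 2 / (4 * r) ≤ √((r + α) ^ 2 + β ^ 2) := by
  apply Real.le_sqrt_of_sq_le
  have hα : α ≤ r / 4 := by
    have : α ^ 2 ≤ (r / 4) ^ 2 := by nlinarith [sq_nonneg β]
    exact (abs_le_of_sq_le_sq' this (by positivity)).2
  have e1 : (r + α + β ^ 2 / (4 * r)) ^ 2
      = (r + α) ^ 2 + β ^ 2 * ((r + α) / (2 * r) + (β ^ 2 / r ^ 2) / 16) := by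
    field_simp
    ring
  rw [e1]
  have h1 : (r + α) / (2 * r) ≤ 5 / 8 := by
    rw [div_le_iff₀ (by positivity)]; linarith
  have h2 : β ^ 2 / r ^ 2 ≤ 1 / 16 := by
    rw [div_le_iff₀ (by positivity)]; nlinarith [sq_nonneg α]
  have := mul_le_mul_of_nonneg_left
    (show (r + α) / (2 * r) + (β ^ 2 / r ^ 2) / 16 ≤ 1 by linarith) (sq_nonneg β)
  linarith

theorem sqrt_lower (s t ds dt r : ℝ) (hr : 0 < r) (hrr : r ^ 2 = s ^ 2 + t ^ 2)
    (h : ds ^ 2 + dt ^ 2 ≤ (r / 4) ^ 2) :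
    r + (s * ds + t * dt) / r + (t * ds - s * dt) ^ 2 / (4 * r ^ 3)
      ≤ √((s + ds) ^ 2 + (t + dt) ^ 2) := by
  have hid : ((s * ds + t * dt) / r) ^ 2 + ((t * ds - s * dt) / r) ^ 2 = ds ^ 2 + dt ^ 2 := by
    rw [div_pow, div_pow, ← add_div, div_eq_iff (by positivity), hrr]; ring
  have := sqrt_lower_aux r ((s * ds + t * dt) / r) ((t * ds - s * dt) / r) hr (by rw [hid]; exact h)
  have e1 : (r + (s * ds + t * dt) / r) ^ 2 + ((t * ds - s * dt) / r) ^ 2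
      = (s + ds) ^ 2 + (t + dt) ^ 2 := by
    have : (r + (s * ds + t * dt) / r) ^ 2
        = r ^ 2 + 2 * (s * ds + t * dt) + ((s * ds + t * dt) / r) ^ 2 := by
      field_simp
      ring
    rw [this, add_assoc, hid, hrr]; ring
  have e2 : ((t * ds - s * dt) / r) ^ 2 / (4 * r) = (t * ds - s * dt) ^ 2 / (4 * r ^ 3) := by
    field_simp
  rwa [e1, e2] at this

/-- The gradient estimate at a touching point. -/
theorem wedge_grad {E : Type*} [NormedAddCommGroup E] [InnerProductSpace ℝ E]
    (p a y ω : E) (g lam C0 r : ℝ) (hr : 0 < r) (hlam : 0 < lam) (hC0 : 0 < C0)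
    (hy : ‖y‖ = r) (hω : ‖ω‖ = r) (hyω : ⟪y, ω⟫ = 0)
    (hg : |g| * (1 + ‖p‖) ≤ C0) (hlow : lam * r / 2 ≤ g * ⟪p - a, y⟫) :
    r ^ 2 * (1 + ‖p‖ ^ 2)
      ≤ (2 * C0 / lam) ^ 2 * (1 + ‖a‖ ^ 2) * ((1 + ‖p‖ ^ 2) * ‖ω‖ ^ 2 - ⟪p, ω⟫ ^ 2) := by
  have hp0 := norm_nonneg p
  have ha0 := norm_nonneg a
  have hbess : ⟪p, y⟫ ^ 2 + ⟪p, ω⟫ ^ 2 ≤ ‖p‖ ^ 2 * r ^ 2 := by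
    -- Bessel's inequality
    have h0 : 0 ≤ ‖(r ^ 2) • p - ⟪p, y⟫ • y - ⟪p, ω⟫ • ω‖ ^ 2 := sq_nonneg _
    rw [← real_inner_self_eq_norm_sq] at h0
    have hωy : ⟪ω, y⟫ = 0 := by rw [real_inner_comm]; exact hyω
    have hyp : ⟪y, p⟫ = ⟪p, y⟫ := real_inner_comm _ _
    have hωp : ⟪ω, p⟫ = ⟪p, ω⟫ := real_inner_comm _ _
    have hyy : ⟪y, y⟫ = r ^ 2 := by rw [real_inner_self_eq_norm_sq, hy]
    have hωω : ⟪ω, ω⟫ = r ^ 2 := by rw [real_inner_self_eq_norm_sq, hω]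
    have hpp : ⟪p, p⟫ = ‖p‖ ^ 2 := real_inner_self_eq_norm_sq p
    simp only [inner_sub_left, inner_sub_right, real_inner_smul_left, real_inner_smul_right,
      hyy, hωω, hpp, hyω, hωy, hyp, hωp] at h0
    have hr2 : 0 < r ^ 2 := by positivity
    have : 0 ≤ r ^ 2 * (‖p‖ ^ 2 * r ^ 2 - (⟪p, y⟫ ^ 2 + ⟪p, ω⟫ ^ 2)) := by linarith
    have := nonneg_of_mul_nonneg_right this hr2
    linarith
  have hay : |⟪a, y⟫| ≤ ‖a‖ * r := by rw [← hy]; exact abs_real_inner_le_norm a y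
  set m := |⟪p, y⟫| with hm
  have hm0 : 0 ≤ m := abs_nonneg _
  have h1 : lam * r / 2 ≤ |g| * (m + ‖a‖ * r) := by
    refine hlow.trans ((le_abs_self _).trans ?_)
    rw [abs_mul, inner_sub_left]
    refine mul_le_mul_of_nonneg_left ?_ (abs_nonneg g)
    exact (abs_sub _ _).trans (by linarith)
  have h2 : lam * r * (1 + ‖p‖) ≤ 2 * C0 * (m + ‖a‖ * r) := by
    have := mul_le_mul_of_nonneg_right h1 (show 0 ≤ 1 + ‖p‖ by linarith)
    have := mul_le_mul_of_nonneg_right hg (show 0 ≤ m + ‖a‖ * r by positivity)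
    nlinarith
  have h3 : r * (1 + ‖p‖) ≤ 2 * C0 / lam * (m + ‖a‖ * r) := by
    rw [div_mul_eq_mul_div, le_div_iff₀ hlam]; linarith
  have h4 : (r * (1 + ‖p‖)) ^ 2 ≤ (2 * C0 / lam * (m + ‖a‖ * r)) ^ 2 :=
    pow_le_pow_left₀ (by positivity) h3 2
  have h5 : (m + ‖a‖ * r) ^ 2 ≤ (1 + ‖a‖ ^ 2) * (r ^ 2 + m ^ 2) := by
    nlinarith [sq_nonneg (m * ‖a‖ - r)]
  have h6 : r ^ 2 + m ^ 2 ≤ (1 + ‖p‖ ^ 2) * ‖ω‖ ^ 2 - ⟪p, ω⟫ ^ 2 := by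
    rw [hω, hm, sq_abs]; linarith
  calc r ^ 2 * (1 + ‖p‖ ^ 2) ≤ (r * (1 + ‖p‖)) ^ 2 := by
        rw [mul_pow]; exact mul_le_mul_of_nonneg_left (by nlinarith) (sq_nonneg r)
    _ ≤ (2 * C0 / lam * (m + ‖a‖ * r)) ^ 2 := h4
    _ = (2 * C0 / lam) ^ 2 * (m + ‖a‖ * r) ^ 2 := by ring
    _ ≤ (2 * C0 / lam) ^ 2 * ((1 + ‖a‖ ^ 2) * (r ^ 2 + m ^ 2)) :=
        mul_le_mul_of_nonneg_left h5 (sq_nonneg _)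
    _ ≤ (2 * C0 / lam) ^ 2 * ((1 + ‖a‖ ^ 2) * ((1 + ‖p‖ ^ 2) * ‖ω‖ ^ 2 - ⟪p, ω⟫ ^ 2)) := by
        refine mul_le_mul_of_nonneg_left ?_ (sq_nonneg _)
        exact mul_le_mul_of_nonneg_left h6 (by positivity)
    _ = _ := by ring

set_option maxHeartbeats 10000000 in
theorem wedge_step {n : ℕ} {u : EuclideanSpace ℝ (Fin n) → ℝ}
    {Ω : Set (EuclideanSpace ℝ (Fin n))} (hopen : IsOpen Ω) (hN : NonDiv u Ω)
    (hu0 : ContinuousOn u (closure Ω)) {a e1 e2 : EuclideanSpace ℝ (Fin n)} {b σ θ lam : ℝ}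
    (hbdry : ∀ x ∈ frontier Ω, u x = ⟪a, x⟫ + b) (he1 : ‖e1‖ = 1) (he2 : ‖e2‖ = 1)
    (he12 : ⟪e1, e2⟫ = 0) (hlam : 0 < lam) (hlam1 : lam ≤ 1)
    (hw : ∀ x ∈ Ω, 2 * lam * √((⟪e1, x⟫ - σ) ^ 2 + (⟪e2, x⟫ - θ) ^ 2) ≤ ⟪e1, x⟫ - σ)
    (hpos : ∀ x ∈ Ω, 0 < ⟪e1, x⟫ - σ) {τ : ℝ} (hτ : 0 ≤ τ)
    (hτh : ∀ x ∈ Ω, τ * (u x - (⟪a, x⟫ + b))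
      ≤ (⟪e1, x⟫ - σ) - lam * √((⟪e1, x⟫ - σ) ^ 2 + (⟪e2, x⟫ - θ) ^ 2)) :
    ∃ δ > 0, ∀ x ∈ Ω, (τ + δ) * (u x - (⟪a, x⟫ + b))
      ≤ (⟪e1, x⟫ - σ) - lam * √((⟪e1, x⟫ - σ) ^ 2 + (⟪e2, x⟫ - θ) ^ 2) := by
  set ρ : EuclideanSpace ℝ (Fin n) → ℝ :=
    fun x => √((⟪e1, x⟫ - σ) ^ 2 + (⟪e2, x⟫ - θ) ^ 2) with hρ
  have hρc : Continuous ρ := by simp only [hρ]; fun_prop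
  have ha0 : 0 ≤ ‖a‖ := norm_nonneg a
  have hn0 : (0 : ℝ) ≤ n := Nat.cast_nonneg n
  obtain ⟨C0, hC0⟩ : ∃ C0 : ℝ, C0 = τ * (1 + ‖a‖) + 6 := ⟨_, rfl⟩
  have hC0pos : 0 < C0 := by rw [hC0]; positivity
  obtain ⟨C1, hC1⟩ : ∃ C1 : ℝ, C1 = (2 * C0 / lam) ^ 2 * (1 + ‖a‖ ^ 2) := ⟨_, rfl⟩
  have hC1pos : 0 < C1 := by rw [hC1]; positivity
  obtain ⟨D, hD⟩ : ∃ D : ℝ, D = n * C1 * (3 * τ * (1 + ‖a‖) + 1) := ⟨_, rfl⟩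
  have hD0 : 0 ≤ D := by rw [hD]; positivity
  obtain ⟨δ, hδpos, hδ1, hδ2, hδ3⟩ : ∃ δ : ℝ, 0 < δ ∧ δ ≤ 1 ∧ δ * (4 * (1 + ‖a‖)) ≤ lam ∧
      4 * δ * D < lam ^ 2 := by
    refine ⟨min 1 (min (lam / (4 * (1 + ‖a‖))) (lam ^ 2 / (4 * (D + 1)))), ?_, ?_, ?_, ?_⟩
    · positivity
    · exact min_le_left _ _
    · rw [← le_div_iff₀ (by positivity)]
      exact (min_le_right _ _).trans (min_le_left _ _)
    · set q := min 1 (min (lam / (4 * (1 + ‖a‖))) (lam ^ 2 / (4 * (D + 1)))) with hq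
      have hq0 : 0 < q := by rw [hq]; positivity
      have : q ≤ lam ^ 2 / (4 * (D + 1)) := (min_le_right _ _).trans (min_le_right _ _)
      rw [le_div_iff₀ (by positivity)] at this
      linarith
  obtain ⟨c, hc⟩ : ∃ c : ℝ, c = 1 / (2 * (1 + ‖a‖)) := ⟨_, rfl⟩
  have hcpos : 0 < c := by rw [hc]; positivity
  have hca : c * (1 + ‖a‖) = 1 / 2 := by rw [hc]; field_simp
  -- pass to the closure
  have hwcl : ∀ x ∈ closure Ω, 2 * lam * ρ x ≤ ⟪e1, x⟫ - σ := by
    have hcl : IsClosed {x : EuclideanSpace ℝ (Fin n) | 2 * lam * ρ x ≤ ⟪e1, x⟫ - σ} :=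
      isClosed_le (by fun_prop) (by fun_prop)
    intro x hx
    exact closure_minimal (fun y hy => hw y hy) hcl hx
  have hτcl : ∀ x ∈ closure Ω, τ * (u x - (⟪a, x⟫ + b)) ≤ (⟪e1, x⟫ - σ) - lam * ρ x := by
    intro x hx
    by_cases hxΩ : x ∈ Ω
    · exact hτh x hxΩ
    · have hfr : x ∈ frontier Ω := by rw [hopen.frontier_eq]; exact ⟨hx, hxΩ⟩
      rw [hbdry x hfr, sub_self, mul_zero]
      have h1 := hwcl x hx
      have h2 : 0 ≤ lam * ρ x := mul_nonneg hlam.le (Real.sqrt_nonneg _)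
      linarith
  refine ⟨δ * c, mul_pos hδpos hcpos, fun x0 hx0 => ?_⟩
  by_contra hcon
  push Not at hcon
  have hL0 : 0 < u x0 - (⟪a, x0⟫ + b) := by
    by_contra hle
    push Not at hle
    have h1 := hwcl x0 (subset_closure hx0)
    have h2 : 0 ≤ lam * ρ x0 := mul_nonneg hlam.le (Real.sqrt_nonneg _)
    have h3 : (τ + δ * c) * (u x0 - (⟪a, x0⟫ + b)) ≤ 0 :=
      mul_nonpos_of_nonneg_of_nonpos (by positivity) hle
    linarith
  obtain ⟨L0, hL0d⟩ : ∃ L0 : ℝ, L0 = u x0 - (⟪a, x0⟫ + b) := ⟨_, rfl⟩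
  rw [← hL0d] at hL0 hcon
  obtain ⟨R, hR⟩ : ∃ R : ℝ, R = c * L0 := ⟨_, rfl⟩
  have hRpos : 0 < R := by rw [hR]; positivity
  have hRL : L0 = 2 * (1 + ‖a‖) * R := by
    rw [hR]; linear_combination (-2 * L0) * hca
  obtain ⟨κ, hκ⟩ : ∃ κ : ℝ, κ = δ / R := ⟨_, rfl⟩
  have hκpos : 0 < κ := by rw [hκ]; positivity
  have hκR : κ * R = δ := by rw [hκ]; field_simp
  set F : EuclideanSpace ℝ (Fin n) → ℝ := fun x =>
    τ * (u x - (⟪a, x⟫ + b)) - ((⟪e1, x⟫ - σ) - lam * ρ x) + δ * R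
      - κ * (‖x - x0‖ ^ 2 + (u x - u x0) ^ 2) with hF
  have hFc : ContinuousOn F (closure Ω ∩ closedBall x0 R) := by
    have hu' : ContinuousOn u (closure Ω ∩ closedBall x0 R) := hu0.mono inter_subset_left
    have hρ' : ContinuousOn ρ (closure Ω ∩ closedBall x0 R) := hρc.continuousOn
    simp only [hF]
    fun_prop
  have hKc : IsCompact (closure Ω ∩ closedBall x0 R) :=
    (isCompact_closedBall x0 R).inter_left isClosed_closure
  have hx0K : x0 ∈ closure Ω ∩ closedBall x0 R :=
    ⟨subset_closure hx0, mem_closedBall_self hRpos.le⟩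
  obtain ⟨x1, ⟨hx1, hx1b⟩, hmax⟩ := hKc.exists_isMaxOn ⟨_, hx0K⟩ hFc
  have hF0 : 0 < F x0 := by
    simp only [hF, sub_self, norm_zero, ← hL0d]
    rw [hR]
    linarith
  have hF1 : 0 < F x1 := hF0.trans_le (hmax hx0K)
  obtain ⟨L1, hL1d⟩ : ∃ L1 : ℝ, L1 = u x1 - (⟪a, x1⟫ + b) := ⟨_, rfl⟩
  have hτ1 := hτcl x1 hx1
  have hF1' : 0 < τ * L1 - ((⟪e1, x1⟫ - σ) - lam * ρ x1) + δ * R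
      - κ * (‖x1 - x0‖ ^ 2 + (u x1 - u x0) ^ 2) := by
    rw [hL1d]; exact hF1
  rw [← hL1d] at hτ1
  have hin : ‖x1 - x0‖ ^ 2 + (u x1 - u x0) ^ 2 < R ^ 2 := by
    have h1 : κ * (‖x1 - x0‖ ^ 2 + (u x1 - u x0) ^ 2) < κ * R ^ 2 := by
      have : κ * R ^ 2 = δ * R := by rw [← hκR]; ring
      linarith
    exact lt_of_mul_lt_mul_left h1 hκpos.le
  have hnx : ‖x1 - x0‖ < R :=
    lt_of_pow_lt_pow_left₀ 2 hRpos.le (by linarith [sq_nonneg (u x1 - u x0)])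
  have hnu : |u x1 - u x0| < R :=
    abs_lt_of_sq_lt_sq (by linarith [sq_nonneg ‖x1 - x0‖]) hRpos.le
  have hLdiff : |L1 - L0| ≤ (1 + ‖a‖) * R := by
    have e : L1 - L0 = (u x1 - u x0) - ⟪a, x1 - x0⟫ := by
      rw [hL1d, hL0d, inner_sub_right]; ring
    rw [e]
    have h1 := abs_real_inner_le_norm a (x1 - x0)
    have h2 : ‖a‖ * ‖x1 - x0‖ ≤ ‖a‖ * R := mul_le_mul_of_nonneg_left hnx.le ha0
    refine (abs_sub _ _).trans ?_
    linarith
  have hLd := abs_le.1 hLdiff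
  have haR : 0 < (1 + ‖a‖) * R := by positivity
  have hL1pos : 0 < L1 := by linarith [hLd.1]
  have hL1le : L1 ≤ 3 * (1 + ‖a‖) * R := by linarith [hLd.2]
  have hx1Ω : x1 ∈ Ω := by
    by_contra hnot
    have hfr : x1 ∈ frontier Ω := by rw [hopen.frontier_eq]; exact ⟨hx1, hnot⟩
    have h1 := hbdry x1 hfr
    linarith
  -- the geometry at the touching point
  obtain ⟨s, hs⟩ : ∃ s : ℝ, s = ⟪e1, x1⟫ - σ := ⟨_, rfl⟩
  obtain ⟨t, ht⟩ : ∃ t : ℝ, t = ⟪e2, x1⟫ - θ := ⟨_, rfl⟩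
  obtain ⟨r, hr⟩ : ∃ r : ℝ, r = ρ x1 := ⟨_, rfl⟩
  have hspos : 0 < s := by rw [hs]; exact hpos x1 hx1Ω
  have hrsq : r ^ 2 = s ^ 2 + t ^ 2 := by
    rw [hr, hs, ht]; simp only [hρ]; exact Real.sq_sqrt (by positivity)
  have hrpos : 0 < r := by
    have h0 : 0 ≤ r := by rw [hr]; exact Real.sqrt_nonneg _
    rcases h0.lt_or_eq with h | h
    · exact h
    · have h2 : 0 < s ^ 2 := by positivity
      rw [← h] at hrsq
      linarith only [hrsq, h2, sq_nonneg t]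
  have hsr : 2 * lam * r ≤ s := by rw [hr, hs]; exact hwcl x1 hx1
  have he11 : ⟪e1, e1⟫ = 1 := by rw [real_inner_self_eq_norm_sq, he1]; norm_num
  have he22 : ⟪e2, e2⟫ = 1 := by rw [real_inner_self_eq_norm_sq, he2]; norm_num
  have he21 : ⟪e2, e1⟫ = 0 := by rw [real_inner_comm]; exact he12
  obtain ⟨y, hy⟩ : ∃ y, y = s • e1 + t • e2 := ⟨_, rfl⟩
  obtain ⟨ω, hω⟩ : ∃ ω, ω = t • e1 - s • e2 := ⟨_, rfl⟩
  have hyy : ⟪y, y⟫ = r ^ 2 := by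
    rw [hy, hrsq]
    simp only [inner_add_left, inner_add_right, real_inner_smul_left, real_inner_smul_right,
      he11, he12, he21, he22]
    ring
  have hωω : ⟪ω, ω⟫ = r ^ 2 := by
    rw [hω, hrsq]
    simp only [inner_sub_left, inner_sub_right, real_inner_smul_left, real_inner_smul_right,
      he11, he12, he21, he22]
    ring
  have hyω : ⟪y, ω⟫ = 0 := by
    rw [hy, hω]
    simp only [inner_add_left, inner_sub_right, real_inner_smul_left, real_inner_smul_right,
      he11, he12, he21, he22]
    ring
  have hyn : ‖y‖ = r := by
    rw [real_inner_self_eq_norm_sq] at hyy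
    exact (pow_left_inj₀ (norm_nonneg _) hrpos.le two_ne_zero).1 hyy
  have hωn : ‖ω‖ = r := by
    rw [real_inner_self_eq_norm_sq] at hωω
    exact (pow_left_inj₀ (norm_nonneg _) hrpos.le two_ne_zero).1 hωω
  obtain ⟨G, hG⟩ : ∃ G, G = -(τ • a) - e1 + (lam / r) • y - (2 * κ) • (x1 - x0) := ⟨_, rfl⟩
  obtain ⟨g, hg⟩ : ∃ g : ℝ, g = τ - 2 * κ * (u x1 - u x0) := ⟨_, rfl⟩
  obtain ⟨p, hGp, hineq⟩ := touching (G := G) (e := ω) (g := g) (A := lam / (4 * r ^ 3)) (κ := κ)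
    hN hx1Ω (by
      have hcont : Continuous (fun ξ : EuclideanSpace ℝ (Fin n) => x1 + ξ) := by fun_prop
      have hmem : ∀ᶠ ξ in nhds (0 : EuclideanSpace ℝ (Fin n)), x1 + ξ ∈ Ω ∩ ball x0 R := by
        refine hcont.continuousAt.eventually_mem ((hopen.inter isOpen_ball).mem_nhds ?_)
        rw [add_zero]
        exact ⟨hx1Ω, by rw [mem_ball, dist_eq_norm]; exact hnx⟩
      have hsmall : ∀ᶠ ξ in nhds (0 : EuclideanSpace ℝ (Fin n)), ξ ∈ ball 0 (r / 8) :=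
        ball_mem_nhds _ (by positivity)
      filter_upwards [hmem, hsmall] with ξ hξ hξs
      have h1 : F (x1 + ξ) ≤ F x1 := hmax ⟨subset_closure hξ.1, ball_subset_closedBall hξ.2⟩
      rw [mem_ball_zero_iff] at hξs
      have hd1 : ⟪e1, ξ⟫ ^ 2 ≤ ‖ξ‖ ^ 2 := by
        have := abs_real_inner_le_norm e1 ξ
        rw [he1, one_mul] at this
        exact sq_le_sq.2 (by rwa [abs_norm])
      have hd2 : ⟪e2, ξ⟫ ^ 2 ≤ ‖ξ‖ ^ 2 := by
        have := abs_real_inner_le_norm e2 ξ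
        rw [he2, one_mul] at this
        exact sq_le_sq.2 (by rwa [abs_norm])
      have hd3 : ‖ξ‖ ^ 2 ≤ (r / 8) ^ 2 := pow_le_pow_left₀ (norm_nonneg _) hξs.le 2
      have h2 := sqrt_lower s t ⟪e1, ξ⟫ ⟪e2, ξ⟫ r hrpos hrsq (by
        linarith only [hd1, hd2, hd3, sq_nonneg r])
      have hρξ : ρ (x1 + ξ) = √((s + ⟪e1, ξ⟫) ^ 2 + (t + ⟪e2, ξ⟫) ^ 2) := by
        simp only [hρ, inner_add_right, hs, ht]
        congr 2 <;> ring
      rw [← hρξ] at h2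
      have hyξ : s * ⟪e1, ξ⟫ + t * ⟪e2, ξ⟫ = ⟪y, ξ⟫ := by
        rw [hy, inner_add_left, real_inner_smul_left, real_inner_smul_left]
      have hωξ : t * ⟪e1, ξ⟫ - s * ⟪e2, ξ⟫ = ⟪ω, ξ⟫ := by
        rw [hω, inner_sub_left, real_inner_smul_left, real_inner_smul_left]
      rw [hyξ, hωξ] at h2
      have h3 := mul_le_mul_of_nonneg_left h2 hlam.le
      have h4 : ‖x1 + ξ - x0‖ ^ 2 = ‖x1 - x0‖ ^ 2 + 2 * ⟪x1 - x0, ξ⟫ + ‖ξ‖ ^ 2 := by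
        rw [show x1 + ξ - x0 = (x1 - x0) + ξ by abel]
        exact norm_add_sq_real _ _
      simp only [hF, inner_add_right, h4, ← hr] at h1
      rw [hG, hg]
      simp only [inner_add_left, inner_sub_left (-(τ • a) - e1 + (lam / r) • y),
        inner_sub_left (-(τ • a)), inner_neg_left, real_inner_smul_left]
      have e5 : lam * (r + ⟪y, ξ⟫ / r + ⟪ω, ξ⟫ ^ 2 / (4 * r ^ 3))
        = lam * r + lam / r * ⟪y, ξ⟫ + lam / (4 * r ^ 3) * ⟪ω, ξ⟫ ^ 2 := by ring
      rw [e5] at h3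
      linarith)
  -- lower bound for the derivative in the direction `y`
  have hsy : ⟪e1, y⟫ = s := by
    rw [hy, inner_add_right, real_inner_smul_right, real_inner_smul_right, he11, he12]; ring
  have hκx : 2 * κ * ‖x1 - x0‖ ≤ 2 * δ := by
    rw [← hκR]
    have := mul_le_mul_of_nonneg_left hnx.le hκpos.le
    linarith
  have hκu : 2 * κ * |u x1 - u x0| ≤ 2 * δ := by
    rw [← hκR]
    have := mul_le_mul_of_nonneg_left hnu.le hκpos.le
    linarith
  have hlow : lam * r / 2 ≤ g * ⟪p - a, y⟫ := by
    have h1 : ⟪G, y⟫ = -(g * ⟪p, y⟫) := by rw [hGp, inner_neg_left, real_inner_smul_left]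
    have h2 : ⟪G, y⟫ = -(τ * ⟪a, y⟫) - s + lam * r - 2 * κ * ⟪x1 - x0, y⟫ := by
      rw [hG, inner_sub_left, inner_add_left, inner_sub_left, inner_neg_left,
        real_inner_smul_left, real_inner_smul_left, real_inner_smul_left, hyy, hsy]
      field_simp
    have h3 : |2 * κ * ⟪x1 - x0, y⟫| ≤ 2 * δ * r := by
      rw [abs_mul, abs_of_pos (by positivity : 0 < 2 * κ)]
      have h4 := abs_real_inner_le_norm (x1 - x0) y
      rw [hyn] at h4
      have h5 := mul_le_mul_of_nonneg_left h4 (by positivity : 0 ≤ 2 * κ)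
      have h6 := mul_le_mul_of_nonneg_right hκx hrpos.le
      linarith
    have h7 : |2 * κ * (u x1 - u x0) * ⟪a, y⟫| ≤ 2 * δ * (‖a‖ * r) := by
      rw [abs_mul, abs_mul, abs_of_pos (by positivity : 0 < 2 * κ)]
      have h4 := abs_real_inner_le_norm a y
      rw [hyn] at h4
      exact mul_le_mul hκu h4 (abs_nonneg _) (by positivity)
    have h8 := (abs_le.1 h3).1
    have h9 := (abs_le.1 h7).1
    have h10 := mul_le_mul_of_nonneg_right hδ2 hrpos.le
    have h11 : g * ⟪p - a, y⟫ = g * ⟪p, y⟫ - g * ⟪a, y⟫ := by rw [inner_sub_left]; ring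
    have h12 : g * ⟪a, y⟫ = τ * ⟪a, y⟫ - 2 * κ * (u x1 - u x0) * ⟪a, y⟫ := by rw [hg]; ring
    linarith
  have hgp : |g| * (1 + ‖p‖) ≤ C0 := by
    have h1 : |g| * ‖p‖ = ‖G‖ := by rw [hGp, norm_neg, norm_smul, Real.norm_eq_abs]
    have h2 : ‖G‖ ≤ τ * ‖a‖ + 1 + lam + 2 * δ := by
      rw [hG]
      refine (norm_sub_le _ _).trans (add_le_add ((norm_add_le _ _).trans (add_le_add
        ((norm_sub_le _ _).trans (add_le_add ?_ he1.le)) ?_)) ?_)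
      · rw [norm_neg, norm_smul, Real.norm_eq_abs, abs_of_nonneg hτ]
      · rw [norm_smul, hyn, Real.norm_eq_abs, abs_of_pos (by positivity)]
        exact (div_mul_cancel₀ _ hrpos.ne').le
      · rw [norm_smul, Real.norm_eq_abs, abs_of_pos (by positivity)]
        exact hκx
    have h3 : |g| ≤ τ + 2 * δ := by
      rw [hg]
      refine (abs_sub _ _).trans ?_
      rw [abs_of_nonneg hτ, abs_mul, abs_of_pos (by positivity : 0 < 2 * κ)]
      linarith
    rw [mul_add, mul_one, h1, hC0]
    linarith
  have hgrad := wedge_grad p a y ω g lam C0 r hrpos hlam hC0pos hyn hωn hyω hgp hlow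
  rw [← hC1] at hgrad
  obtain ⟨W, hW⟩ : ∃ W : ℝ, W = 1 + ‖p‖ ^ 2 := ⟨_, rfl⟩
  have hWpos : 0 < W := by rw [hW]; positivity
  rw [← hW] at hineq hgrad
  obtain ⟨Q, hQ⟩ : ∃ Q : ℝ, Q = W * ‖ω‖ ^ 2 - ⟪p, ω⟫ ^ 2 := ⟨_, rfl⟩
  rw [← hQ] at hineq hgrad
  -- final contradiction
  have k1 : lam * Q ≤ κ * n * W * (4 * r ^ 3) := by
    rw [div_mul_eq_mul_div, div_le_iff₀ (by positivity)] at hineq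
    exact hineq
  have k2 : lam * (r ^ 2 * W) ≤ C1 * (κ * n * W * (4 * r ^ 3)) := by
    have := mul_le_mul_of_nonneg_left hgrad hlam.le
    have := mul_le_mul_of_nonneg_left k1 hC1pos.le
    linarith
  have k3 : lam ≤ 4 * C1 * κ * n * r := by
    have hpos' : 0 < r ^ 2 * W := by positivity
    refine le_of_mul_le_mul_left ?_ hpos'
    linarith
  have k4 : lam * r ≤ (3 * τ * (1 + ‖a‖) + 1) * R := by
    have h1 : τ * L1 ≤ τ * (3 * (1 + ‖a‖) * R) := mul_le_mul_of_nonneg_left hL1le hτ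
    have h2 : 0 ≤ κ * (‖x1 - x0‖ ^ 2 + (u x1 - u x0) ^ 2) := by positivity
    have h3 : δ * R ≤ 1 * R := mul_le_mul_of_nonneg_right hδ1 hRpos.le
    rw [← hs, ← hr] at hF1'
    linarith
  have k5 : lam * lam ≤ 4 * C1 * κ * n * ((3 * τ * (1 + ‖a‖) + 1) * R) := by
    have h1 := mul_le_mul_of_nonneg_left k3 hlam.le
    have h2 := mul_le_mul_of_nonneg_left k4 (by positivity : 0 ≤ 4 * C1 * κ * n)
    linarith
  have k6 : 4 * C1 * κ * n * ((3 * τ * (1 + ‖a‖) + 1) * R) = 4 * δ * D := by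
    rw [hD, ← hκR]; ring
  rw [k6, ← sq] at k5
  exact absurd hδ3 (not_lt.2 k5)

theorem wedge_le {n : ℕ} {u : EuclideanSpace ℝ (Fin n) → ℝ}
    {Ω : Set (EuclideanSpace ℝ (Fin n))} (hopen : IsOpen Ω) (hN : NonDiv u Ω)
    (hu0 : ContinuousOn u (closure Ω)) {a e1 e2 : EuclideanSpace ℝ (Fin n)} {b σ θ lam : ℝ}
    (hbdry : ∀ x ∈ frontier Ω, u x = ⟪a, x⟫ + b) (he1 : ‖e1‖ = 1) (he2 : ‖e2‖ = 1)
    (he12 : ⟪e1, e2⟫ = 0) (hlam : 0 < lam) (hlam1 : lam ≤ 1)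
    (hw : ∀ x ∈ Ω, 2 * lam * √((⟪e1, x⟫ - σ) ^ 2 + (⟪e2, x⟫ - θ) ^ 2) ≤ ⟪e1, x⟫ - σ)
    (hpos : ∀ x ∈ Ω, 0 < ⟪e1, x⟫ - σ) :
    ∀ x ∈ Ω, u x ≤ ⟪a, x⟫ + b := by
  intro xs hxs
  by_contra hcon
  push Not at hcon
  set T : Set ℝ := {τ | 0 ≤ τ ∧ ∀ x ∈ Ω, τ * (u x - (⟪a, x⟫ + b))
      ≤ (⟪e1, x⟫ - σ) - lam * √((⟪e1, x⟫ - σ) ^ 2 + (⟪e2, x⟫ - θ) ^ 2)} with hT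
  have hTc : IsClosed T := by
    have : T = Ici 0 ∩ ⋂ x ∈ Ω, {τ : ℝ | τ * (u x - (⟪a, x⟫ + b))
      ≤ (⟪e1, x⟫ - σ) - lam * √((⟪e1, x⟫ - σ) ^ 2 + (⟪e2, x⟫ - θ) ^ 2)} := by
      ext τ; simp [hT]
    rw [this]
    exact isClosed_Ici.inter (isClosed_biInter fun x _ =>
      isClosed_le (by fun_prop) continuous_const)
  have h0 : (0 : ℝ) ∈ T := by
    refine ⟨le_rfl, fun x hx => ?_⟩
    have h1 := hw x hx
    have h2 : 0 ≤ lam * √((⟪e1, x⟫ - σ) ^ 2 + (⟪e2, x⟫ - θ) ^ 2) :=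
      mul_nonneg hlam.le (Real.sqrt_nonneg _)
    linarith
  have hbdd : BddAbove T := by
    refine ⟨((⟪e1, xs⟫ - σ) - lam * √((⟪e1, xs⟫ - σ) ^ 2 + (⟪e2, xs⟫ - θ) ^ 2))
      / (u xs - (⟪a, xs⟫ + b)), fun τ hτ => ?_⟩
    rw [le_div_iff₀ (by linarith)]
    exact hτ.2 xs hxs
  have hmem := hTc.csSup_mem ⟨0, h0⟩ hbdd
  obtain ⟨δ, hδ, h⟩ := wedge_step hopen hN hu0 hbdry he1 he2 he12 hlam hlam1 hw hpos hmem.1 hmem.2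
  have hin : sSup T + δ ∈ T := ⟨by linarith [hmem.1], h⟩
  have := le_csSup hbdd hin
  linarith

/-! ### Geometry of convex sets that are not half-spaces -/

/-- Supporting unit vector. -/
theorem exists_support {n : ℕ} {Ω : Set (EuclideanSpace ℝ (Fin n))} (hne : Ω.Nonempty)
    (hopen : IsOpen Ω) (hconv : Convex ℝ Ω) {z : EuclideanSpace ℝ (Fin n)} (hz : z ∉ Ω) :
    ∃ v : EuclideanSpace ℝ (Fin n), ‖v‖ = 1 ∧ ∀ x ∈ Ω, ⟪v, z⟫ < ⟪v, x⟫ := by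
  obtain ⟨f, hf⟩ := geometric_hahn_banach_point_open hconv hopen hz
  set w := (InnerProductSpace.toDual ℝ (EuclideanSpace ℝ (Fin n))).symm f with hw
  have hfw : ∀ x, f x = ⟪w, x⟫ := fun x => by rw [hw, InnerProductSpace.toDual_symm_apply]
  obtain ⟨x0, hx0⟩ := hne
  have hw0 : w ≠ 0 := by
    intro h
    have := hf x0 hx0
    rw [hfw, hfw, h, inner_zero_left, inner_zero_left] at this
    exact lt_irrefl _ this
  have hwn : 0 < ‖w‖ := norm_pos_iff.2 hw0
  refine ⟨‖w‖⁻¹ • w, ?_, fun x hx => ?_⟩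
  · rw [norm_smul, norm_inv, norm_norm, inv_mul_cancel₀ hwn.ne']
  · rw [real_inner_smul_left, real_inner_smul_left]
    have := hf x hx
    rw [hfw, hfw] at this
    exact mul_lt_mul_of_pos_left this (inv_pos.2 hwn)

theorem one_sided {n : ℕ} {u : EuclideanSpace ℝ (Fin n) → ℝ}
    {Ω : Set (EuclideanSpace ℝ (Fin n))} (hne : Ω.Nonempty) (hopen : IsOpen Ω)
    (hconv : Convex ℝ Ω) (hproper : Ω ≠ univ)
    (hnothalf : ∀ (v : EuclideanSpace ℝ (Fin n)) (c : ℝ), v ≠ 0 → Ω ≠ {x | c < ⟪v, x⟫})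
    (hN : NonDiv u Ω)
    (hu0 : ContinuousOn u (closure Ω)) {a : EuclideanSpace ℝ (Fin n)} {b : ℝ}
    (hbdry : ∀ x ∈ frontier Ω, u x = ⟪a, x⟫ + b) :
    ∀ x ∈ Ω, u x ≤ ⟪a, x⟫ + b := by
  obtain ⟨z1, hz1⟩ := (Set.ne_univ_iff_exists_notMem Ω).1 hproper
  obtain ⟨v1, hv1, hs1⟩ := exists_support hne hopen hconv hz1
  set P : Set ℝ := (fun x => ⟪v1, x⟫) '' Ω with hP
  have hPne : P.Nonempty := hne.image _
  have hPb : BddBelow P := ⟨⟪v1, z1⟫, by rintro _ ⟨x, hx, rfl⟩; exact (hs1 x hx).le⟩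
  set c1 := sInf P with hc1
  have hv11 : ⟪v1, v1⟫ = 1 := by rw [real_inner_self_eq_norm_sq, hv1]; norm_num
  have hgt : ∀ x ∈ Ω, c1 < ⟪v1, x⟫ := by
    intro x hx
    have hcont : Continuous (fun ε : ℝ => x - ε • v1) := by fun_prop
    have hmem : ∀ᶠ ε : ℝ in nhds 0, x - ε • v1 ∈ Ω :=
      hcont.continuousAt.eventually_mem (hopen.mem_nhds (by simpa using hx))
    obtain ⟨η, hη, hh⟩ := Metric.eventually_nhds_iff.1 hmem
    have h1 := hh (y := η / 2) (by
      rw [Real.dist_eq, sub_zero, abs_of_pos (by linarith)]; linarith)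
    have h2 : c1 ≤ ⟪v1, x - (η / 2) • v1⟫ := csInf_le hPb ⟨_, h1, rfl⟩
    rw [inner_sub_right, real_inner_smul_right, hv11] at h2
    linarith
  have hv10 : v1 ≠ 0 := by
    intro h; rw [h, norm_zero] at hv1; exact zero_ne_one hv1
  obtain ⟨z2, hz2, hz2n⟩ : ∃ z2, c1 < ⟪v1, z2⟫ ∧ z2 ∉ Ω := by
    by_contra hall
    push Not at hall
    exact hnothalf v1 c1 hv10 (Set.Subset.antisymm (fun x hx => hgt x hx) (fun x hx => hall x hx))
  obtain ⟨v2, hv2, hs2⟩ := exists_support hne hopen hconv hz2n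
  set c2 := ⟪v2, z2⟫ with hc2
  by_cases hminus : v1 + v2 = 0
  · -- slab
    have hv : v2 = -v1 := (neg_eq_of_add_eq_zero_right hminus).symm
    refine slab_le hopen hN hu0 (e := v1) (m := (c1 - c2) / 2) (w := (-c2 - c1) / 2) hbdry hv1 ?_
    intro x hx
    have h1 := hgt x hx
    have h2 := hs2 x hx
    have hvx : ⟪v2, x⟫ = -⟪v1, x⟫ := by rw [hv, inner_neg_left]
    rw [hvx] at h2
    rw [abs_le]
    constructor <;> linarith
  · have hplus : v1 - v2 ≠ 0 := by
      intro h
      have hv : v2 = v1 := (sub_eq_zero.1 h).symm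
      obtain ⟨_, ⟨x, hx, rfl⟩, hlt⟩ := exists_lt_of_csInf_lt hPne hz2
      have := hs2 x hx
      rw [hc2, hv] at this
      simp only at hlt
      linarith
    obtain ⟨A, hA⟩ : ∃ A : ℝ, A = ‖v1 + v2‖ := ⟨_, rfl⟩
    obtain ⟨B, hB⟩ : ∃ B : ℝ, B = ‖v1 - v2‖ := ⟨_, rfl⟩
    have hApos : 0 < A := by rw [hA]; exact norm_pos_iff.2 hminus
    have hBpos : 0 < B := by rw [hB]; exact norm_pos_iff.2 hplus
    have hAB : 0 < A / B := by positivity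
    -- choose the opening parameter
    obtain ⟨lam, hlam⟩ : ∃ lam : ℝ, lam = 1 / (2 * (1 + A / B)) := ⟨_, rfl⟩
    have hlampos : 0 < lam := by rw [hlam]; positivity
    have hlam1 : lam ≤ 1 := by
      rw [hlam, div_le_one (by positivity)]; linarith
    have hst : ∀ x ∈ Ω, 0 < ⟪A⁻¹ • (v1 + v2), x⟫ - (c1 + c2) / A ∧
        |⟪B⁻¹ • (v1 - v2), x⟫ - (c1 - c2) / B|
          ≤ A / B * (⟪A⁻¹ • (v1 + v2), x⟫ - (c1 + c2) / A) := by
      intro x hx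
      have h1 := hgt x hx
      have h2 : c2 < ⟪v2, x⟫ := hs2 x hx
      have es : ⟪A⁻¹ • (v1 + v2), x⟫ - (c1 + c2) / A
          = ((⟪v1, x⟫ - c1) + (⟪v2, x⟫ - c2)) / A := by
        rw [real_inner_smul_left, inner_add_left]; ring
      have et : ⟪B⁻¹ • (v1 - v2), x⟫ - (c1 - c2) / B
          = ((⟪v1, x⟫ - c1) - (⟪v2, x⟫ - c2)) / B := by
        rw [real_inner_smul_left, inner_sub_left]; ring
      rw [es, et]
      refine ⟨div_pos (by linarith) hApos, ?_⟩
      have e3 : A / B * (((⟪v1, x⟫ - c1) + (⟪v2, x⟫ - c2)) / A)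
          = ((⟪v1, x⟫ - c1) + (⟪v2, x⟫ - c2)) / B := by field_simp
      rw [e3, abs_div, abs_of_pos hBpos]
      refine div_le_div_of_nonneg_right ?_ hBpos.le
      rw [abs_le]
      constructor <;> linarith
    refine wedge_le hopen hN hu0 (e1 := A⁻¹ • (v1 + v2)) (e2 := B⁻¹ • (v1 - v2))
      (σ := (c1 + c2) / A) (θ := (c1 - c2) / B) (lam := lam) hbdry ?_ ?_ ?_ hlampos hlam1 ?_
      (fun x hx => (hst x hx).1)
    · rw [norm_smul, norm_inv, Real.norm_eq_abs, abs_of_pos hApos, ← hA, inv_mul_cancel₀ hApos.ne']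
    · rw [norm_smul, norm_inv, Real.norm_eq_abs, abs_of_pos hBpos, ← hB, inv_mul_cancel₀ hBpos.ne']
    · rw [real_inner_smul_left, real_inner_smul_right, inner_add_left, inner_sub_right,
        inner_sub_right, hv11, real_inner_self_eq_norm_sq v2, hv2, real_inner_comm v1 v2]
      ring
    · intro x hx
      obtain ⟨h1, h2⟩ := hst x hx
      set s := ⟪A⁻¹ • (v1 + v2), x⟫ - (c1 + c2) / A
      set t := ⟪B⁻¹ • (v1 - v2), x⟫ - (c1 - c2) / B
      have h3 : √(s ^ 2 + t ^ 2) ≤ (1 + A / B) * s := by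
        apply Real.sqrt_le_iff.2
        refine ⟨by positivity, ?_⟩
        have h4 : t ^ 2 ≤ (A / B * s) ^ 2 := sq_le_sq.2 (h2.trans (le_abs_self _))
        have h5 : 0 < A / B * s ^ 2 := by positivity
        linarith
      have h6 : 2 * lam * ((1 + A / B) * s) = s := by rw [hlam]; field_simp
      have := mul_le_mul_of_nonneg_left h3 (by positivity : 0 ≤ 2 * lam)
      linarith

theorem bernstein_not_halfspace
    (n : ℕ) (hn : 1 ≤ n)
    (Ω : Set (EuclideanSpace ℝ (Fin n)))
    (hne : Ω.Nonempty) (hopen : IsOpen Ω) (hconv : Convex ℝ Ω) (hproper : Ω ≠ univ)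
    (hnothalf : ¬ ∃ (v : EuclideanSpace ℝ (Fin n)) (c : ℝ), v ≠ 0 ∧
      Ω = {x | c < ∑ i, v i * x i})
    (u : EuclideanSpace ℝ (Fin n) → ℝ)
    (hu2 : ContDiffOn ℝ 2 u Ω) (hu0 : ContinuousOn u (closure Ω))
    (hmse : MinimalSurfaceEq u Ω)
    (a : EuclideanSpace ℝ (Fin n)) (b : ℝ)
    (hbdry : ∀ x ∈ frontier Ω, u x = ∑ i, a i * x i + b) :
    ∀ x ∈ closure Ω, u x = ∑ i, a i * x i + b := by
  have hin : ∀ v x : EuclideanSpace ℝ (Fin n), ∑ i, v i * x i = ⟪v, x⟫ := by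
    intro v x
    rw [PiLp.inner_apply]
    refine Finset.sum_congr rfl fun i _ => ?_
    simp [mul_comm]
  simp only [hin] at hnothalf hbdry ⊢
  have hN := nonDiv_of_mse hopen hu2 hmse
  have hnh : ∀ (v : EuclideanSpace ℝ (Fin n)) (c : ℝ), v ≠ 0 → Ω ≠ {x | c < ⟪v, x⟫} :=
    fun v c hv h => hnothalf ⟨v, c, hv, h⟩
  have h1 := one_sided hne hopen hconv hproper hnh hN hu0 hbdry
  have h2 := one_sided (u := fun x => -u x) (a := -a) (b := -b) hne hopen hconv hproper hnh
    hN.neg hu0.neg (fun x hx => by rw [hbdry x hx, inner_neg_left]; ring)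
  intro x hx
  by_cases hxΩ : x ∈ Ω
  · have h3 := h1 x hxΩ
    have h4 := h2 x hxΩ
    rw [inner_neg_left] at h4
    linarith
  · exact hbdry x (by rw [hopen.frontier_eq]; exact ⟨hx, hxΩ⟩)
end

section
/- Let Ω be an open convex subset of ℝⁿ. Then for every x ∈ ℝⁿ and r > 0, the (n−1)-dimensional Hausdorff measure of the intersection of the closed ball of radius r about x with the frontier of Ω is at most the (n−1)-dimensional Hausdorff measure of the sphere of radius r: H^{n-1}( cl B_r(x) ∩ ∂Ω ) ≤ H^{n-1}( ∂B_r(x) ). -/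
open Set Metric MeasureTheory
open scoped ENNReal

/-- From each frontier point inside the ball, the outward normal ray hits the sphere. -/
lemma exists_normal_hit (n : ℕ) (Ω : Set (EuclideanSpace ℝ (Fin n)))
    (hopen : IsOpen Ω) (hconv : Convex ℝ Ω)
    (x : EuclideanSpace ℝ (Fin n)) (r : ℝ)
    (y : EuclideanSpace ℝ (Fin n)) (hy : y ∈ Metric.closedBall x r ∩ frontier Ω) :
    ∃ s ∈ Metric.sphere x r, ∀ z ∈ closure Ω, inner ℝ (s - y) (z - y) ≤ 0 := by
  obtain ⟨hyb, hyf⟩ := hy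
  rw [hopen.frontier_eq] at hyf
  obtain ⟨f, hf⟩ := geometric_hahn_banach_open_point hconv hopen hyf.2
  obtain ⟨w, hw⟩ : Ω.Nonempty := closure_nonempty_iff.1 ⟨y, hyf.1⟩
  set v := (InnerProductSpace.toDual ℝ (EuclideanSpace ℝ (Fin n))).symm f with hv
  have hin : ∀ z, inner ℝ v z = f z := fun z => by
    rw [hv, InnerProductSpace.toDual_symm_apply]
  have hv0 : v ≠ 0 := by
    intro h
    have h1 := hf w hw
    rw [← hin, ← hin, h] at h1
    simp at h1
  have hvn : 0 < ‖v‖ := norm_pos_iff.2 hv0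
  have hcl : ∀ z ∈ closure Ω, f z ≤ f y := by
    intro z hz
    have hc : IsClosed {z | f z ≤ f y} := isClosed_le f.continuous continuous_const
    exact closure_minimal (fun a ha => (hf a ha).le) hc hz
  have hyn : ‖y - x‖ ≤ r := by simpa [dist_eq_norm] using hyb
  have hr : 0 ≤ r := (norm_nonneg _).trans hyn
  set T := 2 * r / ‖v‖ with hT
  have hT0 : 0 ≤ T := by positivity
  have hTr : r ≤ ‖y + T • v - x‖ := by
    have h1 : ‖T • v‖ = 2 * r := by
      rw [norm_smul, Real.norm_of_nonneg hT0, hT]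
      field_simp
    have h2 : ‖T • v‖ ≤ ‖y + T • v - x‖ + ‖y - x‖ := by
      calc ‖T • v‖ = ‖(y + T • v - x) - (y - x)‖ := by congr 1; abel
        _ ≤ _ := norm_sub_le _ _
    linarith
  have hcont : ContinuousOn (fun t : ℝ => ‖y + t • v - x‖) (Icc 0 T) := by fun_prop
  obtain ⟨t, ht, hts⟩ := intermediate_value_Icc hT0 hcont
    (show r ∈ Icc _ _ from ⟨by simpa using hyn, hTr⟩)
  refine ⟨y + t • v, by simpa [dist_eq_norm] using hts, fun z hz => ?_⟩
  rw [add_sub_cancel_left, real_inner_smul_left, hin, map_sub]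
  have := hcl z hz
  exact mul_nonpos_of_nonneg_of_nonpos ht.1 (by linarith)

theorem hausdorff_frontier_cap_ball_le_sphere
    (n : ℕ) (Ω : Set (EuclideanSpace ℝ (Fin n)))
    (hopen : IsOpen Ω) (hconv : Convex ℝ Ω)
    (x : EuclideanSpace ℝ (Fin n)) (r : ℝ) (hr : 0 < r) :
    μH[(n : ℝ) - 1] (Metric.closedBall x r ∩ frontier Ω)
      ≤ μH[(n : ℝ) - 1] (Metric.sphere x r) := by
  rcases Nat.eq_zero_or_pos n with rfl | hn
  · have : frontier Ω = ∅ := (isClopen_discrete Ω).frontier_eq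
    simp [this]
  have hd : (0 : ℝ) ≤ (n : ℝ) - 1 := by
    have : (1 : ℝ) ≤ n := by exact_mod_cast hn
    linarith
  set A := Metric.closedBall x r ∩ frontier Ω with hA
  have key := fun y : A => exists_normal_hit n Ω hopen hconv x r y y.2
  choose s hs hsz using key
  have hanti : AntilipschitzWith 1 s := by
    refine AntilipschitzWith.of_le_mul_dist fun a b => ?_
    have h1 := hsz a b (frontier_subset_closure b.2.2)
    have h2 := hsz b a (frontier_subset_closure a.2.2)
    rw [Subtype.dist_eq, dist_eq_norm, dist_eq_norm, NNReal.coe_one, one_mul]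
    set p : EuclideanSpace ℝ (Fin n) := a.1
    set q : EuclideanSpace ℝ (Fin n) := b.1
    have h3 : inner ℝ (s a - s b) (p - q) =
        inner ℝ (p - q) (p - q) - inner ℝ (s a - p) (q - p) - inner ℝ (s b - q) (p - q) := by
      simp only [inner_sub_left, inner_sub_right]
      ring
    have h4 := real_inner_le_norm (s a - s b) (p - q)
    rw [real_inner_self_eq_norm_sq] at h3
    rcases (norm_nonneg (p - q)).eq_or_lt with h | h
    · rw [← h]; positivity
    · refine le_of_mul_le_mul_right ?_ h
      nlinarith
  have h1 := hanti.le_hausdorffMeasure_image hd univ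
  have h2 := (isometry_subtype_coe (s := A)).hausdorffMeasure_image (d := (n : ℝ) - 1)
    (Or.inl hd) univ
  rw [image_univ, Subtype.range_coe] at h2
  rw [h2]
  refine h1.trans ?_
  rw [ENNReal.coe_one, ENNReal.one_rpow, one_mul]
  refine measure_mono ?_
  rintro _ ⟨a, -, rfl⟩
  exact hs a
end

section
/- Let Ω be a nonempty open convex proper subset of ℝⁿ, and let p : ℝⁿ → cl Ω denote the nearest-point projection onto the closed convex set cl Ω. Then for every x ∈ ℝⁿ, r > 0, and every z ∈ cl B_r(x) ∩ ∂Ω, there exists y ∈ ∂B_r(x) with p(y) = z. That is, p maps the sphere ∂B_r(x) onto cl B_r(x) ∩ ∂Ω. -/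
open Set Metric

theorem projection_sphere_onto_frontier
    (n : ℕ) (Ω : Set (EuclideanSpace ℝ (Fin n)))
    (hne : Ω.Nonempty) (hopen : IsOpen Ω) (hconv : Convex ℝ Ω) (hproper : Ω ≠ univ)
    (p : EuclideanSpace ℝ (Fin n) → EuclideanSpace ℝ (Fin n))
    (hp : ∀ x, p x ∈ closure Ω ∧ dist x (p x) = Metric.infDist x (closure Ω)) :
    ∀ (x : EuclideanSpace ℝ (Fin n)) (r : ℝ), 0 < r →
      ∀ z ∈ Metric.closedBall x r ∩ frontier Ω,
        ∃ y ∈ Metric.sphere x r, p y = z := by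
  rintro x r hr z ⟨hzx, hz⟩
  rw [hopen.frontier_eq] at hz
  obtain ⟨hzc, hzn⟩ := hz
  obtain ⟨f, hf⟩ := geometric_hahn_banach_open_point hconv hopen hzn
  obtain ⟨v, rfl⟩ := (InnerProductSpace.toDual ℝ (EuclideanSpace ℝ (Fin n))).surjective f
  simp only [InnerProductSpace.toDual_apply_apply] at hf
  have hv : v ≠ 0 := by
    rintro rfl
    obtain ⟨a, ha⟩ := hne
    simpa using hf a ha
  have hvpos : 0 < ‖v‖ := norm_pos_iff.mpr hv
  have hcl : ∀ w ∈ closure Ω, inner ℝ v w ≤ inner ℝ v z := by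
    intro w hw
    have hc : IsClosed {w : EuclideanSpace ℝ (Fin n) | inner ℝ v w ≤ inner ℝ v z} :=
      isClosed_le (by fun_prop) continuous_const
    exact closure_minimal (fun a ha => (hf a ha).le) hc hw
  have hzx' : ‖z - x‖ ≤ r := by simpa [dist_eq_norm] using hzx
  obtain ⟨t, ht, hty⟩ : ∃ t ∈ Icc 0 (2 * r / ‖v‖), ‖z + t • v - x‖ = r := by
    have hT : 0 ≤ 2 * r / ‖v‖ := by positivity
    have hcont : ContinuousOn (fun t : ℝ => ‖z + t • v - x‖) (Icc 0 (2 * r / ‖v‖)) := by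
      fun_prop
    refine intermediate_value_Icc hT hcont ⟨by simpa using hzx', ?_⟩
    have h1 : ‖(2 * r / ‖v‖) • v‖ = 2 * r := by
      rw [norm_smul, Real.norm_of_nonneg hT]
      field_simp
    have h2 := norm_sub_le (z + (2 * r / ‖v‖) • v - x) (z - x)
    have h3 : z + (2 * r / ‖v‖) • v - x - (z - x) = (2 * r / ‖v‖) • v := by abel
    rw [h3, h1] at h2
    show r ≤ ‖z + (2 * r / ‖v‖) • v - x‖
    linarith
  refine ⟨z + t • v, by simpa [dist_eq_norm] using hty, ?_⟩
  obtain ⟨hw, hd⟩ := hp (z + t • v)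
  generalize p (z + t • v) = w at hw hd ⊢
  have hle : ‖t • v - (w - z)‖ ≤ ‖t • v‖ := by
    have h := Metric.infDist_le_dist_of_mem (x := z + t • v) hzc
    rw [← hd, dist_eq_norm, dist_eq_norm] at h
    have e1 : z + t • v - w = t • v - (w - z) := by abel
    have e2 : z + t • v - z = t • v := by abel
    rwa [e1, e2] at h
  have hexp := norm_sub_sq_real (t • v) (w - z)
  rw [real_inner_smul_left, inner_sub_right] at hexp
  have h4 : t * (inner ℝ v w - inner ℝ v z) ≤ 0 :=
    mul_nonpos_of_nonneg_of_nonpos ht.1 (sub_nonpos.mpr (hcl w hw))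
  have h5 := pow_le_pow_left₀ (norm_nonneg _) hle 2
  have h6 : ‖w - z‖ ^ 2 = 0 := le_antisymm (by linarith) (sq_nonneg _)
  exact sub_eq_zero.mp (norm_eq_zero.mp (pow_eq_zero_iff two_ne_zero |>.mp h6))
end

section
/- Let Ω ⊆ ℝⁿ be open and let u ∈ C²(Ω) satisfy the minimal surface equation ∑_{i=1}^n D_i( D_i u / √(1+|Du|²) ) = 0 at every point of Ω. Let W be a bounded open set with cl W ⊆ Ω, and let v : cl W → ℝ be a Lipschitz function with v = u on ∂W. Then ∫_W √(1+|Du|²) dx ≤ ∫_W √(1+|Dv|²) dx, where Dv denotes the (almost everywhere defined) gradient of v. -/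
open Set Metric MeasureTheory
open scoped RealInnerProductSpace ENNReal NNReal

theorem aux_segment_frontier {E : Type*} [NormedAddCommGroup E] [NormedSpace ℝ E]
    (W : Set E) {x y : E} (hx : x ∈ W) (hy : y ∉ W) :
    ∃ z ∈ frontier W, dist x z ≤ dist x y := by
  have hc : IsPreconnected (segment ℝ x y) := (convex_segment x y).isPreconnected
  by_contra! hcon
  have hdisj : ∀ z ∈ segment ℝ x y, z ∉ frontier W := by
    intro z hz hzf
    have h1 := hcon z hzf
    have h2 := dist_add_dist_of_mem_segment hz
    linarith [dist_nonneg (x := z) (y := y)]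
  obtain ⟨z, _, hz1, hz2⟩ := hc (interior W) (closure W)ᶜ isOpen_interior
    isClosed_closure.isOpen_compl
    (fun z hz => by
      by_cases h : z ∈ closure W
      · left
        by_contra h'
        exact hdisj z hz ⟨h, h'⟩
      · right; exact h)
    ⟨x, left_mem_segment ℝ x y, by
      by_contra h'
      exact hdisj x (left_mem_segment ℝ x y) ⟨subset_closure hx, h'⟩⟩
    ⟨y, right_mem_segment ℝ x y, fun h' =>
      hdisj y (right_mem_segment ℝ x y) ⟨h', fun h => hy (interior_subset h)⟩⟩
  exact hz2 (subset_closure (interior_subset hz1))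

theorem aux_lipschitz_extend {E : Type*} [NormedAddCommGroup E] [NormedSpace ℝ E]
    (W : Set E) (f : E → ℝ) (K : ℝ≥0) (hf : LipschitzOnWith K f (closure W))
    (h0 : ∀ x ∈ frontier W, f x = 0) : LipschitzWith K (W.indicator f) := by
  classical
  have key : ∀ x ∈ W, ∀ y ∉ W, |f x| ≤ K * dist x y := by
    intro x hx y hy
    obtain ⟨z, hz, hd⟩ := aux_segment_frontier W hx hy
    have := hf.dist_le_mul x (subset_closure hx) z hz.1
    rw [h0 z hz, Real.dist_eq, sub_zero] at this
    exact this.trans (by gcongr)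
  apply LipschitzWith.of_dist_le_mul
  intro x y
  by_cases hx : x ∈ W <;> by_cases hy : y ∈ W
  · simpa [hx, hy] using hf.dist_le_mul x (subset_closure hx) y (subset_closure hy)
  · simpa [hx, hy, Real.dist_eq] using key x hx y hy
  · simpa [hx, hy, Real.dist_eq, dist_comm x y] using key y hy x hx
  · simp [hx, hy]; positivity

theorem aux_fderiv_zero {n : ℕ} (w : EuclideanSpace ℝ (Fin n) → ℝ) (C : ℝ≥0)
    (hw : LipschitzWith C w) : ∀ᵐ x, w x = 0 → fderiv ℝ w x = 0 := by
  have habs : LipschitzWith (1 * C) (fun x => ‖w x‖) := lipschitzWith_one_norm.comp hw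
  filter_upwards [habs.ae_differentiableAt (μ := volume)] with x hx h0
  have hmin : IsLocalMin (fun x => ‖w x‖) x :=
    Filter.Eventually.of_forall fun y => by simp [h0]
  have h1 := hx.hasFDerivAt
  rw [hmin.fderiv_eq_zero] at h1
  apply HasFDerivAt.fderiv
  rw [hasFDerivAt_iff_isLittleO] at h1 ⊢
  simp only [h0, norm_zero, sub_zero, zero_apply] at h1 ⊢
  exact h1.of_norm_left

theorem aux_convex {n : ℕ} (p q : Fin n → ℝ) :
    Real.sqrt (1 + ∑ i, p i ^ 2) + ∑ i, (q i - p i) * (p i / Real.sqrt (1 + ∑ i, p i ^ 2))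
      ≤ Real.sqrt (1 + ∑ i, q i ^ 2) := by
  set P := ∑ i, p i ^ 2 with hP
  set Q := ∑ i, q i ^ 2 with hQ
  have hP0 : 0 ≤ P := Finset.sum_nonneg fun i _ => sq_nonneg _
  have hQ0 : 0 ≤ Q := Finset.sum_nonneg fun i _ => sq_nonneg _
  have hs : 0 < Real.sqrt (1 + P) := Real.sqrt_pos.2 (by linarith)
  have hss : Real.sqrt (1 + P) * Real.sqrt (1 + P) = 1 + P := Real.mul_self_sqrt (by linarith)
  have hsum : ∑ i, (q i - p i) * (p i / Real.sqrt (1 + P))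
      = (∑ i, p i * q i - P) / Real.sqrt (1 + P) := by
    rw [hP, ← Finset.sum_sub_distrib, Finset.sum_div]
    exact Finset.sum_congr rfl fun i _ => by ring
  rw [hsum]
  have hCS : (∑ i, p i * q i) ^ 2 ≤ P * Q := Finset.sum_mul_sq_le_sq_mul_sq _ _ _
  set R := ∑ i, p i * q i
  have h2 : 1 + R ≤ Real.sqrt (1 + P) * Real.sqrt (1 + Q) := by
    rw [← Real.sqrt_mul (by linarith)]
    apply Real.le_sqrt_of_sq_le
    nlinarith [sq_nonneg (P - Q), sq_nonneg (R - (P + Q) / 2),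
      abs_le_of_sq_le_sq (show R ^ 2 ≤ ((P + Q) / 2) ^ 2 by nlinarith [sq_nonneg (P - Q)])
        (by linarith)]
  have h3 : Real.sqrt (1 + P) + (R - P) / Real.sqrt (1 + P) = (1 + R) / Real.sqrt (1 + P) := by
    field_simp
    nlinarith
  rw [h3, div_le_iff₀ hs]
  linarith

theorem aux_gradSq_congr {n : ℕ} {f g : EuclideanSpace ℝ (Fin n) → ℝ}
    {x : EuclideanSpace ℝ (Fin n)} (h : f =ᶠ[nhds x] g) : gradSq f x = gradSq g x := by
  simp only [gradSq, pderiv', h.fderiv_eq]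

theorem aux_gradSq_contDiff {n : ℕ} {U : EuclideanSpace ℝ (Fin n) → ℝ} (hU : ContDiff ℝ 2 U) :
    (∀ i, ContDiff ℝ 1 (pderiv' U i)) ∧ ContDiff ℝ 1 (gradSq U) := by
  have h : ∀ i, ContDiff ℝ 1 (pderiv' U i) := fun i =>
    (hU.fderiv_right (m := 1) (by norm_num)).clm_apply contDiff_const
  exact ⟨h, ContDiff.sum fun i _ => (h i).pow 2⟩

theorem aux_gradSq_nonneg {n : ℕ} (U : EuclideanSpace ℝ (Fin n) → ℝ) (x) : 0 ≤ gradSq U x :=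
  Finset.sum_nonneg fun i _ => sq_nonneg _

theorem aux_global {n : ℕ} (U w : EuclideanSpace ℝ (Fin n) → ℝ) (hU : ContDiff ℝ 2 U)
    (hUc : HasCompactSupport U) (C : ℝ≥0) (hw : LipschitzWith C w)
    (W : Set (EuclideanSpace ℝ (Fin n))) (hWopen : IsOpen W) (hWbdd : Bornology.IsBounded W)
    (hw0 : ∀ x ∉ W, w x = 0) (hmse : MinimalSurfaceEq U W) :
    ∫ x in W, Real.sqrt (1 + gradSq U x) ≤
      ∫ x in W, Real.sqrt (1 + gradSq (fun y => w y + U y) x) := by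
  obtain ⟨hpd, hgs⟩ := aux_gradSq_contDiff hU
  have hne : ∀ x, 1 + gradSq U x ≠ 0 := fun x => by have := aux_gradSq_nonneg U x; positivity
  have hsc : ContDiff ℝ 1 (fun x => Real.sqrt (1 + gradSq U x)) :=
    (contDiff_const.add hgs).sqrt hne
  have hsne : ∀ x, Real.sqrt (1 + gradSq U x) ≠ 0 := fun x => by
    have := aux_gradSq_nonneg U x
    positivity
  set g : Fin n → EuclideanSpace ℝ (Fin n) → ℝ :=
    fun i y => pderiv' U i y / Real.sqrt (1 + gradSq U y) with hg
  have hgC : ∀ i, ContDiff ℝ 1 (g i) := fun i => (hpd i).div hsc hsne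
  have hgc : ∀ i, HasCompactSupport (g i) := by
    intro i
    have h1 : HasCompactSupport (pderiv' U i) := hUc.fderiv_apply ℝ _
    refine h1.mono fun x hx => ?_
    simp only [Function.mem_support, hg] at hx ⊢
    intro h
    exact hx (by rw [h, zero_div])
  have hgL : ∀ i, ∃ D, LipschitzWith D (g i) := fun i =>
    ContDiff.lipschitzWith_of_hasCompactSupport (hgc i) (hgC i) (by norm_num)
  obtain ⟨CU, hUL⟩ := ContDiff.lipschitzWith_of_hasCompactSupport hUc hU (by norm_num)
  have hwd := hw.ae_differentiableAt (μ := volume)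
  have hwc : HasCompactSupport w := by
    apply HasCompactSupport.intro hWbdd.isCompact_closure
    intro x hx
    exact hw0 x fun h => hx (subset_closure h)
  have hbound : ∀ i x, |pderiv' w i x| ≤ C := by
    intro i x
    calc |pderiv' w i x| ≤ ‖fderiv ℝ w x‖ * ‖EuclideanSpace.single i (1 : ℝ)‖ :=
          (fderiv ℝ w x).le_opNorm _
      _ ≤ C := by
          simpa using norm_fderiv_le_of_lipschitz ℝ hw
  have hmeas : ∀ (f : EuclideanSpace ℝ (Fin n) → ℝ) i, Measurable (pderiv' f i) := fun f i =>
    measurable_fderiv_apply_const ℝ f _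
  have hint : ∀ i, Integrable (fun x => pderiv' w i x * g i x) := by
    intro i
    refine ((hgC i).continuous.integrable_of_hasCompactSupport (hgc i)).bdd_mul (c := C)
      (hmeas w i).aestronglyMeasurable (Filter.Eventually.of_forall fun x => hbound i x)
  have hintg : ∀ i, Integrable (fun x => pderiv' (g i) i x * w x) := by
    intro i
    refine Continuous.integrable_of_hasCompactSupport ?_ hwc.mul_left
    exact (((hgC i).continuous_fderiv (by norm_num)).clm_apply continuous_const).mul hw.continuous
  have hparts : ∀ i, ∫ x, pderiv' w i x * g i x = - ∫ x, pderiv' (g i) i x * w x := by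
    intro i
    obtain ⟨D, hD⟩ := hgL i
    have h := LipschitzWith.integral_lineDeriv_mul_eq (μ := volume) hw hD (hgc i)
      (EuclideanSpace.single i 1)
    rw [← integral_neg]
    calc ∫ x, pderiv' w i x * g i x
        = ∫ x, lineDeriv ℝ w x (EuclideanSpace.single i 1) * g i x := by
          apply integral_congr_ae
          filter_upwards [hwd] with x hx
          simp only [hx.lineDeriv_eq_fderiv, pderiv']
      _ = _ := h
      _ = _ := by
          congr 1
          ext x
          rw [(((hgC i).differentiable (by norm_num)) x).lineDeriv_eq_fderiv]
          simp [pderiv']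
  have hzero : ∫ x, ∑ i, pderiv' w i x * g i x = 0 := by
    rw [integral_finsetSum _ fun i _ => hint i]
    simp_rw [hparts]
    rw [Finset.sum_neg_distrib, ← integral_finsetSum _ fun i _ => hintg i, neg_eq_zero]
    apply integral_eq_zero_of_ae
    refine Filter.Eventually.of_forall fun x => ?_
    simp only [Pi.zero_apply]
    rw [← Finset.sum_mul]
    by_cases hx : x ∈ W
    · rw [hmse x hx, zero_mul]
    · rw [hw0 x hx, mul_zero]
  have hzeroW : ∫ x in W, ∑ i, pderiv' w i x * g i x = 0 := by
    rw [← hzero]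
    apply setIntegral_eq_integral_of_ae_compl_eq_zero
    filter_upwards [aux_fderiv_zero w C hw] with x hx hxW
    simp [pderiv', hx (hw0 x hxW)]
  have hWfin : volume W ≠ ∞ := hWbdd.measure_lt_top.ne
  have hIU : IntegrableOn (fun x => Real.sqrt (1 + gradSq U x)) W :=
    (hsc.continuous.continuousOn.integrableOn_compact hWbdd.isCompact_closure).mono_set
      subset_closure
  have hVL : LipschitzWith (C + CU) (fun y => w y + U y) := hw.add hUL
  have hIV : IntegrableOn (fun x => Real.sqrt (1 + gradSq (fun y => w y + U y) x)) W := by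
    have : IsFiniteMeasure (volume.restrict W) := ⟨by simpa using hWbdd.measure_lt_top⟩
    refine Integrable.of_bound (C := Real.sqrt (1 + ∑ _i : Fin n, (C + CU : ℝ) ^ 2)) ?_ ?_
    · apply Measurable.aestronglyMeasurable
      apply Measurable.sqrt
      apply Measurable.const_add
      exact Finset.measurable_fun_sum _ fun i _ => (hmeas _ i).pow_const 2
    · refine Filter.Eventually.of_forall fun x => ?_
      rw [Real.norm_of_nonneg (Real.sqrt_nonneg _)]
      apply Real.sqrt_le_sqrt
      gcongr 1 + ?_
      apply Finset.sum_le_sum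
      intro i _
      apply sq_le_sq'
      all_goals
        have h1 : |pderiv' (fun y => w y + U y) i x| ≤ C + CU := by
          calc |pderiv' (fun y => w y + U y) i x|
              ≤ ‖fderiv ℝ (fun y => w y + U y) x‖ * ‖EuclideanSpace.single i (1 : ℝ)‖ :=
                (fderiv ℝ (fun y => w y + U y) x).le_opNorm _
            _ ≤ C + CU := by
                simpa using norm_fderiv_le_of_lipschitz ℝ hVL
        linarith [abs_le.1 h1]
  have hIs : IntegrableOn (fun x => ∑ i, pderiv' w i x * g i x) W :=
    (integrable_finsetSum _ fun i _ => hint i).integrableOn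
  calc ∫ x in W, Real.sqrt (1 + gradSq U x)
      = ∫ x in W, (Real.sqrt (1 + gradSq U x) + ∑ i, pderiv' w i x * g i x) := by
        rw [integral_add hIU hIs, hzeroW, add_zero]
    _ ≤ _ := by
        apply integral_mono_ae (hIU.add hIs) hIV
        apply ae_restrict_of_ae
        filter_upwards [hwd] with x hx
        have hUx : DifferentiableAt ℝ U x := hU.differentiable (by norm_num) x
        have h := aux_convex (fun i => pderiv' U i x) (fun i => pderiv' (fun y => w y + U y) i x)
        have h2 : ∀ i, pderiv' (fun y => w y + U y) i x - pderiv' U i x = pderiv' w i x := by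
          intro i
          simp only [pderiv']
          rw [fderiv_fun_add hx hUx]
          simp
        simp only [h2] at h
        exact h

theorem minimal_graph_area_minimizing
    (n : ℕ) (Ω : Set (EuclideanSpace ℝ (Fin n))) (hopen : IsOpen Ω)
    (u : EuclideanSpace ℝ (Fin n) → ℝ)
    (hu2 : ContDiffOn ℝ 2 u Ω) (hmse : MinimalSurfaceEq u Ω)
    (W : Set (EuclideanSpace ℝ (Fin n))) (hWopen : IsOpen W)
    (hWbdd : Bornology.IsBounded W) (hWsub : closure W ⊆ Ω)
    (K : ℝ≥0) (v : EuclideanSpace ℝ (Fin n) → ℝ)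
    (hv : LipschitzOnWith K v (closure W))
    (hbdry : ∀ x ∈ frontier W, v x = u x) :
    ∫ x in W, Real.sqrt (1 + gradSq u x) ≤ ∫ x in W, Real.sqrt (1 + gradSq v x) := by
  classical
  obtain ⟨T, hTc, hWT, hTΩ⟩ := exists_compact_between hWbdd.isCompact_closure hopen hWsub
  obtain ⟨χ, hχ1, hχ0, -⟩ := exists_contMDiffMap_one_nhds_of_subset_interior (n := (2 : ℕ∞))
    (modelWithCornersSelf ℝ (EuclideanSpace ℝ (Fin n))) isClosed_closure hWT
  have hχC : ContDiff ℝ 2 χ := χ.contMDiff.contDiff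
  have hχ1' : ∀ x ∈ closure W, χ x = 1 := fun x hx => hχ1.self_of_nhdsSet x hx
  set U : EuclideanSpace ℝ (Fin n) → ℝ := fun x => χ x * u x with hUdef
  have hUT : ∀ x ∉ T, U x = 0 := fun x hx => by simp [hUdef, hχ0 x hx]
  have hUc : HasCompactSupport U := HasCompactSupport.intro hTc hUT
  have hU : ContDiff ℝ 2 U := by
    rw [contDiff_iff_contDiffAt]
    intro x
    by_cases hx : x ∈ T
    · exact hχC.contDiffAt.mul (hu2.contDiffAt (hopen.mem_nhds (hTΩ hx)))
    · have : U =ᶠ[nhds x] fun _ => 0 := by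
        filter_upwards [hTc.isClosed.isOpen_compl.mem_nhds hx] with y hy using hUT y hy
      exact contDiffAt_const.congr_of_eventuallyEq this
  have hUu : ∀ x ∈ closure W, U x = u x := fun x hx => by simp [hUdef, hχ1' x hx]
  have hUe : ∀ x ∈ W, U =ᶠ[nhds x] u := fun x hx => by
    filter_upwards [hWopen.mem_nhds hx] with y hy using hUu y (subset_closure hy)
  obtain ⟨CU, hUL⟩ := ContDiff.lipschitzWith_of_hasCompactSupport hUc hU (by norm_num)
  have hw : LipschitzWith (K + CU) (W.indicator fun x => v x - U x) := by
    apply aux_lipschitz_extend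
    · exact hv.sub hUL.lipschitzOnWith
    · intro x hx
      rw [hbdry x hx, hUu x hx.1, sub_self]
  have hmseU : MinimalSurfaceEq U W := by
    intro x hx
    rw [← hmse x (hWsub (subset_closure hx))]
    refine Finset.sum_congr rfl fun i _ => ?_
    have : (fun y => pderiv' U i y / Real.sqrt (1 + gradSq U y)) =ᶠ[nhds x]
        (fun y => pderiv' u i y / Real.sqrt (1 + gradSq u y)) := by
      filter_upwards [hWopen.mem_nhds hx] with y hy
      rw [aux_gradSq_congr (hUe y hy)]
      simp only [pderiv', (hUe y hy).fderiv_eq]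
    rw [pderiv', this.fderiv_eq, pderiv']
  have h := aux_global U _ hU hUc _ hw W hWopen hWbdd
    (fun x hx => indicator_of_notMem hx _) hmseU
  calc _ = _ := setIntegral_congr_fun hWopen.measurableSet fun x hx => by
        simp only [aux_gradSq_congr (hUe x hx)]
    _ ≤ _ := h
    _ = _ := setIntegral_congr_fun hWopen.measurableSet fun x hx => by
        have : (fun y => W.indicator (fun x => v x - U x) y + U y) =ᶠ[nhds x] v := by
          filter_upwards [hWopen.mem_nhds hx] with y hy
          simp [hy]
        simp only [aux_gradSq_congr this]
end

section
/- Let n ≥ 1, let x ∈ ℝⁿ and r > 0, and let D ⊆ cl B_r(x) be a convex set contained in the closed ball of radius r about x. Then the (n−1)-dimensional Hausdorff measure of the frontier of D is at most that of the sphere of radius r: H^{n-1}( ∂D ) ≤ H^{n-1}( ∂B_r(x) ). -/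
open Set Metric MeasureTheory
open scoped ENNReal

/-- A supporting normal at each frontier point of a convex set. -/
theorem exists_support_normal {n : ℕ} (D : Set (EuclideanSpace ℝ (Fin n)))
    (hconv : Convex ℝ D) (p : EuclideanSpace ℝ (Fin n)) (hp : p ∈ frontier D) :
    ∃ u : EuclideanSpace ℝ (Fin n), u ≠ 0 ∧ ∀ y ∈ closure D, inner ℝ u (y - p) ≤ 0 := by
  suffices h : ∃ u : EuclideanSpace ℝ (Fin n), u ≠ 0 ∧
      ∃ A : Set (EuclideanSpace ℝ (Fin n)), closure D ⊆ closure A ∧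
        ∀ y ∈ A, inner ℝ u (y - p) ≤ 0 by
    obtain ⟨u, hu, A, hA, h⟩ := h
    refine ⟨u, hu, fun y hy => ?_⟩
    have hc : IsClosed {y : EuclideanSpace ℝ (Fin n) | inner ℝ u (y - p) ≤ 0} :=
      isClosed_le (by fun_prop) (by fun_prop)
    exact (closure_minimal h hc) (hA hy)
  by_cases hi : (interior D).Nonempty
  · obtain ⟨f, hf⟩ := geometric_hahn_banach_open_point hconv.interior isOpen_interior hp.2
    refine ⟨(InnerProductSpace.toDual ℝ _).symm f, ?_, interior D, ?_, ?_⟩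
    · intro h0
      obtain ⟨a, ha⟩ := hi
      have := hf a ha
      have hf0 : f = 0 := by simpa using h0
      simp [hf0] at this
    · exact (hconv.closure_interior_eq_closure_of_nonempty_interior hi).ge
    · intro y hy
      rw [InnerProductSpace.toDual_symm_apply, map_sub]
      linarith [hf y hy]
  · rw [hconv.interior_nonempty_iff_affineSpan_eq_top] at hi
    have hpc : p ∈ closure D := hp.1
    obtain ⟨d, hd⟩ : D.Nonempty := closure_nonempty_iff.1 ⟨p, hpc⟩
    have hdir : (affineSpan ℝ D).direction ≠ ⊤ := by
      intro h
      exact hi ((AffineSubspace.direction_eq_top_iff_of_nonempty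
        ⟨d, subset_affineSpan ℝ D hd⟩).1 h)
    have hperp : (affineSpan ℝ D).directionᗮ ≠ ⊥ := by
      intro h
      exact hdir (Submodule.orthogonal_eq_bot_iff.1 h)
    obtain ⟨u, hu, hu0⟩ := Submodule.exists_mem_ne_zero_of_ne_bot hperp
    have hpa : p ∈ affineSpan ℝ D :=
      closure_minimal (subset_affineSpan ℝ D)
        (AffineSubspace.closed_of_finiteDimensional _) hpc
    refine ⟨u, hu0, D, subset_rfl, fun y hy => ?_⟩
    have := AffineSubspace.vsub_mem_direction (subset_affineSpan ℝ D hy) hpa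
    exact (Submodule.inner_left_of_mem_orthogonal this hu).le

theorem exists_sphere_point {n : ℕ} (x : EuclideanSpace ℝ (Fin n)) (r : ℝ) (hr : 0 < r)
    (D : Set (EuclideanSpace ℝ (Fin n)))
    (hconv : Convex ℝ D) (hsub : D ⊆ Metric.closedBall x r)
    (p : EuclideanSpace ℝ (Fin n)) (hp : p ∈ frontier D) :
    ∃ q ∈ Metric.sphere x r, ∀ y ∈ closure D, inner ℝ (q - p) (y - p) ≤ 0 := by
  obtain ⟨u, hu, h⟩ := exists_support_normal D hconv p hp
  have hpx : ‖p - x‖ ≤ r := by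
    rw [← dist_eq_norm]
    exact closure_minimal hsub isClosed_closedBall hp.1
  have hun : 0 < ‖u‖ := norm_pos_iff.2 hu
  have hT : 0 ≤ 2 * r / ‖u‖ := by positivity
  have hcont : ContinuousOn (fun t : ℝ => ‖(p - x) + t • u‖) (Icc 0 (2 * r / ‖u‖)) := by
    fun_prop
  have hr1 : r ≤ ‖(p - x) + (2 * r / ‖u‖) • u‖ := by
    have h1 : ‖(2 * r / ‖u‖) • u‖ = 2 * r := by
      rw [norm_smul, Real.norm_of_nonneg hT]; field_simp
    have h2 := norm_sub_le ((p - x) + (2 * r / ‖u‖) • u) (p - x)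
    rw [add_sub_cancel_left, h1] at h2
    linarith
  obtain ⟨t, ht, hte⟩ := intermediate_value_Icc hT hcont
    (show r ∈ Icc _ _ from ⟨by simpa using hpx, hr1⟩)
  refine ⟨p + t • u, ?_, fun y hy => ?_⟩
  · rw [mem_sphere, dist_eq_norm, ← hte]
    congr 1
    abel
  · rw [add_sub_cancel_left, real_inner_smul_left]
    exact mul_nonpos_of_nonneg_of_nonpos ht.1 (h y hy)

theorem hausdorff_frontier_convex_subset_ball
    (n : ℕ) (hn : 1 ≤ n)
    (x : EuclideanSpace ℝ (Fin n)) (r : ℝ) (hr : 0 < r)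
    (D : Set (EuclideanSpace ℝ (Fin n)))
    (hconv : Convex ℝ D) (hsub : D ⊆ Metric.closedBall x r) :
    μH[(n : ℝ) - 1] (frontier D) ≤ μH[(n : ℝ) - 1] (Metric.sphere x r) := by
  have hd : (0 : ℝ) ≤ (n : ℝ) - 1 := by
    have : (1 : ℝ) ≤ n := by exact_mod_cast hn
    linarith
  choose! q hq hqi using exists_sphere_point x r hr D hconv hsub
  have key : ∀ p ∈ frontier D, ∀ p' ∈ frontier D, dist p p' ≤ dist (q p) (q p') := by
    intro p hp p' hp'
    have h1 := hqi p hp p' hp'.1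
    have h2 := hqi p' hp' p hp.1
    have h3 := real_inner_le_norm (q p - q p') (p - p')
    have h4 : inner ℝ (q p - q p') (p - p') = ‖p - p'‖ * ‖p - p'‖
        - inner ℝ (q p - p) (p' - p) - inner ℝ (q p' - p') (p - p') := by
      have e : q p - q p' = (p - p') + (q p - p) - (q p' - p') := by abel
      rw [e, inner_sub_left, inner_add_left, real_inner_self_eq_norm_mul_norm,
        ← neg_sub p p', inner_neg_right]
      ring
    rw [dist_eq_norm, dist_eq_norm]
    by_contra! hlt
    have hpos : 0 < ‖p - p'‖ := (norm_nonneg _).trans_lt hlt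
    nlinarith [mul_lt_mul_of_pos_right hlt hpos]
  have hinj : InjOn q (frontier D) := by
    intro p hp p' hp' h
    have := key p hp p' hp'
    rw [h, dist_self] at this
    exact dist_le_zero.1 this
  have hleft := hinj.leftInvOn_invFunOn
  have hlip : LipschitzOnWith 1 (Function.invFunOn q (frontier D)) (q '' frontier D) := by
    apply LipschitzOnWith.of_dist_le_mul
    rintro _ ⟨p, hp, rfl⟩ _ ⟨p', hp', rfl⟩
    rw [hleft hp, hleft hp']
    simpa using key p hp p' hp'
  have hm := hlip.hausdorffMeasure_image_le hd
  rw [hleft.image_image] at hm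
  simp only [ENNReal.coe_one, ENNReal.one_rpow, one_mul] at hm
  refine hm.trans (measure_mono ?_)
  rintro _ ⟨p, hp, rfl⟩
  exact hq p hp
end

section
/- Let Ω be a nonempty open convex proper subset of ℝⁿ, let l : ℝⁿ → ℝ be a locally Lipschitz function, and suppose u ∈ C²(Ω) ∩ C⁰(cl Ω) satisfies the minimal surface equation ∑_{i=1}^n D_i( D_i u / √(1+|Du|²) ) = 0 at every point of Ω and u = l on ∂Ω. Define E ⊆ ℝ^{n+1} by E = { (x, t) : x ∈ Ω, t < u(x) } ∪ { (x, t) : x ∈ ℝⁿ \ Ω, t < l(x) }. Then for every r > 0 and every K ≥ 0 that is a Lipschitz constant for l on the ball B_r(0) ⊂ ℝⁿ, there is a constant c > 0 depending only on n and K such that for every continuously differentiable vector field X : ℝ^{n+1} → ℝ^{n+1} with compact support contained in the ball B_r(0) ⊂ ℝ^{n+1}, one has | ∫_E div X dL^{n+1} | ≤ c (sup |X|) rⁿ. -/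
open Set Metric MeasureTheory
open scoped RealInnerProductSpace ENNReal

/-- The first `n` coordinates of a point of `ℝ^{n+1}`. -/
noncomputable def projFirst {n : ℕ} (p : EuclideanSpace ℝ (Fin (n + 1))) :
    EuclideanSpace ℝ (Fin n) :=
  (EuclideanSpace.equiv (Fin n) ℝ).symm (fun i => p i.castSucc)

/-- The region below the graph of `u` over `Ω` and below the graph of `l` outside `Ω`. -/
def lowerRegion {n : ℕ} (Ω : Set (EuclideanSpace ℝ (Fin n)))
    (l u : EuclideanSpace ℝ (Fin n) → ℝ) : Set (EuclideanSpace ℝ (Fin (n + 1))) :=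
  {p | (projFirst p ∈ Ω ∧ p (Fin.last n) < u (projFirst p)) ∨
       (projFirst p ∉ Ω ∧ p (Fin.last n) < l (projFirst p))}

/-- The divergence `∑ᵢ Dᵢ Xᵢ` of a vector field `X` on `ℝ^m`. -/
noncomputable def divg {m : ℕ} (X : EuclideanSpace ℝ (Fin m) → EuclideanSpace ℝ (Fin m))
    (p : EuclideanSpace ℝ (Fin m)) : ℝ :=
  ∑ i, fderiv ℝ X p (EuclideanSpace.single i 1) i

section Helpers
open Filter Topology ContDiff NNReal

namespace LRP

lemma lip_of_loc {E : Type*} [NormedAddCommGroup E] [NormedSpace ℝ E] [FiniteDimensional ℝ E]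
    {φ : E → ℝ} (h : LocallyLipschitz φ) (hc : HasCompactSupport φ) :
    ∃ C : ℝ≥0, LipschitzWith C φ := by
  have : ProperSpace E := FiniteDimensional.proper ℝ E
  obtain ⟨ρ, hρ⟩ := hc.isBounded.subset_closedBall (0 : E)
  obtain ⟨C, hC⟩ := LocallyLipschitzOn.exists_lipschitzOnWith_of_compact
    (isCompact_closedBall (0 : E) (ρ + 1)) (h.locallyLipschitzOn (s := closedBall 0 (ρ+1)))
  obtain ⟨M, hM⟩ := hc.exists_bound_of_continuous h.continuous
  have hM0 : 0 ≤ M := (norm_nonneg _).trans (hM 0)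
  have key : ∀ x y, x ∈ tsupport φ → dist (φ x) (φ y) ≤ max C ⟨M, hM0⟩ * dist x y := by
    intro x y hx
    have hx' : ‖x‖ ≤ ρ := by simpa using hρ hx
    by_cases hy : ‖y‖ ≤ ρ + 1
    · refine (hC.dist_le_mul x (by simpa using by linarith) y (by simpa using hy)).trans ?_
      gcongr
      exact_mod_cast le_max_left _ _
    · have hy0 : φ y = 0 := by
        by_contra hne
        have := hρ (subset_tsupport φ hne)
        simp at this
        linarith
      have hd : 1 ≤ dist x y := by
        rw [dist_comm, dist_eq_norm]
        have := norm_sub_norm_le y x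
        linarith
      rw [hy0, dist_zero_right]
      calc ‖φ x‖ ≤ M := hM x
        _ ≤ M * dist x y := by nlinarith
        _ ≤ _ := by
          gcongr
          exact le_max_right C ⟨M, hM0⟩
  refine ⟨max C ⟨M, hM0⟩, LipschitzWith.of_dist_le_mul fun x y => ?_⟩
  by_cases hx : x ∈ tsupport φ
  · exact key x y hx
  by_cases hy : y ∈ tsupport φ
  · rw [dist_comm (φ x), dist_comm x]; exact key y x hy
  · rw [image_eq_zero_of_notMem_tsupport hx, image_eq_zero_of_notMem_tsupport hy, dist_self]
    positivity

lemma exists_cutoff {E : Type*} [NormedAddCommGroup E] [NormedSpace ℝ E] [FiniteDimensional ℝ E]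
    {κ Ω : Set E} (hκ : IsCompact κ) (hΩ : IsOpen Ω) (h : κ ⊆ Ω) :
    ∃ χ : E → ℝ, ContDiff ℝ ∞ χ ∧ HasCompactSupport χ ∧ tsupport χ ⊆ Ω ∧
      ∀ x ∈ κ, ∀ᶠ y in 𝓝 x, χ y = 1 := by
  have : ProperSpace E := FiniteDimensional.proper ℝ E
  obtain ⟨t, ht, h1, h2⟩ := exists_compact_between hκ hΩ h
  obtain ⟨f, hf1, hf2, hf3⟩ := exists_contMDiffMap_one_nhds_of_subset_interior
    (n := (⊤ : ℕ∞)) (modelWithCornersSelf ℝ E) hκ.isClosed h1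
  have hs : tsupport f ⊆ t := closure_minimal
    (fun x hx => by by_contra hxt; exact hx (hf2 x hxt)) ht.isClosed
  refine ⟨f, f.contMDiff.contDiff, ht.of_isClosed_subset (isClosed_tsupport _) hs,
    hs.trans h2, fun x hx => ?_⟩
  exact (eventually_nhdsSet_iff_forall.1 hf1) x hx

lemma contDiff_cutoff_mul {E : Type*} [NormedAddCommGroup E] [NormedSpace ℝ E]
    {Ω : Set E} (hΩ : IsOpen Ω) {χ F : E → ℝ} {k : ℕ} (hχ : ContDiff ℝ ∞ χ)
    (hs : tsupport χ ⊆ Ω) (hF : ContDiffOn ℝ k F Ω) : ContDiff ℝ k (fun x => χ x * F x) := by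
  rw [contDiff_iff_contDiffAt]
  intro x
  by_cases hx : x ∈ tsupport χ
  · exact (hχ.contDiffAt.of_le (by exact_mod_cast le_top)).mul (hF.contDiffAt (hΩ.mem_nhds (hs hx)))
  · have : (fun x => χ x * F x) =ᶠ[𝓝 x] fun _ => 0 := by
      filter_upwards [(isClosed_tsupport χ).isOpen_compl.mem_nhds hx] with y hy
      rw [image_eq_zero_of_notMem_tsupport hy, zero_mul]
    exact contDiffAt_const.congr_of_eventuallyEq this

lemma pow_sub_bound (n : ℕ) {a b r : ℝ} (ha : 0 ≤ a) (hab : a ≤ b) (hbr : b ≤ r) :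
    (b ^ n - a ^ n) * r ≤ n * (b - a) * r ^ n := by
  have hr : 0 ≤ r := ha.trans (hab.trans hbr)
  rcases n with _ | n
  · simp
  have h := abs_pow_sub_pow_le b a (n+1)
  rw [abs_of_nonneg (sub_nonneg.2 (pow_le_pow_left₀ ha hab _)), abs_of_nonneg (sub_nonneg.2 hab),
    abs_of_nonneg ha, abs_of_nonneg (ha.trans hab), max_eq_left hab] at h
  have h2 : b ^ n ≤ r ^ n := pow_le_pow_left₀ (ha.trans hab) hbr _
  simp only [Nat.add_sub_cancel] at h
  calc (b ^ (n+1) - a ^ (n+1)) * r ≤ ((b - a) * ((n+1:ℕ):ℝ) * b ^ n) * r := by gcongr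
    _ ≤ ((b - a) * ((n+1:ℕ):ℝ) * r ^ n) * r := by
      have : 0 ≤ (b - a) * ((n+1:ℕ):ℝ) := mul_nonneg (sub_nonneg.2 hab) (by positivity)
      gcongr
    _ = _ := by ring

/-- Integration by parts against a `C¹` divergence free field. -/
lemma weak_eq {n : ℕ} {Ω : Set (EuclideanSpace ℝ (Fin n))} (hΩ : IsOpen Ω)
    (A : Fin n → EuclideanSpace ℝ (Fin n) → ℝ) (hA : ∀ i, ContDiffOn ℝ 1 (A i) Ω)
    (hdiv : ∀ x ∈ Ω, ∑ i, pderiv' (A i) i x = 0)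
    {φ : EuclideanSpace ℝ (Fin n) → ℝ} {C : ℝ≥0} (hφ : LipschitzWith C φ)
    (hc : HasCompactSupport φ) (hs : tsupport φ ⊆ Ω) :
    Integrable (fun x => ∑ i, A i x * lineDeriv ℝ φ x (EuclideanSpace.single i 1)) ∧
    ∫ x, ∑ i, A i x * lineDeriv ℝ φ x (EuclideanSpace.single i 1) = 0 := by
  obtain ⟨χ, hχ, hχc, hχs, hχ1⟩ := exists_cutoff hc.isCompact hΩ hs
  have hB : ∀ i, ContDiff ℝ 1 (fun x => χ x * A i x) := fun i =>
    contDiff_cutoff_mul hΩ hχ hχs (k := 1) (hA i)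
  have hBc : ∀ i, HasCompactSupport (fun x => χ x * A i x) := fun i => hχc.mul_right
  have hd0 : ∀ x ∉ tsupport φ, ∀ v, lineDeriv ℝ φ x v = 0 := by
    intro x hx v
    have : φ =ᶠ[𝓝 x] fun _ => 0 := by
      filter_upwards [(isClosed_tsupport φ).isOpen_compl.mem_nhds hx] with y hy
      exact image_eq_zero_of_notMem_tsupport hy
    rw [this.lineDeriv_eq]
    simp [lineDeriv]
  have heq : ∀ i x, A i x * lineDeriv ℝ φ x (EuclideanSpace.single i 1)
      = lineDeriv ℝ φ x (EuclideanSpace.single i 1) * (χ x * A i x) := by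
    intro i x
    by_cases hx : x ∈ tsupport φ
    · rw [(hχ1 x hx).self_of_nhds]; ring
    · rw [hd0 x hx]; ring
  have hint : ∀ i, Integrable (fun x => A i x * lineDeriv ℝ φ x (EuclideanSpace.single i 1)) := by
    intro i
    simp_rw [heq i]
    refine Integrable.bdd_mul (c := C * ‖(EuclideanSpace.single i 1 : EuclideanSpace ℝ (Fin n))‖)
      ((hB i).continuous.integrable_of_hasCompactSupport (hBc i))
      (aestronglyMeasurable_lineDeriv hφ.continuous _) ?_
    exact .of_forall fun x => norm_lineDeriv_le_of_lipschitz ℝ hφ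
  have hint2 : ∀ i, Integrable (fun x => lineDeriv ℝ (fun x => χ x * A i x) x
      (-EuclideanSpace.single i 1) * φ x) := by
    intro i
    obtain ⟨D, hD⟩ := ContDiff.lipschitzWith_of_hasCompactSupport (hBc i) (hB i) (by simp)
    refine Integrable.bdd_mul (c := D * ‖-(EuclideanSpace.single i 1 : EuclideanSpace ℝ (Fin n))‖)
      (hφ.continuous.integrable_of_hasCompactSupport hc)
      (aestronglyMeasurable_lineDeriv hD.continuous _) ?_
    exact .of_forall fun x => norm_lineDeriv_le_of_lipschitz ℝ hD
  refine ⟨integrable_finsetSum _ fun i _ => hint i, ?_⟩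
  rw [integral_finsetSum _ fun i _ => hint i]
  have h1 : ∀ i, ∫ x, A i x * lineDeriv ℝ φ x (EuclideanSpace.single i 1)
      = ∫ x, lineDeriv ℝ (fun x => χ x * A i x) x (-EuclideanSpace.single i 1) * φ x := by
    intro i
    obtain ⟨D, hD⟩ := ContDiff.lipschitzWith_of_hasCompactSupport (hBc i) (hB i) (by simp)
    simp_rw [heq i]
    exact LipschitzWith.integral_lineDeriv_mul_eq hφ hD (hBc i) _
  simp_rw [h1]
  rw [← integral_finsetSum _ fun i _ => hint2 i]
  apply integral_eq_zero_of_ae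
  refine .of_forall fun x => ?_
  by_cases hx : x ∈ tsupport φ
  · simp only [Pi.zero_apply]
    rw [← Finset.sum_mul]
    have : ∀ i, lineDeriv ℝ (fun x => χ x * A i x) x (-EuclideanSpace.single i 1)
        = - pderiv' (A i) i x := by
      intro i
      have h2 : (fun x => χ x * A i x) =ᶠ[𝓝 x] A i := by
        filter_upwards [hχ1 x hx] with y hy
        rw [hy, one_mul]
      rw [h2.lineDeriv_eq, lineDeriv_neg, pderiv']
      rw [DifferentiableAt.lineDeriv_eq_fderiv]
      exact ((hA i).contDiffAt (hΩ.mem_nhds (hs hx))).differentiableAt (by simp)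
    simp_rw [this]
    rw [Finset.sum_neg_distrib, hdiv x (hs hx)]
    simp
  · simp [image_eq_zero_of_notMem_tsupport hx]

end LRP

namespace LRP

/-- The point `(x, t)` of `ℝ^{n+1}`. -/
noncomputable def P (n : ℕ) : EuclideanSpace ℝ (Fin n) × ℝ →L[ℝ] EuclideanSpace ℝ (Fin (n + 1)) :=
  LinearMap.toContinuousLinearMap
    { toFun := fun z => WithLp.toLp 2 (Fin.snoc (α := fun _ => ℝ) (fun i => z.1 i) z.2)
      map_add' := by
        intro a b
        ext i
        refine Fin.lastCases ?_ (fun j => ?_) i <;> simp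
      map_smul' := by
        intro a b
        ext i
        refine Fin.lastCases ?_ (fun j => ?_) i <;> simp }

variable {n : ℕ}

@[simp] lemma P_last (z : EuclideanSpace ℝ (Fin n) × ℝ) : P n z (Fin.last n) = z.2 := by
  simp [P]

@[simp] lemma P_castSucc (z : EuclideanSpace ℝ (Fin n) × ℝ) (i : Fin n) :
    P n z i.castSucc = z.1 i := by
  simp [P]

@[simp] lemma projFirst_P (z : EuclideanSpace ℝ (Fin n) × ℝ) : projFirst (P n z) = z.1 := by
  ext i
  simp [projFirst]

lemma norm_P_sq (z : EuclideanSpace ℝ (Fin n) × ℝ) : ‖P n z‖ ^ 2 = ‖z.1‖ ^ 2 + z.2 ^ 2 := by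
  simp [EuclideanSpace.norm_sq_eq, Fin.sum_univ_castSucc]

lemma fst_le_norm_P (z : EuclideanSpace ℝ (Fin n) × ℝ) : ‖z.1‖ ≤ ‖P n z‖ := by
  have := norm_P_sq z
  exact abs_le_of_sq_le_sq' (by nlinarith [sq_nonneg z.2]) (norm_nonneg _) |>.2

lemma snd_le_norm_P (z : EuclideanSpace ℝ (Fin n) × ℝ) : |z.2| ≤ ‖P n z‖ := by
  have := norm_P_sq z
  exact abs_le_of_sq_le_sq (by nlinarith [sq_nonneg ‖z.1‖]) (norm_nonneg _)

lemma P_surj (p : EuclideanSpace ℝ (Fin (n + 1))) : P n (projFirst p, p (Fin.last n)) = p := by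
  ext i
  refine Fin.lastCases ?_ (fun j => ?_) i
  · simp
  · simp [projFirst]

lemma norm_projFirst_le (p : EuclideanSpace ℝ (Fin (n + 1))) : ‖projFirst p‖ ≤ ‖p‖ := by
  have := fst_le_norm_P (projFirst p, p (Fin.last n))
  rwa [P_surj] at this

lemma P_inj : Function.Injective (P n) := by
  intro a b h
  refine Prod.ext ?_ ?_
  · rw [← projFirst_P a, h, projFirst_P]
  · rw [← P_last a, h, P_last]

lemma P_mp : MeasurePreserving (P n) (volume.prod volume) volume := by
  have h1 := (PiLp.volume_preserving_ofLp (Fin n))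
  have h2 := h1.prod (MeasurePreserving.id (volume : Measure ℝ))
  have h3 := (Measure.measurePreserving_swap (μ := (volume : Measure (Fin n → ℝ)))
    (ν := (volume : Measure ℝ))).comp h2
  have h4 := (volume_preserving_piFinSuccAbove (fun _ : Fin (n+1) => ℝ) (Fin.last n)).symm
  have h5 := (PiLp.volume_preserving_toLp (Fin (n+1))).comp (h4.comp h3)
  have h6 : (P n : EuclideanSpace ℝ (Fin n) × ℝ → EuclideanSpace ℝ (Fin (n + 1))) =
    WithLp.toLp 2 ∘ (MeasurableEquiv.piFinSuccAbove (fun _ : Fin (n+1) => ℝ) (Fin.last n)).symm ∘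
      Prod.swap ∘ Prod.map WithLp.ofLp id := by
    ext z i
    refine Fin.lastCases ?_ (fun j => ?_) i
    · simp [MeasurableEquiv.piFinSuccAbove]
    · simp [MeasurableEquiv.piFinSuccAbove]
  rw [h6]
  exact h5

lemma P_emb : MeasurableEmbedding (P n) :=
  (LinearMap.isClosedEmbedding_of_injective (f := (P n).toLinearMap)
    (LinearMap.ker_eq_bot.2 P_inj)).measurableEmbedding

lemma integral_P (F : EuclideanSpace ℝ (Fin (n + 1)) → ℝ) :
    ∫ z, F (P n z) ∂(volume.prod volume) = ∫ p, F p := P_mp.integral_comp P_emb F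

lemma P_single (i : Fin n) (a : ℝ) : P n (EuclideanSpace.single i 1, a) =
    EuclideanSpace.single i.castSucc 1 + a • EuclideanSpace.single (Fin.last n) 1 := by
  ext k
  refine Fin.lastCases ?_ (fun j => ?_) k
  · simp
  · simp

lemma P_zero_one : P n (0, 1) = EuclideanSpace.single (Fin.last n) 1 := by
  ext k
  refine Fin.lastCases ?_ (fun j => ?_) k
  · simp
  · simp

end LRP

namespace LRP
variable {n : ℕ}

/-- Vertical shear. -/
def shear {g : EuclideanSpace ℝ (Fin n) → ℝ} (hg : Continuous g) :
    EuclideanSpace ℝ (Fin n) × ℝ ≃ₜ EuclideanSpace ℝ (Fin n) × ℝ where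
  toFun z := (z.1, z.2 + g z.1)
  invFun z := (z.1, z.2 - g z.1)
  left_inv z := by simp
  right_inv z := by simp
  continuous_toFun := by fun_prop
  continuous_invFun := by fun_prop

lemma P_closedEmb : IsClosedEmbedding (P n) :=
  LinearMap.isClosedEmbedding_of_injective (f := (P n).toLinearMap)
    (LinearMap.ker_eq_bot.2 P_inj)

lemma slice_lip {Y : EuclideanSpace ℝ (Fin (n + 1)) → ℝ} {D : ℝ≥0} (hY : LipschitzWith D Y)
    {g : EuclideanSpace ℝ (Fin n) → ℝ} {C : ℝ≥0} (hg : LipschitzWith C g) (t : ℝ) :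
    ∃ D' : ℝ≥0, LipschitzWith D' (fun x => Y (P n (x, t + g x))) := by
  have h1 : LipschitzWith _ (fun x : EuclideanSpace ℝ (Fin n) => (x, t + g x)) :=
    LipschitzWith.id.prodMk ((LipschitzWith.const t).add hg)
  exact ⟨_, hY.comp ((P n).lipschitz.comp h1)⟩

lemma vert_contDiff {Y : EuclideanSpace ℝ (Fin (n + 1)) → ℝ} (hY : ContDiff ℝ 1 Y)
    (x : EuclideanSpace ℝ (Fin n)) : ContDiff ℝ 1 (fun t : ℝ => Y (P n (x, t))) := by
  fun_prop

lemma vert_deriv {Y : EuclideanSpace ℝ (Fin (n + 1)) → ℝ} (hY : ContDiff ℝ 1 Y)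
    (x : EuclideanSpace ℝ (Fin n)) (t : ℝ) : deriv (fun t : ℝ => Y (P n (x, t))) t =
      fderiv ℝ Y (P n (x, t)) (EuclideanSpace.single (Fin.last n) 1) := by
  have h1 : HasDerivAt (fun t : ℝ => (x, t)) ((0 : EuclideanSpace ℝ (Fin n)), (1 : ℝ)) t :=
    (hasDerivAt_const t x).prodMk (hasDerivAt_id t)
  have h2 := (P n).hasFDerivAt.comp_hasDerivAt t h1
  have h3 := ((hY.differentiable (by simp)) (P n (x, t))).hasFDerivAt.comp_hasDerivAt t h2
  rw [← P_zero_one]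
  exact h3.deriv

lemma vert_compact {Y : EuclideanSpace ℝ (Fin (n + 1)) → ℝ} (hc : HasCompactSupport Y)
    (x : EuclideanSpace ℝ (Fin n)) : HasCompactSupport (fun t : ℝ => Y (P n (x, t))) := by
  have h1 : IsClosedEmbedding (fun t : ℝ => (x, t)) := by
    refine IsClosedEmbedding.of_continuous_injective_isClosedMap (by fun_prop)
      (fun a b h => by simpa using h) ?_
    intro s hs
    have : (fun t : ℝ => (x, t)) '' s = {x} ×ˢ s := by ext ⟨a, b⟩; aesop
    rw [this]
    exact isClosed_singleton.prod hs
  exact hc.comp_isClosedEmbedding (P_closedEmb.comp h1)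

lemma vert_ftc {Y : EuclideanSpace ℝ (Fin (n + 1)) → ℝ} (hY : ContDiff ℝ 1 Y)
    (hc : HasCompactSupport Y) (x : EuclideanSpace ℝ (Fin n)) (a : ℝ) :
    ∫ t in Iic a, fderiv ℝ Y (P n (x, t)) (EuclideanSpace.single (Fin.last n) 1)
      = Y (P n (x, a)) := by
  simp_rw [← vert_deriv hY]
  exact HasCompactSupport.integral_Iic_deriv_eq (vert_contDiff hY x) (vert_compact hc x) a

lemma shift_Iic (F : ℝ → ℝ) (a : ℝ) : ∫ t in Iic 0, F (t + a) = ∫ t in Iic a, F t := by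
  have := (measurePreserving_add_right (volume : Measure ℝ) a).setIntegral_preimage_emb
    (MeasurableEquiv.addRight a).measurableEmbedding F (Iic a)
  simpa using this

lemma fderiv_apply_cont {m : ℕ} {Y : EuclideanSpace ℝ (Fin m) → ℝ} (hY : ContDiff ℝ 1 Y)
    (v : EuclideanSpace ℝ (Fin m)) : Continuous (fun p => fderiv ℝ Y p v) :=
  (hY.continuous_fderiv (by simp)).clm_apply continuous_const

lemma subgraph_horiz {Y : EuclideanSpace ℝ (Fin (n + 1)) → ℝ} (hY : ContDiff ℝ 1 Y)
    (hc : HasCompactSupport Y)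
    {g : EuclideanSpace ℝ (Fin n) → ℝ} {C : ℝ≥0} (hg : LipschitzWith C g) (i : Fin n) :
    Integrable (fun x => ∫ t in Iic (g x), fderiv ℝ Y (P n (x, t))
      (EuclideanSpace.single i.castSucc 1)) ∧
    Integrable (fun x => lineDeriv ℝ g x (EuclideanSpace.single i 1) * Y (P n (x, g x))) ∧
    ∫ x, ∫ t in Iic (g x), fderiv ℝ Y (P n (x, t)) (EuclideanSpace.single i.castSucc 1)
      = - ∫ x, lineDeriv ℝ g x (EuclideanSpace.single i 1) * Y (P n (x, g x)) := by
  set a : EuclideanSpace ℝ (Fin n) × ℝ → ℝ := fun z =>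
    fderiv ℝ Y (P n (z.1, z.2 + g z.1)) (EuclideanSpace.single i.castSucc 1) with ha
  set b : EuclideanSpace ℝ (Fin n) × ℝ → ℝ := fun z =>
    fderiv ℝ Y (P n (z.1, z.2 + g z.1)) (EuclideanSpace.single (Fin.last n) 1) with hb
  have hgc := hg.continuous
  have hemb : IsClosedEmbedding (fun z : EuclideanSpace ℝ (Fin n) × ℝ =>
      P n (z.1, z.2 + g z.1)) := P_closedEmb.comp (shear hgc).isClosedEmbedding
  have hac : Continuous a := (fderiv_apply_cont hY _).comp hemb.continuous
  have hbc : Continuous b := (fderiv_apply_cont hY _).comp hemb.continuous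
  have has : HasCompactSupport a :=
    (hc.fderiv_apply ℝ (EuclideanSpace.single i.castSucc 1)).comp_isClosedEmbedding hemb
  have hbs : HasCompactSupport b :=
    (hc.fderiv_apply ℝ (EuclideanSpace.single (Fin.last n) 1)).comp_isClosedEmbedding hemb
  set ν : Measure ℝ := volume.restrict (Iic 0) with hν
  have hai : Integrable a (volume.prod ν) := hac.integrable_of_hasCompactSupport has
  have hbi : Integrable b (volume.prod ν) := hbc.integrable_of_hasCompactSupport hbs
  set dg : EuclideanSpace ℝ (Fin n) → ℝ := fun x => lineDeriv ℝ g x (EuclideanSpace.single i 1)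
    with hdg
  have hdgm : Measurable dg := measurable_lineDeriv hgc
  have hdgb : ∀ x, ‖dg x‖ ≤ C * ‖(EuclideanSpace.single i 1 : EuclideanSpace ℝ (Fin n))‖ :=
    fun x => norm_lineDeriv_le_of_lipschitz ℝ hg
  have hdbi : Integrable (fun z => dg z.1 * b z) (volume.prod ν) :=
    hbi.bdd_mul (hdgm.comp measurable_fst).aestronglyMeasurable (.of_forall fun z => hdgb z.1)
  obtain ⟨D, hD⟩ := ContDiff.lipschitzWith_of_hasCompactSupport hc hY (by simp)
  have hgd := hg.ae_differentiableAt (μ := volume)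
  -- the slices
  have hslice : ∀ t, ∫ x, (a (x, t) + dg x * b (x, t)) = 0 := by
    intro t
    obtain ⟨D', hD'⟩ := slice_lip hD hg t
    have hcs : HasCompactSupport (fun x => Y (P n (x, t + g x))) := by
      have h1 : IsClosedEmbedding (fun x : EuclideanSpace ℝ (Fin n) => (x, t)) := by
        refine IsClosedEmbedding.of_continuous_injective_isClosedMap (by fun_prop)
          (fun a b h => by simpa using h) ?_
        intro s hs
        have : (fun x : EuclideanSpace ℝ (Fin n) => (x, t)) '' s = s ×ˢ {t} := by
          ext ⟨a, b⟩; aesop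
        rw [this]
        exact hs.prod isClosed_singleton
      exact hc.comp_isClosedEmbedding (hemb.comp h1)
    have h0 := LipschitzWith.integral_lineDeriv_mul_eq (μ := volume)
      (LipschitzWith.const (1 : ℝ)) hD' hcs (-(EuclideanSpace.single i 1))
    have h1 : ∀ x : EuclideanSpace ℝ (Fin n), lineDeriv ℝ
      (fun _ : EuclideanSpace ℝ (Fin n) => (1 : ℝ)) x (-(EuclideanSpace.single i 1)) = 0 := by
      intro x; simp [lineDeriv]
    simp only [h1, zero_mul, integral_zero, neg_neg, mul_one] at h0
    rw [h0]
    apply integral_congr_ae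
    filter_upwards [hgd] with x hx
    have e1 : HasFDerivAt (fun x : EuclideanSpace ℝ (Fin n) => (x, t + g x))
      ((ContinuousLinearMap.id ℝ _).prod (fderiv ℝ g x)) x :=
      (hasFDerivAt_id x).prodMk (hx.hasFDerivAt.const_add t)
    have e2 := (P n).hasFDerivAt.comp x e1
    have e3 := ((hY.differentiable (by simp)) (P n (x, t + g x))).hasFDerivAt.comp x e2
    have e4 := (e3.hasLineDerivAt (EuclideanSpace.single i 1)).lineDeriv
    have e5 : lineDeriv ℝ (fun x => Y (P n (x, t + g x))) x (EuclideanSpace.single i 1) = _ := e4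
    rw [e5]
    simp only [ha, hb, hdg, ContinuousLinearMap.comp_apply, ContinuousLinearMap.prod_apply,
      ContinuousLinearMap.id_apply, hx.lineDeriv_eq_fderiv]
    rw [P_single]
    simp
  have hsum : Integrable (fun z => a z + dg z.1 * b z) (volume.prod ν) := hai.add hdbi
  have hswap := integral_integral_swap (f := fun x t => a (x, t) + dg x * b (x, t)) hsum
  simp only [hslice, integral_zero] at hswap
  have hbt : ∀ x, ∫ t, b (x, t) ∂ν = Y (P n (x, g x)) := by
    intro x
    rw [← vert_ftc hY hc x (g x)]
    exact shift_Iic (fun s => fderiv ℝ Y (P n (x, s)) (EuclideanSpace.single (Fin.last n) 1)) (g x)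
  have hat : ∀ x, ∫ t, a (x, t) ∂ν = ∫ t in Iic (g x), fderiv ℝ Y (P n (x, t))
      (EuclideanSpace.single i.castSucc 1) := by
    intro x
    exact shift_Iic (fun s => fderiv ℝ Y (P n (x, s)) (EuclideanSpace.single i.castSucc 1)) (g x)
  have hI1 := hai.integral_prod_left
  have hI2 := hdbi.integral_prod_left
  simp only [hat] at hI1
  simp only [integral_const_mul, hbt] at hI2
  refine ⟨hI1, hI2, ?_⟩
  have h3 : ∀ x, ∫ t, (a (x, t) + dg x * b (x, t)) ∂ν = (∫ t in Iic (g x), fderiv ℝ Y (P n (x, t))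
      (EuclideanSpace.single i.castSucc 1)) + dg x * Y (P n (x, g x)) := by
    intro x
    have i1 : Integrable (fun t => a (x, t)) ν := by
      refine (hac.comp (by fun_prop : Continuous fun t : ℝ => (x, t))).integrable_of_hasCompactSupport ?_
      have := vert_compact (hc.fderiv_apply ℝ (EuclideanSpace.single i.castSucc 1)) x
      exact this.comp_homeomorph (Homeomorph.addRight (g x))
    have i2 : Integrable (fun t => b (x, t)) ν := by
      refine (hbc.comp (by fun_prop : Continuous fun t : ℝ => (x, t))).integrable_of_hasCompactSupport ?_
      have := vert_compact (hc.fderiv_apply ℝ (EuclideanSpace.single (Fin.last n) 1)) x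
      exact this.comp_homeomorph (Homeomorph.addRight (g x))
    rw [integral_add i1 (i2.const_mul _), integral_const_mul, hbt, hat]
  simp only [h3] at hswap
  rw [integral_add hI1 hI2] at hswap
  linarith

end LRP

namespace LRP
variable {n : ℕ}

lemma comp_contDiff {m : ℕ} {X : EuclideanSpace ℝ (Fin m) → EuclideanSpace ℝ (Fin m)}
    (hX : ContDiff ℝ 1 X) (i : Fin m) : ContDiff ℝ 1 (fun p => X p i) :=
  (EuclideanSpace.proj (𝕜 := ℝ) i).contDiff.comp hX

lemma comp_compact {m : ℕ} {X : EuclideanSpace ℝ (Fin m) → EuclideanSpace ℝ (Fin m)}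
    (hX : HasCompactSupport X) (i : Fin m) : HasCompactSupport (fun p => X p i) :=
  hX.comp_left (g := fun v : EuclideanSpace ℝ (Fin m) => v i) (by simp)

lemma divg_eq {m : ℕ} {X : EuclideanSpace ℝ (Fin m) → EuclideanSpace ℝ (Fin m)}
    (hX : ContDiff ℝ 1 X) (p : EuclideanSpace ℝ (Fin m)) :
    divg X p = ∑ i, fderiv ℝ (fun q => X q i) p (EuclideanSpace.single i 1) := by
  unfold divg
  refine Finset.sum_congr rfl fun i _ => ?_
  have h := (EuclideanSpace.proj (𝕜 := ℝ) i).hasFDerivAt.comp p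
    ((hX.differentiable (by simp)) p).hasFDerivAt
  have h2 : fderiv ℝ (fun q => X q i) p = _ := h.fderiv
  rw [h2]
  rfl

lemma fderiv_vert_integrable {Y : EuclideanSpace ℝ (Fin (n + 1)) → ℝ} (hY : ContDiff ℝ 1 Y)
    (hc : HasCompactSupport Y) (x : EuclideanSpace ℝ (Fin n)) (v : EuclideanSpace ℝ (Fin (n + 1))) :
    Integrable (fun t => fderiv ℝ Y (P n (x, t)) v) := by
  refine ((fderiv_apply_cont hY v).comp (by fun_prop : Continuous fun t : ℝ => P n (x, t))
    ).integrable_of_hasCompactSupport ?_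
  exact vert_compact (hc.fderiv_apply ℝ v) x

lemma norm_fderiv_integrableOn {E : Type*} [NormedAddCommGroup E] [NormedSpace ℝ E]
    [FiniteDimensional ℝ E] [MeasurableSpace E] [BorelSpace E] {μ : Measure E}
    [IsFiniteMeasureOnCompacts μ]
    {g : E → ℝ} {C : ℝ≥0} (hg : LipschitzWith C g) (x₀ : E) (ρ : ℝ) :
    IntegrableOn (fun x => ‖fderiv ℝ g x‖) (ball x₀ ρ) μ := by
  have : ProperSpace E := FiniteDimensional.proper ℝ E
  refine Measure.integrableOn_of_bounded (M := C) measure_ball_lt_top.ne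
    (measurable_fderiv ℝ g).norm.aestronglyMeasurable (.of_forall fun x => ?_)
  rw [norm_norm]
  exact norm_fderiv_le_of_lipschitz ℝ hg

lemma subgraph_bound {X : EuclideanSpace ℝ (Fin (n + 1)) → EuclideanSpace ℝ (Fin (n + 1))}
    (hX : ContDiff ℝ 1 X) (hc : HasCompactSupport X) {M ρ : ℝ} (hM : ∀ p, ‖X p‖ ≤ M)
    (hρ : ∀ p, ρ ≤ ‖p‖ → X p = 0)
    {g : EuclideanSpace ℝ (Fin n) → ℝ} {C : ℝ≥0} (hg : LipschitzWith C g) :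
    |∫ x, ∫ t in Iic (g x), divg X (P n (x, t))| ≤
      M * ∫ x in ball (0 : EuclideanSpace ℝ (Fin n)) ρ, (1 + ‖fderiv ℝ g x‖) := by
  have hYd := comp_contDiff hX
  have hYc := comp_compact hc
  have hgc := hg.continuous
  have hsplit : ∀ x, ∫ t in Iic (g x), divg X (P n (x, t)) =
      (∑ i : Fin n, ∫ t in Iic (g x), fderiv ℝ (fun q => X q i.castSucc) (P n (x, t))
        (EuclideanSpace.single i.castSucc 1)) + X (P n (x, g x)) (Fin.last n) := by
    intro x
    simp_rw [divg_eq hX]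
    rw [integral_finsetSum _ fun i _ => (fderiv_vert_integrable (hYd i) (hYc i) x _).integrableOn,
      Fin.sum_univ_castSucc, vert_ftc (hYd _) (hYc _)]
  have hlast : Integrable (fun x => X (P n (x, g x)) (Fin.last n)) := by
    refine Continuous.integrable_of_hasCompactSupport ?_ ?_
    · exact (hYd (Fin.last n)).continuous.comp (by fun_prop)
    · refine HasCompactSupport.intro (isCompact_closedBall 0 ρ) fun x hx => ?_
      rw [hρ]
      · simp
      · simp at hx
        exact hx.le.trans (fst_le_norm_P (x, g x))
  have h1 := fun i : Fin n => subgraph_horiz (hYd i.castSucc) (hYc i.castSucc) hg i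
  simp_rw [hsplit]
  rw [integral_add (integrable_finsetSum _ fun i _ => (h1 i).1) hlast,
    integral_finsetSum _ fun i _ => (h1 i).1]
  simp_rw [fun i => (h1 i).2.2]
  rw [Finset.sum_neg_distrib, ← integral_finsetSum _ fun i _ => (h1 i).2.1, neg_add_eq_sub,
    ← integral_sub hlast (integrable_finsetSum _ fun i _ => (h1 i).2.1)]
  rw [← integral_const_mul, ← integral_indicator measurableSet_ball, ← Real.norm_eq_abs]
  refine norm_integral_le_of_norm_le ?_ ?_
  · rw [integrable_indicator_iff measurableSet_ball]
    refine Integrable.const_mul (Integrable.add ?_ (norm_fderiv_integrableOn hg 0 ρ)) M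
    exact integrableOn_const measure_ball_lt_top.ne
  filter_upwards [hg.ae_differentiableAt (μ := volume)] with x hx
  by_cases hxρ : x ∈ ball (0 : EuclideanSpace ℝ (Fin n)) ρ
  · rw [indicator_of_mem hxρ]
    set V := X (P n (x, g x)) with hV
    have hs : ∑ i : Fin n, lineDeriv ℝ g x (EuclideanSpace.single i 1) * V i.castSucc
        = fderiv ℝ g x (projFirst V) := by
      have : projFirst V = ∑ i : Fin n, V i.castSucc • EuclideanSpace.single i (1 : ℝ) := by
        ext j
        simp [projFirst, Finset.sum_apply, Pi.single_apply]
      rw [this, map_sum]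
      refine Finset.sum_congr rfl fun i _ => ?_
      rw [hx.lineDeriv_eq_fderiv, map_smul, smul_eq_mul, mul_comm]
    rw [hs]
    have b1 : ‖V (Fin.last n)‖ ≤ M := (PiLp.norm_apply_le V _).trans (hM _)
    have b2 : ‖fderiv ℝ g x (projFirst V)‖ ≤ ‖fderiv ℝ g x‖ * M :=
      (ContinuousLinearMap.le_opNorm _ _).trans
        (mul_le_mul_of_nonneg_left ((norm_projFirst_le V).trans (hM _)) (norm_nonneg _))
    calc _ ≤ ‖V (Fin.last n)‖ + ‖fderiv ℝ g x (projFirst V)‖ := norm_sub_le _ _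
      _ ≤ M * (1 + ‖fderiv ℝ g x‖) := by linarith
  · rw [indicator_of_notMem hxρ]
    have : X (P n (x, g x)) = 0 := by
      apply hρ
      simp at hxρ
      exact hxρ.trans (fst_le_norm_P (x, g x))
    simp [this]

end LRP

namespace LRP
variable {n : ℕ}

/-- Truncation at height `R`. -/
noncomputable def clamp (R a : ℝ) : ℝ := max (-R) (min a R)

/-- Soft thresholding. -/
noncomputable def soft (δ s : ℝ) : ℝ := s - clamp δ s

lemma clamp_cont (R : ℝ) : Continuous (clamp R) := by unfold clamp; fun_prop

lemma clamp_of_abs_le {R a : ℝ} (h : |a| ≤ R) : clamp R a = a := by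
  rw [abs_le] at h
  unfold clamp
  rw [min_eq_left h.2, max_eq_right h.1]

lemma clamp_of_ge {R a : ℝ} (hR : 0 ≤ R) (h : R ≤ a) : clamp R a = R := by
  unfold clamp
  rw [min_eq_right h, max_eq_right (by linarith)]

lemma clamp_of_le {R a : ℝ} (hR : 0 ≤ R) (h : a ≤ -R) : clamp R a = -R := by
  unfold clamp
  rw [min_eq_left (by linarith), max_eq_left (by linarith)]

lemma clamp_le {R : ℝ} (hR : 0 ≤ R) (a : ℝ) : clamp R a ≤ R := by
  unfold clamp
  exact max_le (by linarith) (min_le_right _ _)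

lemma le_clamp (R a : ℝ) : -R ≤ clamp R a := le_max_left _ _

lemma abs_clamp_le {R : ℝ} (hR : 0 ≤ R) (a : ℝ) : |clamp R a| ≤ R :=
  abs_le.2 ⟨le_clamp R a, clamp_le hR a⟩

lemma soft_of_abs_le {δ s : ℝ} (h : |s| ≤ δ) : soft δ s = 0 := by
  rw [soft, clamp_of_abs_le h, sub_self]

lemma abs_soft_sub {δ : ℝ} (hδ : 0 ≤ δ) (s : ℝ) : |soft δ s - s| ≤ δ := by
  have : soft δ s - s = - clamp δ s := by unfold soft; ring
  rw [this, abs_neg]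
  exact abs_clamp_le hδ s

lemma soft_nonneg {δ s : ℝ} (h : -δ ≤ s) : 0 ≤ soft δ s := by
  unfold soft clamp
  have := max_le h (min_le_left s δ)
  linarith

lemma soft_nonpos {δ s : ℝ} (h : s ≤ δ) : soft δ s ≤ 0 := by
  unfold soft clamp
  rw [min_eq_left h]
  have := le_max_right (-δ) s
  linarith

lemma abs_soft_le {δ s : ℝ} (hδ : 0 ≤ δ) : |soft δ s| ≤ |s| := by
  rcases le_total |s| δ with h | h
  · rw [soft_of_abs_le h]; simp
  · rcases le_total 0 s with h0 | h0
    · rw [abs_of_nonneg h0] at h ⊢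
      rw [soft, clamp_of_ge hδ h, abs_of_nonneg] <;> linarith
    · rw [abs_of_nonpos h0] at h ⊢
      rw [soft, clamp_of_le hδ (by linarith), abs_of_nonpos] <;> linarith

/-- The vector `Du / √(1+|Du|²)`. -/
noncomputable def Avec (u : EuclideanSpace ℝ (Fin n) → ℝ) (x : EuclideanSpace ℝ (Fin n)) :
    EuclideanSpace ℝ (Fin n) :=
  WithLp.toLp 2 (fun i => pderiv' u i x / Real.sqrt (1 + gradSq u x))

lemma gradSq_nonneg (u : EuclideanSpace ℝ (Fin n) → ℝ) (x : EuclideanSpace ℝ (Fin n)) :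
    0 ≤ gradSq u x := Finset.sum_nonneg fun _ _ => sq_nonneg _

lemma sum_single (v : EuclideanSpace ℝ (Fin n)) :
    v = ∑ i : Fin n, v i • EuclideanSpace.single i (1 : ℝ) := by
  ext j
  simp [Finset.sum_apply, Pi.single_apply]

lemma clm_eq_sum (L : EuclideanSpace ℝ (Fin n) →L[ℝ] ℝ) (v : EuclideanSpace ℝ (Fin n)) :
    L v = ∑ i : Fin n, v i * L (EuclideanSpace.single i (1 : ℝ)) := by
  conv_lhs => rw [sum_single v, map_sum]
  simp

lemma norm_Avec_le (u : EuclideanSpace ℝ (Fin n) → ℝ) (x : EuclideanSpace ℝ (Fin n)) :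
    ‖Avec u x‖ ≤ 1 := by
  have h0 := gradSq_nonneg u x
  have h : ‖Avec u x‖ ^ 2 ≤ 1 := by
    rw [EuclideanSpace.norm_sq_eq]
    simp only [Avec, Real.norm_eq_abs, sq_abs, div_pow]
    rw [← Finset.sum_div, Real.sq_sqrt (by linarith), div_le_one (by linarith)]
    unfold gradSq
    linarith
  nlinarith [norm_nonneg (Avec u x)]

lemma fderiv_Avec (u : EuclideanSpace ℝ (Fin n) → ℝ) (x : EuclideanSpace ℝ (Fin n)) :
    fderiv ℝ u x (Avec u x) = gradSq u x / Real.sqrt (1 + gradSq u x) := by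
  rw [clm_eq_sum]
  simp only [Avec, gradSq, Finset.sum_div]
  refine Finset.sum_congr rfl fun i _ => ?_
  simp only [pderiv']
  ring

lemma norm_fderiv_le (u : EuclideanSpace ℝ (Fin n) → ℝ) (x : EuclideanSpace ℝ (Fin n)) :
    ‖fderiv ℝ u x‖ ≤ Real.sqrt (gradSq u x) := by
  refine ContinuousLinearMap.opNorm_le_bound _ (Real.sqrt_nonneg _) fun v => ?_
  rw [clm_eq_sum, EuclideanSpace.norm_eq v, Real.norm_eq_abs, ← Real.sqrt_mul (gradSq_nonneg u x)]
  apply Real.abs_le_sqrt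
  simp only [Real.norm_eq_abs, sq_abs, gradSq, pderiv']
  rw [mul_comm]
  exact Finset.sum_mul_sq_le_sq_mul_sq _ _ _

lemma norm_fderiv_le' (u : EuclideanSpace ℝ (Fin n) → ℝ) (x : EuclideanSpace ℝ (Fin n)) :
    ‖fderiv ℝ u x‖ ≤ fderiv ℝ u x (Avec u x) + 1 := by
  refine (norm_fderiv_le u x).trans ?_
  rw [fderiv_Avec]
  have h0 := gradSq_nonneg u x
  set G := gradSq u x
  have hW : 1 ≤ Real.sqrt (1 + G) := Real.one_le_sqrt.2 (by linarith)
  have hW2 : Real.sqrt (1 + G) ^ 2 = 1 + G := Real.sq_sqrt (by linarith)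
  have h1 : Real.sqrt G ≤ Real.sqrt (1 + G) := Real.sqrt_le_sqrt (by linarith)
  refine h1.trans ?_
  set W := Real.sqrt (1 + G)
  rw [← sub_le_iff_le_add, le_div_iff₀ (by linarith)]
  nlinarith

lemma core {u ℓ σ : EuclideanSpace ℝ (Fin n) → ℝ} {x : EuclideanSpace ℝ (Fin n)} {R δ K : ℝ}
    (hR : 0 < R) (hδ : 0 < δ) (hu : DifferentiableAt ℝ u x) (hℓ : DifferentiableAt ℝ ℓ x)
    (hK : ‖fderiv ℝ ℓ x‖ ≤ K) (hσ : DifferentiableAt ℝ σ x)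
    (heq : σ =ᶠ[𝓝 x] fun y => soft δ (clamp R (u y) - ℓ y)) :
    ‖fderiv ℝ ℓ x + fderiv ℝ σ x‖ ≤ fderiv ℝ σ x (Avec u x) + (1 + 2 * K) := by
  have hK0 : 0 ≤ K := (norm_nonneg _).trans hK
  have hA := norm_Avec_le u x
  have hℓA : |fderiv ℝ ℓ x (Avec u x)| ≤ K := by
    refine ((fderiv ℝ ℓ x).le_opNorm _).trans ?_
    nlinarith [norm_nonneg (fderiv ℝ ℓ x), norm_nonneg (Avec u x)]
  rw [abs_le] at hℓA
  have hsc : ContinuousAt (fun y => clamp R (u y) - ℓ y) x :=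
    ((clamp_cont R).continuousAt.comp hu.continuousAt).sub hℓ.continuousAt
  have hx := heq.self_of_nhds
  by_cases hs : |clamp R (u x) - ℓ x| ≤ δ
  · have hσ0 : σ x = 0 := by rw [hx]; exact soft_of_abs_le hs
    have hD : fderiv ℝ σ x = 0 := by
      by_cases h2 : -δ < clamp R (u x) - ℓ x
      · refine IsLocalMin.fderiv_eq_zero ?_
        filter_upwards [heq, hsc.eventually_const_lt h2] with y hy1 hy2
        rw [hσ0, hy1]
        exact soft_nonneg hy2.le
      · refine IsLocalMax.fderiv_eq_zero ?_
        have h3 : clamp R (u x) - ℓ x < δ := by linarith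
        filter_upwards [heq, hsc.eventually_lt_const h3] with y hy1 hy2
        rw [hσ0, hy1]
        exact soft_nonpos hy2.le
    rw [hD]
    simp only [add_zero, _root_.zero_apply, zero_add]
    linarith
  · rw [not_le] at hs
    have hsum : ∃ c, (fun y => ℓ y + σ y) =ᶠ[𝓝 x] fun y => clamp R (u y) + c := by
      rcases lt_abs.1 hs with h | h
      · refine ⟨-δ, ?_⟩
        filter_upwards [heq, hsc.eventually_const_lt h] with y hy1 hy2
        rw [hy1, soft, clamp_of_ge hδ.le hy2.le]
        ring
      · refine ⟨δ, ?_⟩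
        filter_upwards [heq, hsc.eventually_lt_const (by linarith : _ < -δ)] with y hy1 hy2
        rw [hy1, soft, clamp_of_le hδ.le hy2.le]
        ring
    obtain ⟨c, hc⟩ := hsum
    have hfs : fderiv ℝ (fun y => ℓ y + σ y) x = fderiv ℝ ℓ x + fderiv ℝ σ x := fderiv_add hℓ hσ
    by_cases hux : |u x| < R
    · have h1 : (fun y => ℓ y + σ y) =ᶠ[𝓝 x] fun y => u y + c := by
        filter_upwards [hc, hu.continuousAt.abs.eventually_lt_const hux] with y hy1 hy2
        rw [hy1, clamp_of_abs_le hy2.le]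
      have h2 : fderiv ℝ ℓ x + fderiv ℝ σ x = fderiv ℝ u x := by
        rw [← hfs, h1.fderiv_eq, fderiv_add_const]
      have h3 := norm_fderiv_le' u x
      have h4 : fderiv ℝ u x (Avec u x) = fderiv ℝ ℓ x (Avec u x) + fderiv ℝ σ x (Avec u x) := by
        rw [← h2]; rfl
      rw [h2]
      linarith
    · have h2 : fderiv ℝ ℓ x + fderiv ℝ σ x = 0 := by
        rw [← hfs, hc.fderiv_eq]
        rcases le_abs.1 (not_lt.1 hux) with h | h
        · refine IsLocalMax.fderiv_eq_zero (.of_forall fun y => ?_)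
          simp only [clamp_of_ge hR.le h]
          linarith [clamp_le hR.le (u y)]
        · refine IsLocalMin.fderiv_eq_zero (.of_forall fun y => ?_)
          simp only [clamp_of_le hR.le (by linarith : u x ≤ -R)]
          linarith [le_clamp R (u y)]
      have h4 : fderiv ℝ ℓ x (Avec u x) + fderiv ℝ σ x (Avec u x) = 0 := by
        have := congrArg (fun L => L (Avec u x)) h2
        simpa using this
      rw [h2, norm_zero]
      linarith

lemma A_contDiffOn {Ω : Set (EuclideanSpace ℝ (Fin n))} (hΩ : IsOpen Ω)
    {u : EuclideanSpace ℝ (Fin n) → ℝ} (hu : ContDiffOn ℝ 2 u Ω) (i : Fin n) :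
    ContDiffOn ℝ 1 (fun y => pderiv' u i y / Real.sqrt (1 + gradSq u y)) Ω := by
  have h1 : ContDiffOn ℝ 1 (fderiv ℝ u) Ω := hu.fderiv_of_isOpen hΩ (by norm_num)
  have h2 : ∀ j, ContDiffOn ℝ 1 (pderiv' u j) Ω := fun j => h1.clm_apply contDiffOn_const
  have h3 : ContDiffOn ℝ 1 (fun y => 1 + gradSq u y) Ω := by
    refine contDiffOn_const.add ?_
    exact ContDiffOn.sum fun j _ => (h2 j).pow 2
  refine (h2 i).div (h3.sqrt fun x _ => ?_) fun x _ => ?_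
  · have := gradSq_nonneg u x
    positivity
  · have := gradSq_nonneg u x
    positivity

end LRP

namespace LRP
variable {n : ℕ}

lemma clamp_lip (R : ℝ) : LipschitzWith 1 (clamp R) := by
  unfold clamp
  exact (LipschitzWith.id.min_const R).const_max (-R)

lemma locLip_mul {f g : EuclideanSpace ℝ (Fin n) → ℝ} (hf : LocallyLipschitz f)
    (hg : LocallyLipschitz g) : LocallyLipschitz (fun x => f x * g x) := by
  have h : LocallyLipschitz (fun z : ℝ × ℝ => z.1 * z.2) :=
    ContDiff.locallyLipschitz (𝕂 := ℝ) (by fun_prop)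
  exact h.comp (hf.prodMk hg)

lemma locLip_soft {δ R : ℝ} {f ℓ : EuclideanSpace ℝ (Fin n) → ℝ} (hf : LocallyLipschitz f)
    (hl : LocallyLipschitz ℓ) : LocallyLipschitz (fun x => soft δ (clamp R (f x) - ℓ x)) := by
  have h1 : LocallyLipschitz (fun x => clamp R (f x) - ℓ x) :=
    ((clamp_lip R).locallyLipschitz.comp hf).sub hl
  exact h1.sub ((clamp_lip δ).locallyLipschitz.comp h1)

/-- The cutoff function. -/
noncomputable def cut (ρ ρ' : ℝ) (x : EuclideanSpace ℝ (Fin n)) : ℝ :=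
  max 0 (min ((ρ' - ‖x‖) / (ρ' - ρ)) 1)

lemma cut_lip {ρ ρ' : ℝ} (h : ρ < ρ') :
    LipschitzWith (Real.toNNReal (1 / (ρ' - ρ))) (cut (n := n) ρ ρ') := by
  have h0 : 0 < ρ' - ρ := sub_pos.2 h
  have h1 : LipschitzWith (Real.toNNReal (1 / (ρ' - ρ)))
      (fun x : EuclideanSpace ℝ (Fin n) => (ρ' - ‖x‖) / (ρ' - ρ)) := by
    refine LipschitzWith.of_dist_le_mul fun x y => ?_
    rw [Real.coe_toNNReal _ (by positivity), Real.dist_eq, ← _root_.sub_div, abs_div, abs_of_pos h0,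
      div_le_iff₀ h0, dist_eq_norm]
    have e : ρ' - ‖x‖ - (ρ' - ‖y‖) = -(‖x‖ - ‖y‖) := by ring
    rw [e, abs_neg]
    have := abs_norm_sub_norm_le x y
    field_simp
    exact this
  exact (h1.min_const 1).const_max 0

lemma cut_nonneg (ρ ρ' : ℝ) (x : EuclideanSpace ℝ (Fin n)) : 0 ≤ cut ρ ρ' x := le_max_left _ _

lemma cut_le_one (ρ ρ' : ℝ) (x : EuclideanSpace ℝ (Fin n)) : cut ρ ρ' x ≤ 1 :=
  max_le zero_le_one (min_le_right _ _)

lemma cut_pos {ρ ρ' : ℝ} (h : ρ < ρ') {x : EuclideanSpace ℝ (Fin n)} (hx : ‖x‖ < ρ') :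
    0 < cut ρ ρ' x :=
  lt_max_of_lt_right (lt_min (div_pos (by linarith) (by linarith)) one_pos)

lemma cut_one {ρ ρ' : ℝ} (h : ρ < ρ') {x : EuclideanSpace ℝ (Fin n)} (hx : ‖x‖ ≤ ρ) :
    cut ρ ρ' x = 1 := by
  unfold cut
  rw [min_eq_right, max_eq_right zero_le_one]
  rw [le_div_iff₀ (by linarith)]
  linarith

lemma cut_zero {ρ ρ' : ℝ} (h : ρ < ρ') {x : EuclideanSpace ℝ (Fin n)} (hx : ρ' ≤ ‖x‖) :
    cut ρ ρ' x = 0 := by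
  unfold cut
  apply max_eq_left
  exact (min_le_left _ _).trans (div_nonpos_of_nonpos_of_nonneg (by linarith) (by linarith))

lemma approx {Ω : Set (EuclideanSpace ℝ (Fin n))} {u ℓ : EuclideanSpace ℝ (Fin n) → ℝ}
    (hΩ : IsOpen Ω) (hu : ContDiffOn ℝ 2 u Ω) (huc : ContinuousOn u (closure Ω))
    (hmse : MinimalSurfaceEq u Ω) {K : ℝ≥0} (hℓ : LipschitzWith K ℓ) {R ρ ρ' δ : ℝ}
    (hR : 0 < R) (hρ : 0 ≤ ρ) (hρρ : ρ < ρ') (hδ : 0 < δ) (hℓR : ∀ x, |ℓ x| ≤ R)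
    (hbd : ∀ x ∈ frontier Ω, ‖x‖ ≤ ρ' → clamp R (u x) = ℓ x) :
    ∃ (g : EuclideanSpace ℝ (Fin n) → ℝ) (C : ℝ≥0), LipschitzWith C g ∧
      (∀ x ∈ ball (0 : EuclideanSpace ℝ (Fin n)) ρ, x ∈ Ω → |g x - clamp R (u x)| ≤ δ) ∧
      (∀ x, x ∉ Ω → g x = ℓ x) ∧
      ∫ x in ball (0 : EuclideanSpace ℝ (Fin n)) ρ, ‖fderiv ℝ g x‖ ≤
        (1 + 2 * K) * volume.real (ball (0 : EuclideanSpace ℝ (Fin n)) ρ') +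
        2 * R / (ρ' - ρ) * volume.real (ball (0 : EuclideanSpace ℝ (Fin n)) ρ' \ ball 0 ρ) := by
  classical
  set η : EuclideanSpace ℝ (Fin n) → ℝ := cut ρ ρ' with hη
  have hε : 0 < ρ' - ρ := sub_pos.2 hρρ
  have hηl := cut_lip (n := n) hρρ
  set σ₀ : EuclideanSpace ℝ (Fin n) → ℝ := fun x => soft δ (clamp R (u x) - ℓ x) with hσ₀
  set φ : EuclideanSpace ℝ (Fin n) → ℝ := fun x => if x ∈ Ω then η x * σ₀ x else 0 with hφ
  set κ : Set (EuclideanSpace ℝ (Fin n)) :=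
    (closure Ω ∩ closedBall 0 ρ') ∩ (fun x => |clamp R (u x) - ℓ x|) ⁻¹' Ici δ with hκ
  have hκcl : IsClosed κ := by
    refine ContinuousOn.preimage_isClosed_of_isClosed ?_
      (isClosed_closure.inter isClosed_closedBall) isClosed_Ici
    exact ((((clamp_cont R).comp_continuousOn huc).sub hℓ.continuous.continuousOn).abs).mono
      inter_subset_left
  have hκc : IsCompact κ := (isCompact_closedBall (0 : EuclideanSpace ℝ (Fin n)) ρ').of_isClosed_subset
    hκcl fun x hx => hx.1.2
  have hκΩ : κ ⊆ Ω := by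
    intro x hx
    by_contra hxΩ
    have hf : x ∈ frontier Ω := by
      rw [hΩ.frontier_eq]
      exact ⟨hx.1.1, hxΩ⟩
    have h1 := hbd x hf (by simpa using hx.1.2)
    have h2 : δ ≤ |clamp R (u x) - ℓ x| := hx.2
    rw [h1, sub_self, abs_zero] at h2
    linarith
  have hφ0 : ∀ x, x ∉ κ → φ x = 0 := by
    intro x hx
    simp only [hφ]
    split_ifs with hxΩ
    · by_cases h1 : ρ' ≤ ‖x‖
      · rw [hη, cut_zero hρρ h1, zero_mul]
      · have h2 : |clamp R (u x) - ℓ x| < δ := by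
          by_contra h3
          exact hx ⟨⟨subset_closure hxΩ, by simpa using (not_le.1 h1).le⟩, not_lt.1 h3⟩
        simp only [hσ₀]
        rw [soft_of_abs_le h2.le, mul_zero]
    · rfl
  have hφs : tsupport φ ⊆ κ := closure_minimal
    (fun x hx => by by_contra hxt; exact hx (hφ0 x hxt)) hκcl
  have hφc : HasCompactSupport φ := hκc.of_isClosed_subset (isClosed_tsupport _) hφs
  have hφnear0 : ∀ x, x ∉ κ → φ =ᶠ[𝓝 x] fun _ => 0 := by
    intro x hx
    filter_upwards [hκcl.isOpen_compl.mem_nhds hx] with y hy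
    exact hφ0 y hy
  have hφnear : ∀ x ∈ Ω, φ =ᶠ[𝓝 x] fun y => η y * σ₀ y := by
    intro x hx
    filter_upwards [hΩ.mem_nhds hx] with y hy
    simp only [hφ, if_pos hy]
  -- Lipschitz
  obtain ⟨C, hφl⟩ : ∃ C : ℝ≥0, LipschitzWith C φ := by
    refine lip_of_loc (fun x => ?_) hφc
    have tr : ∀ ψ : EuclideanSpace ℝ (Fin n) → ℝ, LocallyLipschitz ψ → φ =ᶠ[𝓝 x] ψ →
        ∃ K, ∃ t ∈ 𝓝 x, LipschitzOnWith K φ t := by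
      intro ψ hψ he
      obtain ⟨K', t, ht, hK'⟩ := hψ x
      refine ⟨K', t ∩ {y | φ y = ψ y}, inter_mem ht he, fun a ha b hb => ?_⟩
      rw [ha.2, hb.2]
      exact hK' ha.1 hb.1
    by_cases hx : x ∈ κ
    · obtain ⟨χ, hχ, hχc, hχs, hχ1⟩ := exists_cutoff hκc hΩ hκΩ
      have hB : ContDiff ℝ 2 (fun x => χ x * u x) := contDiff_cutoff_mul hΩ hχ hχs (k := 2) hu
      have hBl : LocallyLipschitz (fun x => χ x * u x) :=
        (hB.of_le (by norm_num : (1 : ℕ∞ω) ≤ 2)).locallyLipschitz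
      refine tr _ (locLip_mul hηl.locallyLipschitz
        (locLip_soft (δ := δ) (R := R) hBl hℓ.locallyLipschitz)) ?_
      filter_upwards [hφnear x (hκΩ hx), hχ1 x hx] with y hy1 hy2
      rw [hy1, hy2, one_mul]
    · exact tr _ (LocallyLipschitz.const 0) (hφnear0 x hx)
  have hgl : LipschitzWith (K + C) (fun x => ℓ x + φ x) := hℓ.add hφl
  obtain ⟨hwi, hw⟩ := weak_eq hΩ (fun i y => pderiv' u i y / Real.sqrt (1 + gradSq u y))
    (A_contDiffOn hΩ hu) hmse hφl hφc (hφs.trans hκΩ)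
  refine ⟨fun x => ℓ x + φ x, K + C, hgl, ?_, ?_, ?_⟩
  · intro x hx hxΩ
    have h1 : φ x = σ₀ x := by
      simp only [hφ, if_pos hxΩ]
      rw [hη, cut_one hρρ (by simpa using (mem_ball.1 hx).le), one_mul]
    show |ℓ x + φ x - clamp R (u x)| ≤ δ
    rw [h1]
    have := abs_soft_sub hδ.le (clamp R (u x) - ℓ x)
    simp only [hσ₀]
    convert this using 2
    ring
  · intro x hx
    simp [hφ, hx]
  -- the area estimate
  set B := ball (0 : EuclideanSpace ℝ (Fin n)) ρ with hB
  set B' := ball (0 : EuclideanSpace ℝ (Fin n)) ρ' with hB'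
  set T : EuclideanSpace ℝ (Fin n) → ℝ := fun x => ∑ i, pderiv' u i x / Real.sqrt (1 + gradSq u x) *
    lineDeriv ℝ φ x (EuclideanSpace.single i 1) with hT
  have hBB : B ⊆ B' := ball_subset_ball hρρ.le
  have hK2 : (0 : ℝ) ≤ 1 + 2 * K := by positivity
  have hc2 : 0 ≤ 2 * R / (ρ' - ρ) := by positivity
  have hi1 : Integrable (B'.indicator (fun _ => (1 + 2 * K : ℝ))) :=
    (integrable_indicator_iff measurableSet_ball).2 (integrableOn_const measure_ball_lt_top.ne)
  have hi2 : Integrable ((B' \ B).indicator (fun _ => 2 * R / (ρ' - ρ))) :=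
    (integrable_indicator_iff (measurableSet_ball.diff measurableSet_ball)).2
      (integrableOn_const ((measure_mono sdiff_subset).trans_lt measure_ball_lt_top).ne)
  have hae : ∀ᵐ x : EuclideanSpace ℝ (Fin n), B.indicator (fun x => ‖fderiv ℝ (fun x => ℓ x + φ x) x‖) x
      ≤ T x + (B'.indicator (fun _ => (1 + 2 * K : ℝ)) x
        + (B' \ B).indicator (fun _ => 2 * R / (ρ' - ρ)) x) := by
    have hsph : ∀ᵐ x : EuclideanSpace ℝ (Fin n), x ∉ sphere (0 : EuclideanSpace ℝ (Fin n)) ρ' := by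
      rw [ae_iff]
      simp only [not_not, ofPred_mem_eq]
      exact Measure.addHaar_sphere_of_ne_zero volume _ (by linarith)
    filter_upwards [hφl.ae_differentiableAt (μ := volume), hℓ.ae_differentiableAt (μ := volume),
      hηl.ae_differentiableAt (μ := volume), hsph] with x hφx hℓx hηx hxs
    have hTx : T x = fderiv ℝ φ x (Avec u x) := by
      rw [clm_eq_sum]
      simp only [hT, Avec, hφx.lineDeriv_eq_fderiv]
    have hKx : ‖fderiv ℝ ℓ x‖ ≤ K := norm_fderiv_le_of_lipschitz ℝ hℓ
    have hfs : fderiv ℝ (fun x => ℓ x + φ x) x = fderiv ℝ ℓ x + fderiv ℝ φ x :=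
      fderiv_add hℓx hφx
    rw [hTx]
    by_cases hx : x ∈ κ
    · have hxΩ := hκΩ hx
      have hx' : ‖x‖ < ρ' := by
        have h1 : ‖x‖ ≤ ρ' := by simpa using hx.1.2
        exact lt_of_le_of_ne h1 (by simpa using hxs)
      have hxB' : x ∈ B' := by simpa [hB'] using hx'
      have hη0 : 0 < η x := cut_pos hρρ hx'
      have hη1 : η x ≤ 1 := cut_le_one ρ ρ' x
      have hux : DifferentiableAt ℝ u x :=
        (hu.contDiffAt (hΩ.mem_nhds hxΩ)).differentiableAt (by norm_num)
      have hηc : Continuous η := hηl.continuous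
      have hσe : σ₀ =ᶠ[𝓝 x] fun y => φ y * (η y)⁻¹ := by
        filter_upwards [hφnear x hxΩ, hηc.continuousAt.eventually_const_lt hη0] with y hy1 hy2
        rw [hy1, mul_comm (η y), mul_assoc, mul_inv_cancel₀ hy2.ne', mul_one]
      have hσd : DifferentiableAt ℝ σ₀ x :=
        (hφx.mul (hηx.inv hη0.ne')).congr_of_eventuallyEq hσe
      have hcore := core hR hδ hux hℓx hKx hσd (EventuallyEq.refl _ _)
      rw [indicator_of_mem hxB']
      by_cases hxB : x ∈ B
      · rw [indicator_of_mem hxB, indicator_of_notMem (fun h => h.2 hxB), hfs]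
        have he : φ =ᶠ[𝓝 x] σ₀ := by
          filter_upwards [hφnear x hxΩ, isOpen_ball.mem_nhds hxB] with y hy1 hy2
          rw [hy1, hη, cut_one hρρ (by simpa using (mem_ball.1 hy2).le), one_mul]
        rw [he.fderiv_eq, add_zero]
        exact hcore
      · have hmem : x ∈ B' \ B := ⟨hxB', hxB⟩
        rw [indicator_of_notMem hxB, indicator_of_mem hmem]
        have hDφ : fderiv ℝ φ x = η x • fderiv ℝ σ₀ x + σ₀ x • fderiv ℝ η x := by
          rw [(hφnear x hxΩ).fderiv_eq]
          exact fderiv_mul hηx hσd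
        have hDA : fderiv ℝ φ x (Avec u x) = η x * fderiv ℝ σ₀ x (Avec u x)
            + σ₀ x * fderiv ℝ η x (Avec u x) := by
          rw [hDφ]; rfl
        have h1 : -(1 + 2 * K : ℝ) ≤ fderiv ℝ σ₀ x (Avec u x) := by
          linarith [norm_nonneg (fderiv ℝ ℓ x + fderiv ℝ σ₀ x)]
        have h2 : -(1 + 2 * K : ℝ) ≤ η x * fderiv ℝ σ₀ x (Avec u x) := by nlinarith
        have h3 : |σ₀ x| ≤ 2 * R := by
          refine (abs_soft_le hδ.le).trans ((abs_sub _ _).trans ?_)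
          linarith [abs_clamp_le hR.le (u x), hℓR x]
        have h4 : |fderiv ℝ η x (Avec u x)| ≤ 1 / (ρ' - ρ) := by
          refine ((fderiv ℝ η x).le_opNorm _).trans ?_
          have h5 : ‖fderiv ℝ η x‖ ≤ 1 / (ρ' - ρ) := by
            have := norm_fderiv_le_of_lipschitz ℝ (x₀ := x) hηl
            rwa [Real.coe_toNNReal _ (by positivity)] at this
          calc _ ≤ ‖fderiv ℝ η x‖ * 1 :=
                mul_le_mul_of_nonneg_left (norm_Avec_le u x) (norm_nonneg _)
            _ ≤ _ := by rw [mul_one]; exact h5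
        have h6 : |σ₀ x * fderiv ℝ η x (Avec u x)| ≤ 2 * R * (1 / (ρ' - ρ)) := by
          rw [abs_mul]
          exact mul_le_mul h3 h4 (abs_nonneg _) (by positivity)
        have h7 := (abs_le.1 h6).1
        rw [hDA]
        have h8 : 2 * R * (1 / (ρ' - ρ)) = 2 * R / (ρ' - ρ) := by ring
        linarith
    · have hD0 : fderiv ℝ φ x = 0 := by
        rw [(hφnear0 x hx).fderiv_eq, fderiv_fun_const]; rfl
      rw [hD0]
      have hnn : 0 ≤ (B' \ B).indicator (fun _ => 2 * R / (ρ' - ρ)) x :=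
        indicator_nonneg (fun _ _ => hc2) x
      by_cases hxB : x ∈ B
      · rw [indicator_of_mem hxB, indicator_of_mem (hBB hxB), hfs, hD0, add_zero,
          _root_.zero_apply]
        have : (0 : ℝ) ≤ K := K.2
        linarith
      · rw [indicator_of_notMem hxB, _root_.zero_apply]
        have : 0 ≤ B'.indicator (fun _ => (1 + 2 * K : ℝ)) x := indicator_nonneg (fun _ _ => hK2) x
        linarith
  rw [← integral_indicator measurableSet_ball]
  refine (integral_mono_ae ?_ (hwi.add (hi1.add hi2)) hae).trans ?_
  · rw [integrable_indicator_iff measurableSet_ball]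
    exact norm_fderiv_integrableOn hgl 0 ρ
  · have e1 := integral_add hwi (hi1.add hi2)
    have e2 := integral_add hi1 hi2
    simp only [Pi.add_apply] at e1 e2 ⊢
    rw [hw] at e1
    refine (e1.trans ?_).le
    rw [e2, integral_indicator measurableSet_ball,
      integral_indicator (measurableSet_ball.diff measurableSet_ball), setIntegral_const,
      setIntegral_const]
    simp only [smul_eq_mul]
    ring

end LRP

namespace LRP
variable {n : ℕ}

lemma divg_cont {m : ℕ} {X : EuclideanSpace ℝ (Fin m) → EuclideanSpace ℝ (Fin m)}
    (hX : ContDiff ℝ 1 X) : Continuous (divg X) := by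
  unfold divg
  refine continuous_finsetSum _ fun i _ => ?_
  have h : Continuous fun p => fderiv ℝ X p (EuclideanSpace.single i 1) :=
    (hX.continuous_fderiv (by norm_num)).clm_apply continuous_const
  fun_prop

lemma divg_zero {m : ℕ} {X : EuclideanSpace ℝ (Fin m) → EuclideanSpace ℝ (Fin m)}
    {p : EuclideanSpace ℝ (Fin m)} (hp : p ∉ tsupport X) : divg X p = 0 := by
  have h : fderiv ℝ X p = 0 := by
    by_contra h0
    exact hp (support_fderiv_subset ℝ h0)
  simp [divg, h]

lemma divg_compact {m : ℕ} {X : EuclideanSpace ℝ (Fin m) → EuclideanSpace ℝ (Fin m)}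
    (hc : HasCompactSupport X) : HasCompactSupport (divg X) :=
  HasCompactSupport.intro hc fun _ hx => divg_zero hx

lemma iter {D : EuclideanSpace ℝ (Fin (n + 1)) → ℝ} (hD : Integrable D)
    {w : EuclideanSpace ℝ (Fin n) → ℝ} (hw : Measurable w)
    {S : Set (EuclideanSpace ℝ (Fin (n + 1)))} (hS : ∀ z, P n z ∈ S ↔ z.2 < w z.1) :
    Integrable (fun x => ∫ t in Iic (w x), D (P n (x, t))) ∧
      ∫ x, ∫ t in Iic (w x), D (P n (x, t)) = ∫ p in S, D p := by
  have hm : MeasurableSet {z : EuclideanSpace ℝ (Fin n) × ℝ | z.2 < w z.1} :=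
    measurableSet_lt measurable_snd (hw.comp measurable_fst)
  have hSe : S = P n '' {z : EuclideanSpace ℝ (Fin n) × ℝ | z.2 < w z.1} := by
    ext p
    obtain ⟨z, rfl⟩ : ∃ z, P n z = p := ⟨_, P_surj p⟩
    rw [hS, P_emb.injective.mem_set_image]
    rfl
  have hSm : MeasurableSet S := by
    rw [hSe]; exact P_emb.measurableSet_image.2 hm
  have hi : Integrable (S.indicator D) := hD.indicator hSm
  have hi2 : Integrable (fun z => S.indicator D (P n z))
      ((volume : Measure (EuclideanSpace ℝ (Fin n))).prod (volume : Measure ℝ)) :=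
    (P_mp.integrable_comp_emb P_emb).2 hi
  have hin : ∀ x, ∫ t, S.indicator D (P n (x, t)) = ∫ t in Iic (w x), D (P n (x, t)) := by
    intro x
    rw [integral_Iic_eq_integral_Iio, ← integral_indicator measurableSet_Iio]
    congr 1
    ext t
    by_cases ht : t < w x
    · rw [indicator_of_mem ((hS _).2 ht), indicator_of_mem (show t ∈ Iio (w x) from ht)]
    · rw [indicator_of_notMem (fun h => ht ((hS _).1 h)),
        indicator_of_notMem (show t ∉ Iio (w x) from ht)]
  simp only [← hin]
  refine ⟨hi2.integral_prod_left, ?_⟩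
  rw [← integral_indicator hSm, ← integral_P, integral_prod _ hi2]

lemma slice_sub {D : EuclideanSpace ℝ (Fin (n + 1)) → ℝ} (hD : Continuous D)
    (hc : HasCompactSupport D) {N : ℝ} (x : EuclideanSpace ℝ (Fin n)) (a b : ℝ)
    (hN : ∀ t ∈ uIoc a b, |D (P n (x, t))| ≤ N) :
    |(∫ t in Iic b, D (P n (x, t))) - ∫ t in Iic a, D (P n (x, t))| ≤ N * |b - a| := by
  have hi : Integrable (fun t : ℝ => D (P n (x, t))) :=
    Continuous.integrable_of_hasCompactSupport (by fun_prop) (vert_compact hc x)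
  rw [intervalIntegral.integral_Iic_sub_Iic hi.integrableOn hi.integrableOn]
  have hN' : ∀ t ∈ uIoc a b, ‖D (P n (x, t))‖ ≤ N := hN
  exact intervalIntegral.norm_integral_le_of_norm_le_const hN'

lemma slice_clamp {D : EuclideanSpace ℝ (Fin (n + 1)) → ℝ} (hD : Continuous D)
    (hc : HasCompactSupport D) {ρ r : ℝ} (hr : 0 < r) (hρr : ρ < r)
    (h0 : ∀ p, ρ ≤ ‖p‖ → D p = 0) (x : EuclideanSpace ℝ (Fin n)) (a : ℝ) :
    ∫ t in Iic (clamp r a), D (P n (x, t)) = ∫ t in Iic a, D (P n (x, t)) := by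
  have key := slice_sub hD hc (N := 0) x a (clamp r a) (fun t ht => by
    have h1 : r ≤ |t| := by
      rw [mem_uIoc] at ht
      rcases le_total a (-r) with h | h
      · rw [clamp_of_le hr.le h] at ht
        rw [le_abs]
        rcases ht with ht | ht
        · right; linarith [ht.2]
        · exfalso; linarith [ht.1, ht.2]
      rcases le_total r a with h' | h'
      · rw [clamp_of_ge hr.le h'] at ht
        rw [le_abs]
        rcases ht with ht | ht
        · exfalso; linarith [ht.1, ht.2]
        · left; linarith [ht.1]
      · rw [clamp_of_abs_le (abs_le.2 ⟨h, h'⟩)] at ht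
        exfalso
        rcases ht with ht | ht <;> linarith [ht.1, ht.2]
    have h2 := snd_le_norm_P (n := n) (x, t)
    rw [h0 _ (by simp only at h2; linarith), abs_zero])
  rw [zero_mul] at key
  exact sub_eq_zero.1 (abs_eq_zero.1 (le_antisymm key (abs_nonneg _)))

lemma vol_ball {s : ℝ} (hs : 0 < s) : volume.real (ball (0 : EuclideanSpace ℝ (Fin n)) s) =
    s ^ n * volume.real (ball (0 : EuclideanSpace ℝ (Fin n)) 1) := by
  rw [measureReal_def, Measure.addHaar_ball_of_pos _ _ hs, ENNReal.toReal_mul,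
    ENNReal.toReal_ofReal (by positivity), finrank_euclideanSpace_fin]
  rfl

lemma bound {Ω : Set (EuclideanSpace ℝ (Fin n))} {l u : EuclideanSpace ℝ (Fin n) → ℝ}
    (hΩ : IsOpen Ω) (hl : Continuous l) (hu : ContDiffOn ℝ 2 u Ω)
    (huc : ContinuousOn u (closure Ω)) (hmse : MinimalSurfaceEq u Ω)
    (hbd : ∀ x ∈ frontier Ω, u x = l x) {r : ℝ} (hr : 0 < r) {K : ℝ≥0}
    (hK : LipschitzOnWith K l (ball 0 r))
    {X : EuclideanSpace ℝ (Fin (n + 1)) → EuclideanSpace ℝ (Fin (n + 1))}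
    (hX : ContDiff ℝ 1 X) (hc : HasCompactSupport X) (hs : tsupport X ⊆ ball 0 r)
    {M : ℝ} (hM : ∀ p, ‖X p‖ ≤ M) :
    |∫ p in lowerRegion Ω l u, divg X p| ≤
      (volume.real (ball (0 : EuclideanSpace ℝ (Fin n)) 1) * (2 + 2 * K + 2 * n)) * M * r ^ n := by
  classical
  have hM0 : 0 ≤ M := (norm_nonneg _).trans (hM 0)
  obtain ⟨ρ, ⟨hρ0, hρr⟩, hsρ⟩ := exists_pos_lt_subset_ball hr (isClosed_tsupport X) hs
  have hnot : ∀ p, ρ ≤ ‖p‖ → p ∉ tsupport X := fun p hp h => by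
    have := hsρ h
    rw [mem_ball_zero_iff] at this
    linarith
  have hX0 : ∀ p, ρ ≤ ‖p‖ → X p = 0 := fun p hp => image_eq_zero_of_notMem_tsupport (hnot p hp)
  have hD0 : ∀ p, ρ ≤ ‖p‖ → divg X p = 0 := fun p hp => divg_zero (hnot p hp)
  have hDc := divg_cont hX
  have hDs := divg_compact hc
  have hDi : Integrable (divg X) := hDc.integrable_of_hasCompactSupport hDs
  obtain ⟨N, hN⟩ := hDc.bounded_above_of_compact_support hDs
  have hN0 : 0 ≤ N := (norm_nonneg _).trans (hN 0)
  obtain ⟨l', hl', hll'⟩ := hK.extend_real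
  set ℓ : EuclideanSpace ℝ (Fin n) → ℝ := fun x => clamp r (l' x) with hℓd
  have hℓ : LipschitzWith K ℓ := by
    have := (clamp_lip r).comp hl'
    rwa [one_mul] at this
  set ρ' := (ρ + r) / 2 with hρ'
  have hρρ : ρ < ρ' := by rw [hρ']; linarith
  have hρ'r : ρ' < r := by rw [hρ']; linarith
  have hρ'0 : 0 < ρ' := hρ0.trans hρρ
  have hℓl : ∀ x, ‖x‖ < r → ℓ x = clamp r (l x) := fun x hx => by
    simp only [hℓd]
    rw [hll' (mem_ball_zero_iff.2 hx)]
  set w : EuclideanSpace ℝ (Fin n) → ℝ := Ω.piecewise u l with hw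
  have hwm : Measurable w :=
    ContinuousOn.measurable_piecewise hu.continuousOn hl.continuousOn hΩ.measurableSet
  obtain ⟨hGi, hG⟩ := iter hDi hwm (S := lowerRegion Ω l u) (by
    intro z
    simp only [lowerRegion, mem_ofPred_eq, projFirst_P, P_last, hw]
    by_cases hz : z.1 ∈ Ω
    · simp [hz]
    · simp [hz])
  set V := volume.real (ball (0 : EuclideanSpace ℝ (Fin n)) ρ) with hV
  have hV0 : 0 ≤ V := measureReal_nonneg
  set A : ℝ := V + ((1 + 2 * K) * volume.real (ball (0 : EuclideanSpace ℝ (Fin n)) ρ') +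
        2 * r / (ρ' - ρ) * volume.real (ball (0 : EuclideanSpace ℝ (Fin n)) ρ' \ ball 0 ρ)) with hA
  have step : ∀ δ > 0, |∫ p in lowerRegion Ω l u, divg X p| ≤ N * δ * V + M * A := by
    intro δ hδ
    obtain ⟨g, C, hg, hgu, hgl, hgA⟩ := approx hΩ hu huc hmse hℓ hr hρ0.le hρρ hδ
      (fun x => abs_clamp_le hr.le _) (fun x hx hxr => by
        rw [hbd x hx, hℓl x (by linarith)])
    obtain ⟨hHi, -⟩ := iter hDi hg.continuous.measurable
      (S := P n '' {z : EuclideanSpace ℝ (Fin n) × ℝ | z.2 < g z.1})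
      (fun z => by rw [P_emb.injective.mem_set_image]; rfl)
    have hsub := subgraph_bound hX hc hM hX0 hg
    have hint : ∫ x in ball (0 : EuclideanSpace ℝ (Fin n)) ρ, (1 + ‖fderiv ℝ g x‖) ≤ A := by
      have hone : Integrable (fun _ : EuclideanSpace ℝ (Fin n) => (1 : ℝ))
          (volume.restrict (ball (0 : EuclideanSpace ℝ (Fin n)) ρ)) :=
        integrableOn_const measure_ball_lt_top.ne
      rw [integral_add hone (norm_fderiv_integrableOn hg 0 ρ), setIntegral_const, smul_eq_mul, mul_one, hA]
      linarith
    have hpt : ∀ x, ‖(∫ t in Iic (w x), divg X (P n (x, t)))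
        - ∫ t in Iic (g x), divg X (P n (x, t))‖ ≤
        (ball (0 : EuclideanSpace ℝ (Fin n)) ρ).indicator (fun _ => N * δ) x := by
      intro x
      by_cases hx : x ∈ ball (0 : EuclideanSpace ℝ (Fin n)) ρ
      · rw [indicator_of_mem hx, ← slice_clamp hDc hDs hr hρr hD0]
        refine (slice_sub hDc hDs (N := N) x _ _ fun t _ => hN _).trans ?_
        refine mul_le_mul_of_nonneg_left ?_ hN0
        by_cases hxΩ : x ∈ Ω
        · rw [abs_sub_comm, hw, piecewise_eq_of_mem _ _ _ hxΩ]
          exact hgu x hx hxΩ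
        · rw [hgl x hxΩ, hw, piecewise_eq_of_notMem _ _ _ hxΩ,
            hℓl x ((mem_ball_zero_iff.1 hx).trans hρr), sub_self, abs_zero]
          exact hδ.le
      · rw [indicator_of_notMem hx]
        have hz : ∀ t, divg X (P n (x, t)) = 0 := fun t => hD0 _ (by
          have h1 := fst_le_norm_P (n := n) (x, t)
          have h2 : ρ ≤ ‖x‖ := by simpa using hx
          exact h2.trans h1)
        simp [hz]
    have hd : |(∫ x, ∫ t in Iic (w x), divg X (P n (x, t)))
        - ∫ x, ∫ t in Iic (g x), divg X (P n (x, t))| ≤ N * δ * V := by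
      rw [← integral_sub hGi hHi]
      refine (norm_integral_le_of_norm_le ((integrable_indicator_iff measurableSet_ball).2
        (integrableOn_const measure_ball_lt_top.ne)) (Eventually.of_forall hpt)).trans ?_
      rw [integral_indicator measurableSet_ball, setIntegral_const, smul_eq_mul, mul_comm]
    rw [← hG]
    have h1 := abs_sub_abs_le_abs_sub (∫ x, ∫ t in Iic (w x), divg X (P n (x, t)))
      (∫ x, ∫ t in Iic (g x), divg X (P n (x, t)))
    have h2 := mul_le_mul_of_nonneg_left hint hM0
    linarith
  have hlim : |∫ p in lowerRegion Ω l u, divg X p| ≤ M * A := by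
    refine le_of_forall_pos_le_add fun ε hε => ?_
    have hpos : 0 < N * V + 1 := by positivity
    have h := step (ε / (N * V + 1)) (by positivity)
    have h2 : N * (ε / (N * V + 1)) * V ≤ ε := by
      have e : N * (ε / (N * V + 1)) * V = ε * (N * V) / (N * V + 1) := by ring
      rw [e, div_le_iff₀ hpos]
      nlinarith
    linarith
  refine hlim.trans ?_
  set v := volume.real (ball (0 : EuclideanSpace ℝ (Fin n)) 1) with hv
  have hv0 : 0 ≤ v := measureReal_nonneg
  have hAle : A ≤ v * (2 + 2 * K + 2 * n) * r ^ n := by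
    have hdiff : volume.real (ball (0 : EuclideanSpace ℝ (Fin n)) ρ' \ ball 0 ρ)
        = (ρ' ^ n - ρ ^ n) * v := by
      rw [measureReal_sdiff (ball_subset_ball hρρ.le) measurableSet_ball measure_ball_lt_top.ne,
        vol_ball hρ'0, vol_ball hρ0]
      ring
    have hε : 0 < ρ' - ρ := sub_pos.2 hρρ
    have h1 : (ρ' ^ n - ρ ^ n) * r / (ρ' - ρ) ≤ n * r ^ n := by
      rw [div_le_iff₀ hε]
      have := pow_sub_bound n hρ0.le hρρ.le hρ'r.le
      linarith
    have h2 : ρ ^ n ≤ r ^ n := pow_le_pow_left₀ hρ0.le hρr.le n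
    have h3 : ρ' ^ n ≤ r ^ n := pow_le_pow_left₀ hρ'0.le hρ'r.le n
    have hK0 : (0 : ℝ) ≤ K := K.2
    have h4 : (1 + 2 * K) * ρ' ^ n ≤ (1 + 2 * K) * r ^ n :=
      mul_le_mul_of_nonneg_left h3 (by positivity)
    have e : A = v * (ρ ^ n + (1 + 2 * K) * ρ' ^ n
        + 2 * ((ρ' ^ n - ρ ^ n) * r / (ρ' - ρ))) := by
      rw [hA, hdiff, hV, vol_ball hρ0, vol_ball hρ'0]
      ring
    rw [e, mul_assoc v]
    refine mul_le_mul_of_nonneg_left ?_ hv0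
    linarith
  calc M * A ≤ M * (v * (2 + 2 * K + 2 * n) * r ^ n) := mul_le_mul_of_nonneg_left hAle hM0
    _ = _ := by ring

end LRP

end Helpers

theorem lower_region_perimeter_bound
    (n : ℕ) (K : ℝ) (hK : 0 ≤ K) :
    ∃ c > (0 : ℝ), ∀ (Ω : Set (EuclideanSpace ℝ (Fin n)))
      (l u : EuclideanSpace ℝ (Fin n) → ℝ),
      Ω.Nonempty → IsOpen Ω → Convex ℝ Ω → Ω ≠ univ →
      LocallyLipschitz l →
      ContDiffOn ℝ 2 u Ω → ContinuousOn u (closure Ω) →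
      MinimalSurfaceEq u Ω →
      (∀ x ∈ frontier Ω, u x = l x) →
      ∀ r > (0 : ℝ),
        (∀ x ∈ Metric.ball (0 : EuclideanSpace ℝ (Fin n)) r,
         ∀ y ∈ Metric.ball (0 : EuclideanSpace ℝ (Fin n)) r,
          |l x - l y| ≤ K * ‖x - y‖) →
        ∀ X : EuclideanSpace ℝ (Fin (n + 1)) → EuclideanSpace ℝ (Fin (n + 1)),
          ContDiff ℝ 1 X → HasCompactSupport X →
          tsupport X ⊆ Metric.ball (0 : EuclideanSpace ℝ (Fin (n + 1))) r →
          |∫ p in lowerRegion Ω l u, divg X p| ≤ c * (⨆ p, ‖X p‖) * r ^ n := by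
  refine ⟨volume.real (ball (0 : EuclideanSpace ℝ (Fin n)) 1) * (2 + 2 * K + 2 * n), ?_, ?_⟩
  · have hv : 0 < volume.real (ball (0 : EuclideanSpace ℝ (Fin n)) 1) :=
      ENNReal.toReal_pos (measure_ball_pos _ _ one_pos).ne' measure_ball_lt_top.ne
    positivity
  intro Ω l u _ hΩ _ _ hl hu huc hmse hbd r hr hlip X hX hc hs
  lift K to NNReal using hK
  refine LRP.bound hΩ hl.continuous hu huc hmse hbd hr (K := K)
    (LipschitzOnWith.of_dist_le_mul fun x hx y hy => ?_) hX hc hs ?_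
  · rw [Real.dist_eq, dist_eq_norm]
    exact hlip x hx y hy
  · intro p
    obtain ⟨C, hC⟩ := hX.continuous.bounded_above_of_compact_support hc
    exact le_ciSup (f := fun p => ‖X p‖) ⟨C, by rintro _ ⟨q, rfl⟩; exact hC q⟩ p
end

section
/- Let Ω be a nonempty open convex proper subset of ℝⁿ which is neither an open half-space nor an open slab (the open region strictly between two distinct parallel hyperplanes). Then there exist a point x₀ ∈ ℝⁿ and an open convex cone C ⊆ ℝⁿ with vertex at the origin (i.e. C is open, convex, and closed under multiplication by positive scalars) such that C is a proper subset of some open half-space { x : v·x > 0 } (v ≠ 0), and Ω ⊆ x₀ + C. -/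
open Set Metric
open scoped RealInnerProductSpace

theorem aux_solve {n : ℕ} (v w : EuclideanSpace ℝ (Fin n)) (hv : v ≠ 0)
    (hw : ∀ t : ℝ, w ≠ t • v) (α β : ℝ) :
    ∃ x : EuclideanSpace ℝ (Fin n), ⟪v, x⟫ = α ∧ ⟪w, x⟫ = β := by
  have hvv : ⟪v, v⟫ ≠ 0 := inner_self_ne_zero.mpr hv
  obtain ⟨r, hr⟩ : ∃ r : ℝ, r = ⟪v, w⟫ / ⟪v, v⟫ := ⟨_, rfl⟩
  obtain ⟨u, hu⟩ : ∃ u, u = w - r • v := ⟨_, rfl⟩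
  have hu0 : u ≠ 0 := by
    rw [hu]; exact sub_ne_zero.mpr (hw r)
  have huu : ⟪u, u⟫ ≠ 0 := inner_self_ne_zero.mpr hu0
  have hvu : ⟪v, u⟫ = 0 := by
    rw [hu, inner_sub_right, inner_smul_right, hr]
    field_simp
    ring
  have hwe : w = u + r • v := by rw [hu]; abel
  have hwu : ⟪w, u⟫ = ⟪u, u⟫ := by
    conv_lhs => rw [hwe]
    rw [inner_add_left, real_inner_smul_left, hvu]; ring
  refine ⟨(α / ⟪v, v⟫) • v + ((β - α / ⟪v, v⟫ * ⟪w, v⟫) / ⟪u, u⟫) • u, ?_, ?_⟩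
  · rw [inner_add_right, inner_smul_right, inner_smul_right, hvu]
    field_simp
    ring
  · rw [inner_add_right, inner_smul_right, inner_smul_right, hwu]
    rw [div_mul_cancel₀ _ huu]
    ring

theorem aux_sep {n : ℕ} (Ω : Set (EuclideanSpace ℝ (Fin n)))
    (hne : Ω.Nonempty) (hopen : IsOpen Ω) (hconv : Convex ℝ Ω)
    (p : EuclideanSpace ℝ (Fin n)) (hp : p ∉ Ω) :
    ∃ w : EuclideanSpace ℝ (Fin n), w ≠ 0 ∧ ∀ x ∈ Ω, ⟪w, p⟫ < ⟪w, x⟫ := by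
  obtain ⟨f, hf⟩ := geometric_hahn_banach_open_point hconv hopen hp
  have key : ∀ x ∈ Ω, ⟪-((InnerProductSpace.toDual ℝ _).symm f), p⟫
      < ⟪-((InnerProductSpace.toDual ℝ _).symm f), x⟫ := by
    intro x hx
    rw [inner_neg_left, inner_neg_left, InnerProductSpace.toDual_symm_apply,
      InnerProductSpace.toDual_symm_apply]
    linarith [hf x hx]
  refine ⟨_, ?_, key⟩
  intro h0
  obtain ⟨x, hx⟩ := hne
  have := key x hx
  rw [h0] at this
  simp at this

theorem convex_not_halfspace_not_slab_in_cone
    (n : ℕ) (Ω : Set (EuclideanSpace ℝ (Fin n)))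
    (hne : Ω.Nonempty) (hopen : IsOpen Ω) (hconv : Convex ℝ Ω) (hproper : Ω ≠ univ)
    (hnothalf : ¬ ∃ (v : EuclideanSpace ℝ (Fin n)) (c : ℝ), v ≠ 0 ∧
      Ω = {x | c < ⟪v, x⟫})
    (hnotslab : ¬ ∃ (v : EuclideanSpace ℝ (Fin n)) (c₁ c₂ : ℝ), v ≠ 0 ∧ c₁ < c₂ ∧
      Ω = {x | c₁ < ⟪v, x⟫ ∧ ⟪v, x⟫ < c₂}) :
    ∃ (x₀ : EuclideanSpace ℝ (Fin n)) (C : Set (EuclideanSpace ℝ (Fin n))),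
      IsOpen C ∧ Convex ℝ C ∧
      (∀ x ∈ C, ∀ t : ℝ, 0 < t → t • x ∈ C) ∧
      (∃ v : EuclideanSpace ℝ (Fin n), v ≠ 0 ∧
        C ⊆ {x | 0 < ⟪v, x⟫} ∧ C ≠ {x | 0 < ⟪v, x⟫}) ∧
      Ω ⊆ (fun y => x₀ + y) '' C := by
  obtain ⟨z, hz⟩ := (ne_univ_iff_exists_notMem Ω).mp hproper
  obtain ⟨v, hv, hvz⟩ := aux_sep Ω hne hopen hconv z hz
  by_cases H : ∃ (w p : EuclideanSpace ℝ (Fin n)), (∀ t : ℝ, w ≠ t • v) ∧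
      ∀ x ∈ Ω, ⟪w, p⟫ < ⟪w, x⟫
  · obtain ⟨w, p, hw, hwp⟩ := H
    obtain ⟨x₀, h1, h2⟩ := aux_solve v w hv hw ⟪v, z⟫ ⟪w, p⟫
    obtain ⟨y, hy1, hy2⟩ := aux_solve v w hv hw 1 0
    refine ⟨x₀, {x | 0 < ⟪v, x⟫} ∩ {x | 0 < ⟪w, x⟫}, ?_, ?_, ?_, ⟨v, hv, inter_subset_left, ?_⟩, ?_⟩
    · exact (isOpen_lt (by fun_prop) (by fun_prop)).inter (isOpen_lt (by fun_prop) (by fun_prop))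
    · exact (convex_halfSpace_gt (innerSL ℝ v).isLinear 0).inter
        (convex_halfSpace_gt (innerSL ℝ w).isLinear 0)
    · rintro x ⟨hx1, hx2⟩ t ht
      simp only [mem_inter_iff, mem_ofPred_eq, inner_smul_right] at *
      exact ⟨mul_pos ht hx1, mul_pos ht hx2⟩
    · intro h
      have : y ∈ {x | 0 < ⟪v, x⟫} := by simp [hy1]
      rw [← h] at this
      have h3 := this.2
      simp [hy2] at h3
    · intro x hx
      refine ⟨x - x₀, ⟨?_, ?_⟩, by simp⟩
      · have := hvz x hx
        simp only [mem_ofPred_eq, inner_sub_right]; linarith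
      · have := hwp x hx
        simp only [mem_ofPred_eq, inner_sub_right]; linarith
  · exfalso
    push Not at H
    obtain ⟨S, hS⟩ : ∃ S : Set ℝ, S = (innerSL ℝ v) '' Ω := ⟨_, rfl⟩
    have hmem : ∀ x, x ∈ Ω ↔ ⟪v, x⟫ ∈ S := by
      intro q
      constructor
      · intro h; rw [hS]; exact ⟨q, h, rfl⟩
      · intro h
        rw [hS] at h
        obtain ⟨x, hx, hxq⟩ := h
        have hxq' : ⟪v, x⟫ = ⟪v, q⟫ := hxq
        by_contra hq
        obtain ⟨w, hw, hwq⟩ := aux_sep Ω hne hopen hconv q hq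
        by_cases ht : ∃ t : ℝ, w = t • v
        · obtain ⟨t, rfl⟩ := ht
          have := hwq x hx
          rw [real_inner_smul_left, real_inner_smul_left, hxq'] at this
          exact lt_irrefl _ this
        · push Not at ht
          obtain ⟨x', hx', h'⟩ := H w q ht
          exact absurd (hwq x' hx') (not_lt.mpr h')
    have hSne : S.Nonempty := by rw [hS]; exact hne.image _
    have hSo : IsOpen S := by
      rw [hS]
      refine (innerSL ℝ v).isOpenMap_of_ne_zero ?_ _ hopen
      intro h0
      have : innerSL ℝ v v = 0 := by rw [h0]; rfl
      exact hv (inner_self_eq_zero.mp this)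
    have hSc : IsPreconnected S := by
      rw [hS]
      exact hconv.isPreconnected.image _ (innerSL ℝ v).continuous.continuousOn
    have hSb : BddBelow S := by
      refine ⟨⟪v, z⟫, ?_⟩
      rw [hS]
      rintro _ ⟨x, hx, rfl⟩
      exact (hvz x hx).le
    by_cases hSa : BddAbove S
    · have hE : S = Ioo (sInf S) (sSup S) := by
        apply Subset.antisymm
        · rw [← interior_Icc]
          exact interior_maximal (subset_Icc_csInf_csSup hSb hSa) hSo
        · exact IsConnected.Ioo_csInf_csSup_subset ⟨hSne, hSc⟩ hSb hSa
      refine hnotslab ⟨v, sInf S, sSup S, hv, ?_, ?_⟩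
      · obtain ⟨s, hs⟩ := hSne
        rw [hE] at hs
        exact hs.1.trans hs.2
      · ext x
        rw [hmem x]
        exact Set.ext_iff.mp hE _
    · have hE : S = Ioi (sInf S) := by
        apply Subset.antisymm
        · rw [← interior_Ici]
          exact interior_maximal (fun s hs => csInf_le hSb hs) hSo
        · exact hSc.Ioi_csInf_subset hSb hSa
      refine hnothalf ⟨v, sInf S, hv, ?_⟩
      ext x
      rw [hmem x]
      exact Set.ext_iff.mp hE _
end
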